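/- Assume additionally r > 0, q ≥ 0, 0 < β < 1, and that Γ₁ satisfies the exterior sphere condition. Let α ∈ (0,1), let f ∈ C^α(O) obey the elliptic growth condition, and let g be continuous on ∂O and obey the elliptic growth condition. Then there exists a function u, continuous on cl(O) and belonging to C^{2+α}(O), which obeys the elliptic growth condition on O and satisfies A u = f on O and u = g on ∂O. -/

import Mathlib

open Real Set MeasureTheory

noncomputable section

/-- First directional derivative of `u` at `z` in direction `v`. -/
def D1 (u : ℝ × ℝ → ℝ) (z v : ℝ × ℝ) : ℝ := fderiv ℝ u z v

/-- Second directional derivative of `u` at `z` in directions `v`, `w`. -/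
def D2 (u : ℝ × ℝ → ℝ) (z v w : ℝ × ℝ) : ℝ := fderiv ℝ (fun z' => fderiv ℝ u z' v) z w

/-- The elliptic Heston operator
`(Au)(x,y) = −(y/2)(u_xx + 2ρσ u_xy + σ² u_yy) − (r − q − y/2) u_x − κ(θ − y) u_y + r u`. -/
def hestonA (σ ρ κ θ q r : ℝ) (u : ℝ × ℝ → ℝ) (z : ℝ × ℝ) : ℝ :=
  -(z.2 / 2) * (D2 u z (1, 0) (1, 0) + 2 * ρ * σ * D2 u z (1, 0) (0, 1)
      + σ ^ 2 * D2 u z (0, 1) (0, 1))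
    - (r - q - z.2 / 2) * D1 u z (1, 0) - κ * (θ - z.2) * D1 u z (0, 1) + r * u z

/-- The open upper half-plane `ℍ = ℝ × (0,∞)`. -/
def HH : Set (ℝ × ℝ) := {z | 0 < z.2}

/-- `Γ₁ = ∂O ∩ ℍ`. -/
def Gamma1 (O : Set (ℝ × ℝ)) : Set (ℝ × ℝ) := frontier O ∩ HH

/-- `Γ₀`: the interior, relative to `∂ℍ = ℝ × {0}`, of `∂ℍ ∩ ∂O`. -/
def Gamma0 (O : Set (ℝ × ℝ)) : Set (ℝ × ℝ) :=
  {z | z.2 = 0 ∧ z.1 ∈ interior {x : ℝ | (x, (0 : ℝ)) ∈ frontier O}}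

/-- The elliptic growth condition: `|v(x,y)| ≤ C (1 + e^{M₁ y} + e^{M₂ x})` on `S`,
with `0 ≤ M₁ < min (r/(κθ)) μ`, `μ = 2κ/σ²`, and `M₂ ∈ [0,1)`. -/
def ellGrowth (σ κ θ r : ℝ) (S : Set (ℝ × ℝ)) (v : ℝ × ℝ → ℝ) : Prop :=
  ∃ C M₁ M₂ : ℝ, 0 < C ∧ 0 ≤ M₁ ∧ M₁ < min (r / (κ * θ)) (2 * κ / σ ^ 2) ∧
    0 ≤ M₂ ∧ M₂ < 1 ∧ ∀ z ∈ S, |v z| ≤ C * (1 + exp (M₁ * z.2) + exp (M₂ * z.1))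

/-- `v` is uniformly `α`-Hölder continuous on `S`. -/
def holderOn (α : ℝ) (S : Set (ℝ × ℝ)) (v : ℝ × ℝ → ℝ) : Prop :=
  ∃ C : ℝ, ∀ z ∈ S, ∀ w ∈ S, |v z - v w| ≤ C * dist z w ^ α

/-- `v` is locally `α`-Hölder continuous on `S` (Hölder on every compact subset). -/
def locHolderOn (α : ℝ) (S : Set (ℝ × ℝ)) (v : ℝ × ℝ → ℝ) : Prop :=
  ∀ K : Set (ℝ × ℝ), IsCompact K → K ⊆ S → holderOn α K v

/-- `u ∈ C^{2+α}(O)`: twice continuously differentiable on the open set `O` with all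
derivatives through order two locally `α`-Hölder continuous on `O`. -/
def C2alphaOn (α : ℝ) (O : Set (ℝ × ℝ)) (u : ℝ × ℝ → ℝ) : Prop :=
  ContDiffOn ℝ 2 u O ∧ locHolderOn α O u ∧
  (∀ v, locHolderOn α O fun z => D1 u z v) ∧
  (∀ v w, locHolderOn α O fun z => D2 u z v w)

/-- The boundary portion `Γ` of `O` satisfies the exterior sphere condition: for every
`z₀ ∈ Γ` there is a closed Euclidean ball meeting `cl(O)` exactly at `z₀`. -/
def extSphere (O Γ : Set (ℝ × ℝ)) : Prop :=
  ∀ z₀ ∈ Γ, ∃ c : ℝ × ℝ, ∃ R : ℝ, 0 < R ∧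
    {z : ℝ × ℝ | Real.sqrt ((z.1 - c.1) ^ 2 + (z.2 - c.2) ^ 2) ≤ R} ∩ closure O = {z₀}

section Part1
open Real Set MeasureTheory
open Filter Topology
open scoped ContDiff

/-- Directional derivative operator. -/
def dd (v : ℝ × ℝ) (u : ℝ × ℝ → ℝ) : ℝ × ℝ → ℝ := fun z => fderiv ℝ u z v

lemma D1_eq_dd (u : ℝ × ℝ → ℝ) (z v : ℝ × ℝ) : D1 u z v = dd v u z := rfl
lemma D2_eq_dd (u : ℝ × ℝ → ℝ) (z v w : ℝ × ℝ) : D2 u z v w = dd w (dd v u) z := rfl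

lemma dd_smooth {v : ℝ × ℝ} {u : ℝ × ℝ → ℝ} (hu : ContDiff ℝ ∞ u) : ContDiff ℝ ∞ (dd v u) := by
  have : ContDiff ℝ ∞ (fderiv ℝ u) := hu.fderiv_right (by simp)
  exact this.clm_apply contDiff_const

lemma dd_cs {v : ℝ × ℝ} {u : ℝ × ℝ → ℝ} (hu : HasCompactSupport u) : HasCompactSupport (dd v u) :=
  hu.fderiv_apply (𝕜 := ℝ) v

/-- cut-off step -/
def stepS (t : ℝ) : ℝ := Real.smoothTransition (2 * t - 1)

lemma stepS_smooth : ContDiff ℝ ∞ stepS := by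
  unfold stepS
  exact (Real.smoothTransition.contDiff (n := ⊤)).comp ((contDiff_const.mul contDiff_id).sub contDiff_const)

lemma stepS_zero {t : ℝ} (h : t ≤ 1/2) : stepS t = 0 :=
  Real.smoothTransition.zero_of_nonpos (by linarith)
lemma stepS_one {t : ℝ} (h : 1 ≤ t) : stepS t = 1 :=
  Real.smoothTransition.one_of_one_le (by linarith)
lemma stepS_mono : Monotone stepS := by
  intro a b hab
  exact Real.smoothTransition.monotone (by linarith)

def kerh (t : ℝ) : ℝ := stepS t / t

lemma kerh_smooth : ContDiff ℝ ∞ kerh := by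
  rw [contDiff_iff_contDiffAt]
  intro t
  by_cases ht : t = 0
  · have : kerh =ᶠ[𝓝 t] fun _ => 0 := by
      have : Iio (1/2:ℝ) ∈ 𝓝 t := Iio_mem_nhds (by rw [ht]; norm_num)
      filter_upwards [this] with s hs
      simp [kerh, stepS_zero (le_of_lt hs)]
    exact contDiffAt_const.congr_of_eventuallyEq this
  · exact stepS_smooth.contDiffAt.div contDiffAt_id ht

lemma kerh_mul (t : ℝ) : t * kerh t = stepS t := by
  by_cases ht : t = 0
  · subst ht; simp [stepS_zero]
  · unfold kerh; field_simp

def kerH (t : ℝ) : ℝ := ∫ τ in (1:ℝ)..t, kerh τ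

lemma kerH_hasDeriv (t : ℝ) : HasDerivAt kerH (kerh t) t :=
  intervalIntegral.integral_hasDerivAt_right (kerh_smooth.continuous.intervalIntegrable _ _)
    (kerh_smooth.continuous.stronglyMeasurableAtFilter _ _) kerh_smooth.continuous.continuousAt

lemma kerH_smooth : ContDiff ℝ ∞ kerH := by
  rw [contDiff_infty_iff_deriv]
  refine ⟨fun t => (kerH_hasDeriv t).differentiableAt, ?_⟩
  have : deriv kerH = kerh := funext fun t => (kerH_hasDeriv t).deriv
  rw [this]; exact kerh_smooth

lemma kerH_log {t : ℝ} (ht : 1 ≤ t) : kerH t = Real.log t := by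
  unfold kerH
  have : ∫ τ in (1:ℝ)..t, kerh τ = ∫ τ in (1:ℝ)..t, τ⁻¹ := by
    apply intervalIntegral.integral_congr
    intro τ hτ
    rw [uIcc_of_le ht] at hτ
    simp [kerh, stepS_one hτ.1]
  rw [this, integral_inv_of_pos one_pos (by linarith)]
  simp

/-- The frame data: two vectors with dual functionals. -/
structure Frame (e₁ e₂ : ℝ × ℝ) (X Y : (ℝ × ℝ) →L[ℝ] ℝ) : Prop where
  X1 : X e₁ = 1
  X2 : X e₂ = 0
  Y1 : Y e₁ = 0
  Y2 : Y e₂ = 1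
  sp : ∀ z, z = X z • e₁ + Y z • e₂

section
variable {e₁ e₂ : ℝ × ℝ} {X Y : (ℝ × ℝ) →L[ℝ] ℝ}

lemma dd_comp_q (F : ℝ → ℝ) (F' : ℝ → ℝ) (hF : ∀ t, HasDerivAt F (F' t) t) (c : ℝ) (v : ℝ × ℝ) :
    dd v (fun z => F (c * (X z ^ 2 + Y z ^ 2))) =
      fun z => F' (c * (X z ^ 2 + Y z ^ 2)) * (c * (2 * X z * X v + 2 * Y z * Y v)) := by
  funext z
  have h1 : HasFDerivAt (fun z => c * (X z ^ 2 + Y z ^ 2))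
      (c • ((2 * X z) • X + (2 * Y z) • Y)) z := by
    have hX := (X.hasFDerivAt (x := z)).pow 2
    have hY := (Y.hasFDerivAt (x := z)).pow 2
    exact ((hX.fun_add hY).const_mul c).congr_fderiv (by simp)
  have h2 := (hF (c * (X z ^ 2 + Y z ^ 2))).comp_hasFDerivAt z h1
  unfold dd
  rw [show (fun z => F (c * (X z ^ 2 + Y z ^ 2))) = F ∘ (fun z => c * (X z ^ 2 + Y z ^ 2)) from rfl,
    h2.fderiv]
  simp
  ring

lemma lap_comp_q (hfr : Frame e₁ e₂ X Y) (c : ℝ) (z : ℝ × ℝ) :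
    dd e₁ (dd e₁ (fun z => kerH (c * (X z ^ 2 + Y z ^ 2)))) z +
    dd e₂ (dd e₂ (fun z => kerH (c * (X z ^ 2 + Y z ^ 2)))) z =
      4 * c * deriv stepS (c * (X z ^ 2 + Y z ^ 2)) := by
  rw [dd_comp_q kerH kerh kerH_hasDeriv, dd_comp_q kerH kerh kerH_hasDeriv]
  have hk : ∀ t, HasDerivAt kerh (deriv kerh t) t := fun t =>
    (kerh_smooth.differentiable (by simp) t).hasDerivAt
  have key : ∀ v, dd v (fun z => kerh (c * (X z ^ 2 + Y z ^ 2))) z =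
      deriv kerh (c * (X z ^ 2 + Y z ^ 2)) * (c * (2 * X z * X v + 2 * Y z * Y v)) := by
    intro v; rw [dd_comp_q kerh (deriv kerh) hk]
  have hd : DifferentiableAt ℝ (fun z => kerh (c * (X z ^ 2 + Y z ^ 2))) z := by
    have := kerh_smooth.differentiable (by simp)
    fun_prop
  have hS : deriv stepS (c * (X z ^ 2 + Y z ^ 2)) = kerh (c * (X z ^ 2 + Y z ^ 2)) +
      (c * (X z ^ 2 + Y z ^ 2)) * deriv kerh (c * (X z ^ 2 + Y z ^ 2)) := by
    have h1 : stepS = fun t => t * kerh t := funext fun t => (kerh_mul t).symm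
    rw [h1]
    have := (hasDerivAt_id (c * (X z ^ 2 + Y z ^ 2))).mul (hk (c * (X z ^ 2 + Y z ^ 2)))
    rw [show (fun t => t * kerh t) = id * kerh from rfl, this.deriv]; simp
  have prod : ∀ v, ∀ G : (ℝ × ℝ) →L[ℝ] ℝ,
      dd v (fun z => kerh (c * (X z ^ 2 + Y z ^ 2)) * (c * (2 * G z))) z =
      kerh (c * (X z ^ 2 + Y z ^ 2)) * (c * (2 * G v)) +
      (c * (2 * G z)) * dd v (fun z => kerh (c * (X z ^ 2 + Y z ^ 2))) z := by
    intro v G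
    have hG : HasFDerivAt (fun z => c * (2 * G z)) (c • (2:ℝ) • G) z :=
      ((G.hasFDerivAt (x := z)).const_mul 2).const_mul c
    have := hd.hasFDerivAt.mul hG
    unfold dd
    rw [show (fun z => kerh (c * (X z ^ 2 + Y z ^ 2)) * (c * (2 * G z))) =
      (fun z => kerh (c * (X z ^ 2 + Y z ^ 2))) * (fun z => c * (2 * G z)) from rfl, this.fderiv]
    simp
  simp only [hfr.X1, hfr.X2, hfr.Y1, hfr.Y2, mul_one, mul_zero, add_zero, zero_add]
  rw [prod, prod, key, key, hS]
  simp only [hfr.X1, hfr.X2, hfr.Y1, hfr.Y2, mul_one, mul_zero, add_zero, zero_add]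
  ring

lemma q_cs (hfr : Frame e₁ e₂ X Y) {F : ℝ → ℝ} (hF : ∀ t, 1 < t → F t = 0) :
    HasCompactSupport (fun z => F (X z ^ 2 + Y z ^ 2)) := by
  apply HasCompactSupport.intro (K := Metric.closedBall 0 (‖e₁‖ + ‖e₂‖)) (isCompact_closedBall _ _)
  intro z hz
  apply hF
  by_contra hcon
  push Not at hcon
  apply hz
  have hX : |X z| ≤ 1 := by rw [← sq_le_one_iff_abs_le_one]; nlinarith [sq_nonneg (Y z)]
  have hY : |Y z| ≤ 1 := by rw [← sq_le_one_iff_abs_le_one]; nlinarith [sq_nonneg (X z)]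
  rw [mem_closedBall_zero_iff, hfr.sp z]
  refine (norm_add_le _ _).trans ?_
  rw [norm_smul, norm_smul, Real.norm_eq_abs, Real.norm_eq_abs]
  nlinarith [norm_nonneg e₁, norm_nonneg e₂]

/-- Multi-scale kernel. -/
theorem exists_kernel (hfr : Frame e₁ e₂ X Y) :
    ∃ lam rho : ℝ × ℝ → ℝ, ContDiff ℝ ∞ lam ∧ HasCompactSupport lam ∧
      ContDiff ℝ ∞ rho ∧ HasCompactSupport rho ∧ (∫ z, rho z) = 1 ∧
      ∀ z, dd e₁ (dd e₁ lam) z + dd e₂ (dd e₂ lam) z = 4 * rho ((2:ℝ) • z) - rho z := by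
  let ρ₀ : ℝ × ℝ → ℝ := fun z => 4 * deriv stepS (X z ^ 2 + Y z ^ 2)
  let l₀ : ℝ × ℝ → ℝ := fun z => kerH (4 * (X z ^ 2 + Y z ^ 2)) - kerH (1 * (X z ^ 2 + Y z ^ 2)) - Real.log 4
  have hds : ContDiff ℝ ∞ (deriv stepS) := (contDiff_infty_iff_deriv.1 stepS_smooth).2
  have hq : ContDiff ℝ ∞ (fun z => X z ^ 2 + Y z ^ 2) := by fun_prop
  have hρs : ContDiff ℝ ∞ ρ₀ := contDiff_const.mul (hds.comp hq)
  have hls : ContDiff ℝ ∞ l₀ :=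
    ((kerH_smooth.comp (contDiff_const.mul hq)).sub
      (kerH_smooth.comp (contDiff_const.mul hq))).sub contDiff_const
  have hρc : HasCompactSupport ρ₀ := by
    apply q_cs hfr (F := fun t => 4 * deriv stepS t)
    intro t ht
    have : stepS =ᶠ[𝓝 t] fun _ => 1 := by
      filter_upwards [Ioi_mem_nhds ht] with s hs using stepS_one (le_of_lt hs)
    simp [this.deriv_eq]
  have hlc : HasCompactSupport l₀ := by
    apply q_cs hfr (F := fun t => kerH (4 * t) - kerH (1 * t) - Real.log 4)
    intro t ht
    rw [kerH_log (by linarith), kerH_log (by linarith), Real.log_mul (by norm_num) (by linarith)]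
    simp
  have hpos : 0 < ∫ z, ρ₀ z := by
    obtain ⟨ξ, hξ, hξ'⟩ := exists_deriv_eq_slope stepS (show (1/2:ℝ) < 1 by norm_num)
      stepS_smooth.continuous.continuousOn (stepS_smooth.differentiable (by simp)).differentiableOn
    rw [stepS_one le_rfl, stepS_zero le_rfl] at hξ'
    have hne : ρ₀ (Real.sqrt ξ • e₁) ≠ 0 := by
      simp only [ρ₀, map_smul, hfr.X1, hfr.Y1, smul_eq_mul]
      rw [mul_one, mul_zero, Real.sq_sqrt (by linarith [hξ.1])]
      norm_num [hξ']
    refine Continuous.integral_pos_of_hasCompactSupport_nonneg_nonzero hρs.continuous hρc ?_ hne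
    intro z
    have : 0 ≤ deriv stepS (X z ^ 2 + Y z ^ 2) := stepS_mono.deriv_nonneg
    simp only [ρ₀, Pi.zero_apply]; linarith
  set m := ∫ z, ρ₀ z with hm
  have hlap : ∀ z, dd e₁ (dd e₁ l₀) z + dd e₂ (dd e₂ l₀) z = 4 * ρ₀ ((2:ℝ) • z) - ρ₀ z := by
    intro z
    have s1 : ContDiff ℝ ∞ (fun z => kerH (4 * (X z ^ 2 + Y z ^ 2))) :=
      kerH_smooth.comp (contDiff_const.mul hq)
    have s2 : ContDiff ℝ ∞ (fun z => kerH (1 * (X z ^ 2 + Y z ^ 2))) :=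
      kerH_smooth.comp (contDiff_const.mul hq)
    have sub1 : ∀ v, dd v l₀ = fun z => dd v (fun z => kerH (4 * (X z ^ 2 + Y z ^ 2))) z
        - dd v (fun z => kerH (1 * (X z ^ 2 + Y z ^ 2))) z := by
      intro v
      funext z
      simp only [dd, l₀]
      rw [fderiv_sub_const]
      erw [fderiv_sub (s1.differentiable (by simp) z) (s2.differentiable (by simp) z)]
      simp
    have sub2 : ∀ v, dd v (dd v l₀) z = dd v (dd v (fun z => kerH (4 * (X z ^ 2 + Y z ^ 2)))) z
        - dd v (dd v (fun z => kerH (1 * (X z ^ 2 + Y z ^ 2)))) z := by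
      intro v
      rw [sub1 v]
      have t1 := (dd_smooth (v := v) s1).differentiable (by simp) z
      have t2 := (dd_smooth (v := v) s2).differentiable (by simp) z
      conv_lhs => unfold dd
      erw [fderiv_sub t1 t2]
      simp [dd]
    have l1 := lap_comp_q hfr 4 z
    have l2 := lap_comp_q hfr 1 z
    rw [sub2, sub2]
    have e : (X ((2:ℝ) • z)) ^ 2 + (Y ((2:ℝ) • z)) ^ 2 = 4 * (X z ^ 2 + Y z ^ 2) := by
      simp only [map_smul, smul_eq_mul]; ring
    simp only [ρ₀, e]
    rw [one_mul] at l2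
    linarith
  refine ⟨fun z => m⁻¹ * l₀ z, fun z => m⁻¹ * ρ₀ z, contDiff_const.mul hls, hlc.mul_left,
    contDiff_const.mul hρs, hρc.mul_left, ?_, ?_⟩
  · rw [integral_const_mul, ← hm, inv_mul_cancel₀ hpos.ne']
  · intro z
    have sm : ∀ (u : ℝ × ℝ → ℝ), ContDiff ℝ ∞ u → ∀ v, dd v (fun z => m⁻¹ * u z) = fun z => m⁻¹ * dd v u z := by
      intro u hu v
      funext z
      have : HasFDerivAt (fun z => m⁻¹ * u z) (m⁻¹ • fderiv ℝ u z) z :=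
        (hu.differentiable (by simp) z).hasFDerivAt.const_mul _
      simp [dd, this.fderiv]
    rw [sm _ hls, sm _ hls, sm _ (dd_smooth hls), sm _ (dd_smooth hls)]
    have := hlap z
    simp only []
    linear_combination m⁻¹ * this

end
end Part1

section Part2
open Real Set MeasureTheory
open Filter Topology
open scoped ContDiff

lemma dd_add {v z : ℝ × ℝ} {a b : ℝ × ℝ → ℝ} (ha : DifferentiableAt ℝ a z)
    (hb : DifferentiableAt ℝ b z) : dd v (fun z => a z + b z) z = dd v a z + dd v b z := by
  simp [dd, fderiv_fun_add ha hb]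

lemma dd_sub {v z : ℝ × ℝ} {a b : ℝ × ℝ → ℝ} (ha : DifferentiableAt ℝ a z)
    (hb : DifferentiableAt ℝ b z) : dd v (fun z => a z - b z) z = dd v a z - dd v b z := by
  simp [dd, fderiv_fun_sub ha hb]

lemma dd_mul {v z : ℝ × ℝ} {a b : ℝ × ℝ → ℝ} (ha : DifferentiableAt ℝ a z)
    (hb : DifferentiableAt ℝ b z) :
    dd v (fun z => a z * b z) z = a z * dd v b z + b z * dd v a z := by
  simp [dd, fderiv_fun_mul ha hb]

lemma dd_const_mul {v z : ℝ × ℝ} {a : ℝ × ℝ → ℝ} (c : ℝ) (ha : DifferentiableAt ℝ a z) :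
    dd v (fun z => c * a z) z = c * dd v a z := by
  simp [dd, fderiv_const_mul ha c]

lemma dd_neg {v z : ℝ × ℝ} {a : ℝ × ℝ → ℝ} :
    dd v (fun z => - a z) z = - dd v a z := by
  simp [dd]

lemma dd_const {v z : ℝ × ℝ} (c : ℝ) : dd v (fun _ => c) z = 0 := by
  simp [dd]

lemma dd_congr {v z : ℝ × ℝ} {a b : ℝ × ℝ → ℝ} (h : a =ᶠ[𝓝 z] b) : dd v a z = dd v b z := by
  simp [dd, h.fderiv_eq]

lemma dd_eventuallyEq {v z : ℝ × ℝ} {a b : ℝ × ℝ → ℝ} (h : a =ᶠ[𝓝 z] b) :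
    dd v a =ᶠ[𝓝 z] dd v b := by
  have := h.eventuallyEq_nhds
  filter_upwards [this] with w hw using dd_congr hw

lemma opnorm_le (L : (ℝ × ℝ) →L[ℝ] ℝ) : ‖L‖ ≤ |L (1, 0)| + |L (0, 1)| := by
  apply ContinuousLinearMap.opNorm_le_bound _ (by positivity)
  intro z
  have hz : z = z.1 • ((1:ℝ), (0:ℝ)) + z.2 • ((0:ℝ), (1:ℝ)) := by ext <;> simp
  have h1 : |z.1| ≤ ‖z‖ := norm_fst_le z
  have h2 : |z.2| ≤ ‖z‖ := norm_snd_le z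
  conv_lhs => rw [hz]
  rw [map_add, map_smul, map_smul, smul_eq_mul, smul_eq_mul, Real.norm_eq_abs]
  refine (abs_add_le _ _).trans ?_
  rw [abs_mul, abs_mul, add_mul]
  have := abs_nonneg (L (1,0))
  have := abs_nonneg (L (0,1))
  nlinarith

lemma dd_zero_integral {v : ℝ × ℝ} {φ : ℝ × ℝ → ℝ} (hφ : ContDiff ℝ ∞ φ)
    (hc : HasCompactSupport φ) : ∫ z, dd v φ z = 0 := by
  have hi : Integrable (dd v φ) volume :=
    (dd_smooth hφ).continuous.integrable_of_hasCompactSupport (dd_cs hc)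
  have := integral_smul_fderiv_eq_neg_fderiv_smul_of_integrable (μ := volume)
    (f := fun _ : ℝ × ℝ => (1:ℝ)) (g := φ) (v := v) (by simp)
    (by simp only [one_smul]; exact hi)
    (by simpa using hφ.continuous.integrable_of_hasCompactSupport hc)
    (by intro x _; fun_prop) (by intro x _; exact hφ.differentiable (by simp) x)
  simpa [dd] using this

/-- Integration by parts. -/
lemma dd_ibp {v : ℝ × ℝ} {φ ψ : ℝ × ℝ → ℝ} (hφ : ContDiff ℝ 1 φ)
    (hc : HasCompactSupport φ) (hψ : ∀ z ∈ tsupport φ, ContDiffAt ℝ 1 ψ z) :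
    ∫ z, ψ z * dd v φ z = - ∫ z, dd v ψ z * φ z := by
  have hdc : Continuous (dd v φ) := (hφ.continuous_fderiv (by simp)).clm_apply continuous_const
  have hcψ : ∀ z ∈ tsupport φ, ContinuousAt (dd v ψ) z := fun z hz =>
    ((hψ z hz).continuousAt_fderiv (by simp)).clm_apply continuousAt_const
  have i1 : Integrable (fun z => dd v ψ z * φ z) :=
    (continuous_of_tsupport fun z hz => (hcψ z (tsupport_mul_subset_right hz)).mul
      hφ.continuous.continuousAt).integrable_of_hasCompactSupport hc.mul_left
  have i2 : Integrable (fun z => ψ z * dd v φ z) :=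
    (continuous_of_tsupport fun z hz => ((hψ z (tsupport_fderiv_apply_subset ℝ v
      (tsupport_mul_subset_right hz))).continuousAt).mul
      hdc.continuousAt).integrable_of_hasCompactSupport (dd_cs hc).mul_left
  have i3 : Integrable (fun z => ψ z * φ z) :=
    (continuous_of_tsupport fun z hz => ((hψ z (tsupport_mul_subset_right hz)).continuousAt).mul
      hφ.continuous.continuousAt).integrable_of_hasCompactSupport hc.mul_left
  exact integral_smul_fderiv_eq_neg_fderiv_smul_of_integrable (μ := volume)
    (f := ψ) (g := φ) (v := v) i1 i2 i3
    (fun x hx => (hψ x hx).differentiableAt (by simp))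
    (fun x _ => hφ.differentiable (by simp) x)

/-- convolution with kernel `φ`. -/
def cv (φ g : ℝ × ℝ → ℝ) : ℝ × ℝ → ℝ := fun z => ∫ w, φ (z - w) * g w

lemma cv_eq (φ g : ℝ × ℝ → ℝ) : cv φ g = convolution g φ (ContinuousLinearMap.mul ℝ ℝ) volume := by
  funext z
  simp [cv, convolution_def, mul_comm]

lemma cv_smooth {φ g : ℝ × ℝ → ℝ} (hφ : ContDiff ℝ ∞ φ) (hc : HasCompactSupport φ)
    (hg : LocallyIntegrable g) : ContDiff ℝ ∞ (cv φ g) := by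
  rw [cv_eq]
  exact hc.contDiff_convolution_right (n := ⊤) _ hg hφ

lemma cv_comm (φ g : ℝ × ℝ → ℝ) : cv φ g = cv g φ := by
  funext z
  unfold cv
  rw [← integral_sub_left_eq_self (fun w => g (z - w) * φ w) volume z]
  simp [mul_comm]

lemma dd_cv {φ g : ℝ × ℝ → ℝ} (hφ : ContDiff ℝ 1 φ) (hc : HasCompactSupport φ)
    (hg : LocallyIntegrable g) (v : ℝ × ℝ) : dd v (cv φ g) = cv (dd v φ) g := by
  funext z
  have := hc.hasFDerivAt_convolution_right (ContinuousLinearMap.mul ℝ ℝ) (f := g) (μ := volume) hg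
    hφ z
  unfold dd
  rw [cv_eq, cv_eq, this.fderiv, convolution_precompR_apply _ hg (hc.fderiv ℝ) (hφ.continuous_fderiv (by simp))]

lemma cv_integrable {φ g : ℝ × ℝ → ℝ} (hφ : Continuous φ) (hc : HasCompactSupport φ)
    (hg : LocallyIntegrable g) (z : ℝ × ℝ) : Integrable (fun w => φ (z - w) * g w) := by
  have := hc.convolutionExists_right (ContinuousLinearMap.mul ℝ ℝ) hg hφ z
  simpa [ConvolutionExistsAt, mul_comm] using this

lemma cv_const_mul (c : ℝ) (φ g : ℝ × ℝ → ℝ) (z : ℝ × ℝ) :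
    cv (fun z => c * φ z) g z = c * cv φ g z := by
  simp only [cv, mul_assoc, integral_const_mul]

lemma cv_sub {φ ψ g : ℝ × ℝ → ℝ} (hφ : Continuous φ) (hc : HasCompactSupport φ)
    (hψ : Continuous ψ) (hcψ : HasCompactSupport ψ)
    (hg : LocallyIntegrable g) (z : ℝ × ℝ) :
    cv (fun z => φ z - ψ z) g z = cv φ g z - cv ψ g z := by
  simp only [cv, sub_mul]
  exact integral_sub (cv_integrable hφ hc hg z) (cv_integrable hψ hcψ hg z)

/-- scaled kernel -/
def sc (k : ℕ) (φ : ℝ × ℝ → ℝ) : ℝ × ℝ → ℝ := fun z => φ ((2:ℝ)^k • z)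

lemma sc_smooth {φ : ℝ × ℝ → ℝ} (hφ : ContDiff ℝ ∞ φ) (k : ℕ) : ContDiff ℝ ∞ (sc k φ) :=
  hφ.comp (contDiff_const_smul _)

lemma sc_cs {φ : ℝ × ℝ → ℝ} (hφ : HasCompactSupport φ) (k : ℕ) : HasCompactSupport (sc k φ) :=
  hφ.comp_smul (by positivity)

lemma dd_sc {φ : ℝ × ℝ → ℝ} (hφ : ContDiff ℝ ∞ φ) (k : ℕ) (v : ℝ × ℝ) :
    dd v (sc k φ) = fun z => 2^k * sc k (dd v φ) z := by
  funext z
  have h1 : HasFDerivAt (fun z : ℝ × ℝ => (2:ℝ)^k • z) ((2:ℝ)^k • ContinuousLinearMap.id ℝ (ℝ × ℝ)) z :=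
    (hasFDerivAt_id z).fun_const_smul _
  have h2 := ((hφ.differentiable (by simp) ((2:ℝ)^k • z)).hasFDerivAt).comp z h1
  have h3 : HasFDerivAt (sc k φ) _ z := h2
  simp only [dd]
  rw [h3.fderiv]
  simp [sc]
  rfl

lemma sc_integral (ψ : ℝ × ℝ → ℝ) (k : ℕ) (z : ℝ × ℝ) :
    ∫ w, sc k ψ (z - w) = (1/4)^k * ∫ w, ψ w := by
  rw [integral_sub_left_eq_self (fun w => sc k ψ w) volume z]
  unfold sc
  rw [Measure.integral_comp_smul]
  simp only [Module.finrank_prod, Module.finrank_self, smul_eq_mul]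
  congr 1
  rw [abs_of_pos (by positivity), ← pow_mul, mul_comm k, pow_mul, ← inv_pow]
  norm_num

lemma cv_sc_bound {ψ g : ℝ × ℝ → ℝ} {M : ℝ} (hψ : ContDiff ℝ ∞ ψ) (hc : HasCompactSupport ψ)
    (hgM : ∀ z, |g z| ≤ M) (k : ℕ) (z : ℝ × ℝ) :
    |cv (sc k ψ) g z| ≤ M * (∫ w, |ψ w|) * (1/4)^k := by
  have hi : Integrable (fun w => |sc k ψ (z - w)|) := by
    have := ((sc_smooth hψ k).continuous.integrable_of_hasCompactSupport (sc_cs hc k) (μ := volume)).comp_sub_left z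
    exact this.abs
  calc |cv (sc k ψ) g z| ≤ ∫ w, |sc k ψ (z - w)| * M := by
        unfold cv
        rw [← Real.norm_eq_abs]
        refine norm_integral_le_of_norm_le (hi.mul_const M) (Eventually.of_forall fun w => ?_)
        rw [Real.norm_eq_abs, abs_mul]
        exact mul_le_mul_of_nonneg_left (hgM w) (abs_nonneg _)
    _ = (1/4)^k * (∫ w, |ψ w|) * M := by
        rw [integral_mul_const]
        congr 1
        exact sc_integral (fun w => |ψ w|) k z
    _ = _ := by ring

lemma cv_sc_holder {ψ g : ℝ × ℝ → ℝ} {C α R : ℝ} (hψ : ContDiff ℝ ∞ ψ) (hc : HasCompactSupport ψ)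
    (h0 : ∫ w, ψ w = 0) (hR : ∀ z, ψ z ≠ 0 → ‖z‖ ≤ R) (hR0 : 0 ≤ R) (hC : 0 ≤ C) (hα : 0 ≤ α)
    (hg : LocallyIntegrable g)
    (hgH : ∀ z w, |g z - g w| ≤ C * dist z w ^ α) (k : ℕ) (z : ℝ × ℝ) :
    |cv (sc k ψ) g z| ≤ C * R ^ α * (∫ w, |ψ w|) * ((1/4)^k * (((1/2:ℝ))^k) ^ α) := by
  have hi0 := ((sc_smooth hψ k).continuous.integrable_of_hasCompactSupport (sc_cs hc k) (μ := volume)).comp_sub_left z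
  have hi : Integrable (fun w => |sc k ψ (z - w)|) := hi0.abs
  have e1 : cv (sc k ψ) g z = ∫ w, sc k ψ (z - w) * (g w - g z) := by
    simp only [mul_sub]
    rw [integral_sub (cv_integrable (sc_smooth hψ k).continuous (sc_cs hc k) hg z)
      (hi0.mul_const _), integral_mul_const, sc_integral, h0]
    simp [cv]
  rw [e1]
  calc |∫ w, sc k ψ (z - w) * (g w - g z)| ≤ ∫ w, |sc k ψ (z - w)| * (C * (R * (1/2)^k) ^ α) := by
        rw [← Real.norm_eq_abs]
        refine norm_integral_le_of_norm_le (hi.mul_const _) (Eventually.of_forall fun w => ?_)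
        rw [Real.norm_eq_abs, abs_mul]
        by_cases hz : sc k ψ (z - w) = 0
        · simp [hz]
        apply mul_le_mul_of_nonneg_left _ (abs_nonneg _)
        refine (hgH w z).trans ?_
        apply mul_le_mul_of_nonneg_left _ hC
        apply Real.rpow_le_rpow dist_nonneg _ hα
        have := hR _ hz
        rw [norm_smul, Real.norm_eq_abs, abs_of_pos (by positivity)] at this
        rw [dist_comm, dist_eq_norm, one_div, inv_pow, ← div_eq_mul_inv, le_div_iff₀ (by positivity)]
        linarith
    _ = (1/4)^k * (∫ w, |ψ w|) * (C * (R * (1/2)^k) ^ α) := by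
        rw [integral_mul_const]
        congr 1
        exact sc_integral (fun w => |ψ w|) k z
    _ = _ := by
        rw [Real.mul_rpow hR0 (by positivity)]; ring

lemma rpow_half (k : ℕ) (α : ℝ) : ((1/2:ℝ)^k)^α = ((1/2:ℝ)^α)^k := by
  rw [← Real.rpow_natCast, ← Real.rpow_natCast, ← Real.rpow_mul (by norm_num),
    ← Real.rpow_mul (by norm_num), mul_comm]

/-- Hölder continuity of multi-scale series. -/
lemma ser_holder {h : ℕ → ℝ × ℝ → ℝ} {C α : ℝ} (hα0 : 0 < α) (hα1 : α < 1) (hC : 0 ≤ C)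
    (hb : ∀ k z, |h k z| ≤ C * ((1/2:ℝ)^α)^k)
    (hl : ∀ k z w, |h k z - h k w| ≤ C * (2 * (1/2:ℝ)^α)^k * dist z w) :
    ∃ C', 0 ≤ C' ∧ ∀ z w, |(∑' k, h k z) - ∑' k, h k w| ≤ C' * dist z w ^ α := by
  set p : ℝ := (1/2:ℝ)^α with hp
  have hp0 : 0 < p := by positivity
  have hp1 : p < 1 := Real.rpow_lt_one (by norm_num) (by norm_num) hα0
  have hs1 : 1 < 2 * p := by
    have : (1/2:ℝ)^(1:ℝ) < p := Real.rpow_lt_rpow_of_exponent_gt (by norm_num) (by norm_num) hα1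
    rw [Real.rpow_one] at this; linarith
  have hgeo : Summable fun k : ℕ => C * p^k := (summable_geometric_of_lt_one hp0.le hp1).mul_left C
  have hsum : ∀ z, Summable fun k => h k z := fun z =>
    Summable.of_norm_bounded hgeo (fun k => hb k z)
  refine ⟨C * (2 * p / (2 * p - 1)) + 2 * C / (1 - p), ?_, ?_⟩
  · have : 0 < 2 * p - 1 := by linarith
    have : 0 < 1 - p := by linarith
    positivity
  intro z w
  set d := dist z w with hd
  rcases (dist_nonneg (x := z) (y := w)).eq_or_lt with h0 | hdpos
  · have : z = w := dist_eq_zero.1 h0.symm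
    subst this
    simp [hd, Real.zero_rpow hα0.ne']
  rw [← hd] at hdpos
  -- choose N
  obtain ⟨N, hN1, hN2⟩ : ∃ N : ℕ, p^N ≤ d^α ∧ (∑ k ∈ Finset.range N, (2*p)^k) * d ≤ (2*p/(2*p-1)) * d^α := by
    rcases le_or_gt 1 d with h1 | h1
    · exact ⟨0, by simpa using Real.one_le_rpow h1 hα0.le, by
        have : 0 < 2 * p - 1 := by linarith
        simp; positivity⟩
    · obtain ⟨n, hn1, hn2⟩ := exists_nat_pow_near (x := 1/d) (y := 2) (by rw [le_div_iff₀ hdpos]; linarith) (by norm_num)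
      refine ⟨n+1, ?_, ?_⟩
      · rw [hp, ← rpow_half]
        apply Real.rpow_le_rpow (by positivity) _ hα0.le
        rw [one_div, inv_pow, inv_le_comm₀ (by positivity) hdpos, ← one_div]
        exact hn2.le
      · rw [geom_sum_eq hs1.ne']
        have h2p : 0 < 2 * p - 1 := by linarith
        have key : p^n * (2^n * d) ≤ d^α := by
          have hx0 : 0 < 2^n * d := by positivity
          have hx1 : 2^n * d ≤ 1 := by rwa [le_div_iff₀ hdpos] at hn1
          have : p^n = d^α / (2^n*d)^α := by
            rw [Real.mul_rpow (by positivity) hdpos.le, hp, ← rpow_half, one_div, inv_pow,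
              Real.inv_rpow (by positivity)]
            have : 0 < d^α := by positivity
            field_simp
          rw [this, div_mul_eq_mul_div, div_le_iff₀ (by positivity)]
          apply mul_le_mul_of_nonneg_left _ (by positivity)
          calc 2^n*d = (2^n*d)^(1:ℝ) := by rw [Real.rpow_one]
            _ ≤ (2^n*d)^α := Real.rpow_le_rpow_of_exponent_ge hx0 hx1 hα1.le
        have : ((2 * p) ^ (n + 1) - 1) / (2 * p - 1) * d ≤ ((2 * p) ^ (n + 1)) / (2 * p - 1) * d := by
          gcongr; linarith
        refine this.trans ?_
        rw [pow_succ, mul_pow]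
        have e : 2^n * p^n * (2*p) / (2*p-1) * d = (2*p/(2*p-1)) * (p^n * (2^n*d)) := by ring
        rw [e]
        gcongr
  rw [← (hsum z).tsum_sub (hsum w)]
  have hs2 : Summable fun k => h k z - h k w := (hsum z).sub (hsum w)
  rw [← hs2.sum_add_tsum_nat_add N]
  have t1 : |∑ k ∈ Finset.range N, (h k z - h k w)| ≤ C * ((2*p/(2*p-1)) * d^α) := by
    calc _ ≤ ∑ k ∈ Finset.range N, |h k z - h k w| := Finset.abs_sum_le_sum_abs _ _
      _ ≤ ∑ k ∈ Finset.range N, C * (2*p)^k * d := Finset.sum_le_sum fun k _ => hl k z w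
      _ = C * ((∑ k ∈ Finset.range N, (2*p)^k) * d) := by
          rw [Finset.sum_mul, Finset.mul_sum]; congr 1; ext; ring
      _ ≤ _ := by gcongr
  have t2 : |∑' k, (h (k+N) z - h (k+N) w)| ≤ 2 * C / (1-p) * d^α := by
    have hg : HasSum (fun k : ℕ => 2 * C * p^N * p^k) (2 * C * p^N * (1-p)⁻¹) :=
      (hasSum_geometric_of_lt_one hp0.le hp1).mul_left _
    have : ‖∑' k, (h (k+N) z - h (k+N) w)‖ ≤ 2 * C * p^N * (1-p)⁻¹ := by
      apply tsum_of_norm_bounded hg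
      intro k
      have h1 := hb (k+N) z
      have h2 := hb (k+N) w
      have h3 : ‖h (k+N) z - h (k+N) w‖ ≤ |h (k+N) z| + |h (k+N) w| := abs_sub _ _
      rw [pow_add] at h1 h2
      linarith
    refine this.trans ?_
    have : 0 < 1 - p := by linarith
    rw [div_mul_eq_mul_div, ← div_eq_mul_inv]
    gcongr
  calc _ ≤ _ := abs_add_le _ _
    _ ≤ _ := add_le_add t1 t2
    _ = _ := by ring
end Part2

section Part3
open Real Set MeasureTheory
open Filter Topology
open scoped ContDiff

/-- differentiating a series -/
lemma dd_tsum {h : ℕ → ℝ × ℝ → ℝ} {τ : ℝ} (ht0 : 0 ≤ τ) (ht1 : τ < 1)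
    (hs : ∀ k, ContDiff ℝ ∞ (h k)) (hb : ∃ C, ∀ k z, |h k z| ≤ C * τ^k)
    (hd : ∀ v, ∃ C, ∀ k z, |dd v (h k) z| ≤ C * τ^k) :
    ContDiff ℝ 1 (fun z => ∑' k, h k z) ∧
      ∀ v, dd v (fun z => ∑' k, h k z) = fun z => ∑' k, dd v (h k) z := by
  obtain ⟨C, hC⟩ := hb
  obtain ⟨C1, hC1⟩ := hd (1,0)
  obtain ⟨C2, hC2⟩ := hd (0,1)
  have hgeo := summable_geometric_of_lt_one ht0 ht1
  have hu : Summable fun k : ℕ => (C1 + C2) * τ^k := hgeo.mul_left _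
  have hn : ∀ k z, ‖fderiv ℝ (h k) z‖ ≤ (C1 + C2) * τ^k := by
    intro k z
    refine (opnorm_le _).trans ?_
    have h1 := hC1 k z
    have h2 := hC2 k z
    simp only [dd] at h1 h2
    linarith
  have key : ∀ z, HasFDerivAt (fun z => ∑' k, h k z) (∑' k, fderiv ℝ (h k) z) z := by
    intro z
    refine hasFDerivAt_tsum hu (fun k z => ((hs k).differentiable (by simp) z).hasFDerivAt) hn
      (x₀ := 0) ?_ z
    exact Summable.of_norm_bounded (hgeo.mul_left C) (fun k => hC k 0)
  have hfd : fderiv ℝ (fun z => ∑' k, h k z) = fun z => ∑' k, fderiv ℝ (h k) z := by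
    funext z; exact (key z).fderiv
  refine ⟨?_, ?_⟩
  · rw [contDiff_one_iff_fderiv]
    refine ⟨fun z => (key z).differentiableAt, ?_⟩
    rw [hfd]
    exact continuous_tsum (fun k => (hs k).continuous_fderiv (by simp)) hu hn
  · intro v
    funext z
    show fderiv ℝ (fun z => ∑' k, h k z) z v = _
    rw [hfd]
    have hsum : Summable fun k => fderiv ℝ (h k) z := Summable.of_norm_bounded hu (fun k => hn k z)
    exact (ContinuousLinearMap.apply ℝ ℝ v).map_tsum hsum

/-- weighted multi-scale pieces -/
def hk (j : ℕ) (ψ g : ℝ × ℝ → ℝ) (k : ℕ) : ℝ × ℝ → ℝ := fun z => (2^k)^j * cv (sc k ψ) g z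

section
variable {ψ g : ℝ × ℝ → ℝ} {j : ℕ}

lemma hk_smooth (hψ : ContDiff ℝ ∞ ψ) (hc : HasCompactSupport ψ)
    (hg : LocallyIntegrable g) (j k : ℕ) : ContDiff ℝ ∞ (hk j ψ g k) :=
  contDiff_const.mul (cv_smooth (sc_smooth hψ k) (sc_cs hc k) hg)

lemma dd_hk (hψ : ContDiff ℝ ∞ ψ) (hc : HasCompactSupport ψ)
    (hg : LocallyIntegrable g) (j k : ℕ) (v : ℝ × ℝ) :
    dd v (hk j ψ g k) = hk (j+1) (dd v ψ) g k := by
  funext z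
  unfold hk
  rw [dd_const_mul, dd_cv, dd_sc hψ, cv_const_mul, pow_succ, mul_assoc]
  · exact (sc_smooth hψ k).of_le (by simp)
  · exact sc_cs hc k
  · exact hg
  · exact (cv_smooth (sc_smooth hψ k) (sc_cs hc k) hg).differentiable (by simp) z

lemma hk_bound {M : ℝ} (hψ : ContDiff ℝ ∞ ψ) (hc : HasCompactSupport ψ)
    (hgM : ∀ z, |g z| ≤ M) (j k : ℕ) (z : ℝ × ℝ) :
    |hk j ψ g k z| ≤ M * (∫ w, |ψ w|) * (2^j / 4)^k := by
  unfold hk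
  rw [abs_mul, abs_of_pos (by positivity)]
  calc _ ≤ (2^k)^j * (M * (∫ w, |ψ w|) * (1/4)^k) := by
        gcongr; exact cv_sc_bound hψ hc hgM k z
    _ = _ := by
        rw [← pow_mul, mul_comm k j, pow_mul, one_div, inv_pow, div_pow]; ring

lemma hk_holder {C α : ℝ} (hψ : ContDiff ℝ ∞ ψ) (hc : HasCompactSupport ψ)
    (h0 : ∫ w, ψ w = 0) (hC : 0 ≤ C) (hα : 0 ≤ α) (hg : LocallyIntegrable g)
    (hgH : ∀ z w, |g z - g w| ≤ C * dist z w ^ α) (j : ℕ) :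
    ∃ C', 0 ≤ C' ∧ ∀ k z, |hk j ψ g k z| ≤ C' * (2^j / 4 * (1/2:ℝ)^α)^k := by
  obtain ⟨R, hR⟩ := hc.isCompact.isBounded.exists_norm_le
  have hR' : ∀ z, ψ z ≠ 0 → ‖z‖ ≤ max R 0 := fun z hz =>
    (hR z (subset_tsupport _ hz)).trans (le_max_left _ _)
  refine ⟨C * (max R 0)^α * ∫ w, |ψ w|, ?_, ?_⟩
  · have : 0 ≤ ∫ w, |ψ w| := integral_nonneg fun w => abs_nonneg _
    have : 0 ≤ max R 0 := le_max_right _ _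
    positivity
  intro k z
  have := cv_sc_holder hψ hc h0 hR' (le_max_right _ _) hC hα hg hgH k z
  unfold hk
  rw [abs_mul, abs_of_pos (by positivity)]
  calc _ ≤ (2^k)^j * _ := mul_le_mul_of_nonneg_left this (by positivity)
    _ = _ := by
        rw [rpow_half, mul_pow, ← pow_mul, mul_comm k j, pow_mul, one_div, inv_pow, div_pow]; ring

lemma lip_of_dd {h : ℝ × ℝ → ℝ} {a b : ℝ} (hs : ContDiff ℝ ∞ h)
    (h1 : ∀ z, |dd (1,0) h z| ≤ a) (h2 : ∀ z, |dd (0,1) h z| ≤ b) (z w : ℝ × ℝ) :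
    |h z - h w| ≤ (a + b) * dist z w := by
  have := Convex.norm_image_sub_le_of_norm_fderiv_le (𝕜 := ℝ) (f := h) (s := univ) (C := a + b)
    (fun x _ => hs.differentiable (by simp) x)
    (fun x _ => (opnorm_le _).trans (add_le_add (h1 x) (h2 x))) convex_univ (mem_univ w) (mem_univ z)
  rw [dist_eq_norm]
  exact this
end

/-- potential -/
def Np (lam g : ℝ × ℝ → ℝ) : ℝ × ℝ → ℝ := fun z => ∑' k, hk 0 lam g k z

def gHolder (α : ℝ) (u : ℝ × ℝ → ℝ) : Prop := ∃ C, 0 ≤ C ∧ ∀ z w, |u z - u w| ≤ C * dist z w ^ α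

section
variable {lam g : ℝ × ℝ → ℝ} {α M : ℝ}

lemma p_lt (hα0 : 0 < α) : (1/2:ℝ)^α < 1 := Real.rpow_lt_one (by norm_num) (by norm_num) hα0
lemma p_gt (hα1 : α < 1) : 1/2 < (1/2:ℝ)^α := by
  have : (1/2:ℝ)^(1:ℝ) < (1/2:ℝ)^α := Real.rpow_lt_rpow_of_exponent_gt (by norm_num) (by norm_num) hα1
  rwa [Real.rpow_one] at this

lemma Np_C1 (hl : ContDiff ℝ ∞ lam) (hc : HasCompactSupport lam)
    (hg : LocallyIntegrable g) (hM : ∀ z, |g z| ≤ M) :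
    ContDiff ℝ 1 (Np lam g) ∧ ∀ v, dd v (Np lam g) = fun z => ∑' k, hk 1 (dd v lam) g k z := by
  have := dd_tsum (h := hk 0 lam g) (τ := 1/2) (by norm_num) (by norm_num)
    (hk_smooth hl hc hg 0) ?_ ?_
  · refine ⟨this.1, fun v => ?_⟩
    unfold Np
    rw [this.2 v]
    simp only [dd_hk hl hc hg]
  · refine ⟨M * ∫ w, |lam w|, fun k z => (hk_bound hl hc hM 0 k z).trans ?_⟩
    have : 0 ≤ M := (abs_nonneg _).trans (hM 0)
    gcongr; all_goals norm_num
  · intro v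
    refine ⟨M * ∫ w, |dd v lam w|, fun k z => ?_⟩
    rw [dd_hk hl hc hg]
    refine (hk_bound (dd_smooth hl) (dd_cs hc) hM _ k z).trans (le_of_eq ?_)
    norm_num

lemma Np_holder (hl : ContDiff ℝ ∞ lam) (hc : HasCompactSupport lam)
    (hg : LocallyIntegrable g) (hM : ∀ z, |g z| ≤ M) (hα0 : 0 < α) (hα1 : α < 1) (v : ℝ × ℝ) :
    gHolder α (dd v (Np lam g)) := by
  rw [(Np_C1 hl hc hg hM).2 v]
  have hM0 : 0 ≤ M := (abs_nonneg _).trans (hM 0)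
  have hp := p_gt hα1
  set I0 := ∫ w, |dd v lam w| with hI0
  set I1 := ∫ w, |dd (1,0) (dd v lam) w| with hI1
  set I2 := ∫ w, |dd (0,1) (dd v lam) w| with hI2
  have hI0' : 0 ≤ I0 := integral_nonneg fun w => abs_nonneg _
  have hI1' : 0 ≤ I1 := integral_nonneg fun w => abs_nonneg _
  have hI2' : 0 ≤ I2 := integral_nonneg fun w => abs_nonneg _
  apply ser_holder hα0 hα1 (C := M * I0 + (M * I1 + M * I2)) (by positivity)
  · intro k z
    refine (hk_bound (dd_smooth hl) (dd_cs hc) hM _ k z).trans ?_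
    have : M * I0 ≤ M * I0 + (M * I1 + M * I2) := by
      have := mul_nonneg hM0 hI1'
      have := mul_nonneg hM0 hI2'
      linarith
    gcongr
    norm_num at hp ⊢; exact hp.le
  · intro k z w
    have := lip_of_dd (hk_smooth (dd_smooth (v := v) hl) (dd_cs hc) hg 1 k) (a := M * I1) (b := M * I2) ?_ ?_ z w
    · refine this.trans ?_
      have h1 : 1 ≤ (2 * (1/2:ℝ)^α)^k := one_le_pow₀ (by linarith)
      have h2 : M * I1 + M * I2 ≤ M * I0 + (M * I1 + M * I2) := by
        have := mul_nonneg hM0 hI0'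
        linarith
      have h3 := mul_nonneg hM0 hI1'
      have h4 := mul_nonneg hM0 hI2'
      apply mul_le_mul_of_nonneg_right _ dist_nonneg
      nlinarith
    · intro z
      rw [dd_hk (dd_smooth hl) (dd_cs hc) hg]
      refine (hk_bound (dd_smooth (dd_smooth hl)) (dd_cs (dd_cs hc)) hM _ k z).trans (le_of_eq ?_)
      norm_num; left; rfl
    · intro z
      rw [dd_hk (dd_smooth hl) (dd_cs hc) hg]
      refine (hk_bound (dd_smooth (dd_smooth hl)) (dd_cs (dd_cs hc)) hM _ k z).trans (le_of_eq ?_)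
      norm_num; left; rfl

lemma Np_C2 (hl : ContDiff ℝ ∞ lam) (hc : HasCompactSupport lam)
    (hg : LocallyIntegrable g) (hM : ∀ z, |g z| ≤ M) (hα0 : 0 < α) (hα1 : α < 1)
    (hH : gHolder α g) :
    ContDiff ℝ 2 (Np lam g) ∧ ∀ v w, gHolder α (dd w (dd v (Np lam g))) := by
  obtain ⟨C, hC, hCg⟩ := hH
  have hM0 : 0 ≤ M := (abs_nonneg _).trans (hM 0)
  have hp := p_gt hα1
  have hp1 := p_lt hα0
  have hA := Np_C1 hl hc hg hM
  have h1 : ∀ v, ContDiff ℝ 1 (dd v (Np lam g)) ∧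
      ∀ w, dd w (dd v (Np lam g)) = fun z => ∑' k, hk 2 (dd w (dd v lam)) g k z := by
    intro v
    rw [hA.2 v]
    have := dd_tsum (h := hk 1 (dd v lam) g) (τ := (1/2:ℝ)^α) (by positivity) hp1
      (hk_smooth (dd_smooth hl) (dd_cs hc) hg 1) ?_ ?_
    · refine ⟨this.1, fun w => ?_⟩
      rw [this.2 w]
      simp only [dd_hk (dd_smooth hl) (dd_cs hc) hg]
    · refine ⟨M * ∫ w, |dd v lam w|, fun k z => (hk_bound (dd_smooth hl) (dd_cs hc) hM 1 k z).trans ?_⟩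
      have : 0 ≤ ∫ w, |dd v lam w| := integral_nonneg fun w => abs_nonneg _
      gcongr
      norm_num at hp ⊢; exact hp.le
    · intro w
      obtain ⟨C', hC', hb⟩ := hk_holder (dd_smooth (v := w) (dd_smooth (v := v) hl)) (dd_cs (dd_cs hc))
        (dd_zero_integral (dd_smooth hl) (dd_cs hc)) hC hα0.le hg hCg 2
      refine ⟨C', fun k z => ?_⟩
      rw [dd_hk (dd_smooth hl) (dd_cs hc) hg]
      refine (hb k z).trans (le_of_eq ?_)
      norm_num
  refine ⟨?_, ?_⟩
  · rw [show (2 : WithTop ℕ∞) = 1 + 1 by norm_num, contDiff_succ_iff_fderiv_apply]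
    refine ⟨hA.1.differentiable (by simp), by simp, fun v => (h1 v).1⟩
  · intro v w
    rw [(h1 v).2 w]
    obtain ⟨C0, hC0, hb0⟩ := hk_holder (dd_smooth (v := w) (dd_smooth (v := v) hl)) (dd_cs (dd_cs hc))
        (dd_zero_integral (dd_smooth hl) (dd_cs hc)) hC hα0.le hg hCg 2
    obtain ⟨C1, hC1, hb1⟩ := hk_holder (dd_smooth (v := (1,0)) (dd_smooth (v := w) (dd_smooth (v := v) hl))) (dd_cs (dd_cs (dd_cs hc)))
        (dd_zero_integral (dd_smooth (dd_smooth hl)) (dd_cs (dd_cs hc))) hC hα0.le hg hCg 3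
    obtain ⟨C2, hC2, hb2⟩ := hk_holder (dd_smooth (v := (0,1)) (dd_smooth (v := w) (dd_smooth (v := v) hl))) (dd_cs (dd_cs (dd_cs hc)))
        (dd_zero_integral (dd_smooth (dd_smooth hl)) (dd_cs (dd_cs hc))) hC hα0.le hg hCg 3
    apply ser_holder hα0 hα1 (C := C0 + (C1 + C2)) (by positivity)
    · intro k z
      refine (hb0 k z).trans ?_
      have : C0 ≤ C0 + (C1 + C2) := by linarith
      gcongr
      norm_num
    · intro k z w'
      have := lip_of_dd (hk_smooth (dd_smooth (v := w) (dd_smooth (v := v) hl)) (dd_cs (dd_cs hc)) hg 2 k)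
        (a := C1 * (2 * (1/2:ℝ)^α)^k) (b := C2 * (2 * (1/2:ℝ)^α)^k) ?_ ?_ z w'
      · refine this.trans ?_
        rw [← add_mul]
        have : C1 + C2 ≤ C0 + (C1 + C2) := by linarith
        gcongr
      · intro z
        rw [dd_hk (dd_smooth (dd_smooth hl)) (dd_cs (dd_cs hc)) hg]
        refine (hb1 k z).trans (le_of_eq ?_)
        norm_num
      · intro z
        rw [dd_hk (dd_smooth (dd_smooth hl)) (dd_cs (dd_cs hc)) hg]
        refine (hb2 k z).trans (le_of_eq ?_)
        norm_num

lemma Np_dd_comm (hl : ContDiff ℝ ∞ lam) (hc : HasCompactSupport lam)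
    (hg : ContDiff ℝ 1 g) (hgc : HasCompactSupport g) (v : ℝ × ℝ) :
    dd v (Np lam g) = Np lam (dd v g) := by
  obtain ⟨M, hM⟩ := hg.continuous.bounded_above_of_compact_support hgc
  have hgl : LocallyIntegrable g := hg.continuous.locallyIntegrable
  rw [(Np_C1 hl hc hgl hM).2 v]
  funext z
  unfold Np
  congr 1
  funext k
  rw [← dd_hk hl hc hgl]
  unfold hk
  simp only [pow_zero, one_mul]
  rw [cv_comm, dd_cv hg hgc (sc_smooth hl k).continuous.locallyIntegrable, cv_comm]
end
end Part3

section Part4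
open Real Set MeasureTheory
open Filter Topology
open scoped ContDiff

/-- Hölder continuity near a point -/
def LH (α : ℝ) (u : ℝ × ℝ → ℝ) (z₀ : ℝ × ℝ) : Prop :=
  ∃ C : ℝ, 0 ≤ C ∧ ∃ U ∈ 𝓝 z₀, ∀ z ∈ U, ∀ w ∈ U, |u z - u w| ≤ C * dist z w ^ α

section
variable {α : ℝ} {u v : ℝ × ℝ → ℝ} {z₀ : ℝ × ℝ}

lemma LH.continuousAt (hα : 0 < α) (h : LH α u z₀) : ContinuousAt u z₀ := by
  obtain ⟨C, hC, U, hU, hb⟩ := h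
  rw [ContinuousAt, tendsto_iff_dist_tendsto_zero]
  have h0 : Tendsto (fun z => C * dist z z₀ ^ α) (𝓝 z₀) (𝓝 0) := by
    have : ContinuousAt (fun z => C * dist z z₀ ^ α) z₀ :=
      continuousAt_const.mul ((continuousAt_id.dist continuousAt_const).rpow_const (Or.inr hα.le))
    have h2 := this.tendsto
    simpa [Real.zero_rpow hα.ne'] using h2
  refine squeeze_zero' (Eventually.of_forall fun _ => dist_nonneg) ?_ h0
  filter_upwards [hU] with z hz
  exact hb z hz z₀ (mem_of_mem_nhds hU)

lemma LH.congr (h : LH α u z₀) (he : u =ᶠ[𝓝 z₀] v) : LH α v z₀ := by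
  obtain ⟨C, hC, U, hU, hb⟩ := h
  refine ⟨C, hC, U ∩ {z | u z = v z}, inter_mem hU he, ?_⟩
  rintro z ⟨hz, hz'⟩ w ⟨hw, hw'⟩
  have h1 : u z = v z := hz'
  have h2 : u w = v w := hw'
  rw [← h1, ← h2]
  exact hb z hz w hw

lemma LH.add (hu : LH α u z₀) (hv : LH α v z₀) : LH α (fun z => u z + v z) z₀ := by
  obtain ⟨C, hC, U, hU, hb⟩ := hu
  obtain ⟨C', hC', U', hU', hb'⟩ := hv
  refine ⟨C + C', by positivity, U ∩ U', inter_mem hU hU', ?_⟩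
  rintro z ⟨hz, hz'⟩ w ⟨hw, hw'⟩
  have h1 := hb z hz w hw
  have h2 := hb' z hz' w hw'
  calc |u z + v z - (u w + v w)| = |(u z - u w) + (v z - v w)| := by ring_nf
    _ ≤ _ := abs_add_le _ _
    _ ≤ _ := by linarith

lemma LH.mul (hα : 0 < α) (hu : LH α u z₀) (hv : LH α v z₀) : LH α (fun z => u z * v z) z₀ := by
  have cu := hu.continuousAt hα
  have cv := hv.continuousAt hα
  obtain ⟨C, hC, U, hU, hb⟩ := hu
  obtain ⟨C', hC', U', hU', hb'⟩ := hv
  have bu : ∀ᶠ z in 𝓝 z₀, |u z| < |u z₀| + 1 := cu.abs.eventually_lt continuousAt_const (by linarith)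
  have bv : ∀ᶠ z in 𝓝 z₀, |v z| < |v z₀| + 1 := cv.abs.eventually_lt continuousAt_const (by linarith)
  refine ⟨(|u z₀| + 1) * C' + (|v z₀| + 1) * C, by positivity, (U ∩ U') ∩ ({z | |u z| < |u z₀| + 1} ∩ {z | |v z| < |v z₀| + 1}), inter_mem (inter_mem hU hU') (inter_mem bu bv), ?_⟩
  rintro z ⟨⟨hz, hz'⟩, hzu, hzv⟩ w ⟨⟨hw, hw'⟩, hwu, hwv⟩
  have h1 := hb z hz w hw
  have h2 := hb' z hz' w hw'
  simp only [mem_ofPred_eq] at hzu hwv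
  calc |u z * v z - (u w * v w)| = |u z * (v z - v w) + v w * (u z - u w)| := by ring_nf
    _ ≤ |u z| * |v z - v w| + |v w| * |u z - u w| := by
        rw [← abs_mul, ← abs_mul]; exact abs_add_le _ _
    _ ≤ (|u z₀| + 1) * (C' * dist z w ^ α) + (|v z₀| + 1) * (C * dist z w ^ α) := by
        gcongr
    _ = _ := by ring

lemma LH.of_C1 (hα1 : α < 1) (hα0 : 0 < α) (h : ContDiffAt ℝ 1 u z₀) : LH α u z₀ := by
  obtain ⟨K, U, hU, hL⟩ := h.exists_lipschitzOnWith
  refine ⟨K, K.2, U ∩ Metric.ball z₀ (1/2), inter_mem hU (Metric.ball_mem_nhds _ (by norm_num)), ?_⟩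
  rintro z ⟨hz, hz'⟩ w ⟨hw, hw'⟩
  have h1 := hL.dist_le_mul z hz w hw
  rw [Real.dist_eq] at h1
  refine h1.trans ?_
  apply mul_le_mul_of_nonneg_left _ K.2
  have hd : dist z w ≤ 1 := by
    have := dist_triangle_right z w z₀
    rw [Metric.mem_ball] at hz' hw'
    linarith
  rcases (dist_nonneg (x := z) (y := w)).eq_or_lt with h0 | h0
  · rw [← h0, Real.zero_rpow hα0.ne']
  calc dist z w = dist z w ^ (1:ℝ) := by rw [Real.rpow_one]
    _ ≤ _ := Real.rpow_le_rpow_of_exponent_ge h0 hd hα1.le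

lemma LH.const_mul (hα1 : α < 1) (hα0 : 0 < α) (c : ℝ) (h : LH α u z₀) : LH α (fun z => c * u z) z₀ :=
  LH.mul hα0 (LH.of_C1 hα1 hα0 contDiffAt_const) h

lemma LH.sub (hu : LH α u z₀) (hv : LH α v z₀) : LH α (fun z => u z - v z) z₀ := by
  obtain ⟨C', hC', U', hU', hb'⟩ := hv
  have : LH α (fun z => - v z) z₀ := ⟨C', hC', U', hU', fun z hz w hw => by
    rw [show - v z - - v w = - (v z - v w) by ring, abs_neg]; exact hb' z hz w hw⟩
  simpa [sub_eq_add_neg] using hu.add this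

lemma LH.of_g (h : gHolder α u) : LH α u z₀ := by
  obtain ⟨C, hC, h⟩ := h
  exact ⟨C, hC, univ, univ_mem, fun z _ w _ => h z w⟩

lemma LH.of_loc {O : Set (ℝ × ℝ)} (hO : IsOpen O) (h : locHolderOn α O u) (hz : z₀ ∈ O) :
    LH α u z₀ := by
  obtain ⟨ε, hε, hb⟩ := Metric.nhds_basis_closedBall.mem_iff.1 (hO.mem_nhds hz)
  obtain ⟨C, hC⟩ := h _ (isCompact_closedBall z₀ ε) hb
  refine ⟨max C 0, le_max_right _ _, Metric.closedBall z₀ ε, Metric.closedBall_mem_nhds _ hε, ?_⟩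
  intro z hz w hw
  refine (hC z hz w hw).trans ?_
  gcongr
  exact le_max_left _ _

lemma LH.holderOn (hα : 0 < α) {K : Set (ℝ × ℝ)} (hK : IsCompact K) (h : ∀ z ∈ K, LH α u z) :
    holderOn α K u := by
  have key : ∃ C, 0 ≤ C ∧ ∀ p ∈ K ×ˢ K, |u p.1 - u p.2| ≤ C * dist p.1 p.2 ^ α := by
    refine (hK.prod hK).induction_on (p := fun S => ∃ C, 0 ≤ C ∧ ∀ p ∈ S, |u p.1 - u p.2| ≤ C * dist p.1 p.2 ^ α) ?_ ?_ ?_ ?_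
    · exact ⟨0, le_rfl, by simp⟩
    · rintro S T hST ⟨C, hC, h⟩
      exact ⟨C, hC, fun p hp => h p (hST hp)⟩
    · rintro S T ⟨C, hC, h⟩ ⟨C', hC', h'⟩
      refine ⟨max C C', hC.trans (le_max_left _ _), ?_⟩
      rintro p (hp | hp)
      · refine (h p hp).trans ?_
        gcongr; exact le_max_left _ _
      · refine (h' p hp).trans ?_
        gcongr; exact le_max_right _ _
    · rintro ⟨a, b⟩ ⟨ha, hb⟩
      by_cases hab : a = b
      · subst hab
        obtain ⟨C, hC, U, hU, hb⟩ := h a ha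
        refine ⟨U ×ˢ U, mem_nhdsWithin_of_mem_nhds (prod_mem_nhds hU hU), C, hC, ?_⟩
        rintro ⟨z, w⟩ ⟨hz, hw⟩
        exact hb z hz w hw
      · have hd : 0 < dist a b := dist_pos.2 hab
        have c1 := (h a ha).continuousAt hα
        have c2 := (h b hb).continuousAt hα
        have c3 : ContinuousAt (fun p : (ℝ × ℝ) × (ℝ × ℝ) => |u p.1 - u p.2|) (a, b) :=
          ((ContinuousAt.comp (g := u) (f := Prod.fst) c1 continuousAt_fst).sub
            (ContinuousAt.comp (g := u) (f := Prod.snd) c2 continuousAt_snd)).abs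
        have e1 : ∀ᶠ p in 𝓝 (a, b), |u p.1 - u p.2| < |u a - u b| + 1 :=
          c3.eventually_lt continuousAt_const (by simp)
        have e2 : ∀ᶠ p : (ℝ × ℝ) × (ℝ × ℝ) in 𝓝 (a, b), dist a b / 2 < dist p.1 p.2 :=
          continuousAt_const.eventually_lt (continuousAt_fst.dist continuousAt_snd) (by show dist a b / 2 < dist a b; linarith)
        refine ⟨_, mem_nhdsWithin_of_mem_nhds (inter_mem e1 e2), (|u a - u b| + 1) / (dist a b / 2)^α, by positivity, ?_⟩
        rintro ⟨z, w⟩ ⟨h1, h2⟩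
        simp only [mem_ofPred_eq] at h1 h2
        rw [div_mul_eq_mul_div, le_div_iff₀ (by positivity)]
        have : (dist a b / 2)^α ≤ dist z w ^ α := Real.rpow_le_rpow (by positivity) h2.le hα.le
        gcongr
  obtain ⟨C, hC, h⟩ := key
  exact ⟨C, fun z hz w hw => h (z, w) ⟨hz, hw⟩⟩

lemma LH.locHolderOn (hα : 0 < α) {O : Set (ℝ × ℝ)} (h : ∀ z ∈ O, LH α u z) :
    locHolderOn α O u := fun _ hK hKO => LH.holderOn hα hK fun z hz => h z (hKO hz)

lemma LH.global (hα : 0 < α) (hc : HasCompactSupport u) (h : ∀ z, LH α u z) : gHolder α u := by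
  obtain ⟨R, hR⟩ := hc.isCompact.isBounded.exists_norm_le
  have hcont : Continuous u := continuous_iff_continuousAt.2 fun z => (h z).continuousAt hα
  obtain ⟨B, hB⟩ := hcont.bounded_above_of_compact_support hc
  have h0 : ∀ z, R < ‖z‖ → u z = 0 := by
    intro z hz
    by_contra hne
    have := hR z (subset_tsupport _ hne)
    linarith
  obtain ⟨C, hC⟩ := LH.holderOn hα (isCompact_closedBall (0:ℝ×ℝ) (R+1)) (fun z _ => h z)
  have hB0 : 0 ≤ B := (norm_nonneg _).trans (hB 0)
  have aux : ∀ z w, R + 1 < ‖w‖ → |u z - u w| ≤ B * dist z w ^ α := by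
    intro z w hw
    rw [h0 w (by linarith), sub_zero]
    by_cases hz : R < ‖z‖
    · rw [h0 z hz]; simp; positivity
    · have hd : 1 ≤ dist z w := by
        have := norm_sub_norm_le w z
        rw [dist_comm, dist_eq_norm]; linarith
      have := Real.one_le_rpow hd hα.le
      have h2 := hB z
      rw [Real.norm_eq_abs] at h2
      nlinarith
  refine ⟨max C B, le_max_of_le_right hB0, ?_⟩
  intro z w
  by_cases hw : R + 1 < ‖w‖
  · refine (aux z w hw).trans ?_
    gcongr; exact le_max_right _ _
  by_cases hz : R + 1 < ‖z‖
  · rw [abs_sub_comm, dist_comm]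
    refine (aux w z hz).trans ?_
    gcongr; exact le_max_right _ _
  · push Not at hw hz
    refine (hC z (by simpa using hz) w (by simpa using hw)).trans ?_
    gcongr; exact le_max_left _ _
end

lemma contDiffAt_dd {n m : ℕ∞} {u : ℝ × ℝ → ℝ} {z : ℝ × ℝ} (h : ContDiffAt ℝ n u z)
    (hmn : (m:WithTop ℕ∞) + 1 ≤ n) (v : ℝ × ℝ) : ContDiffAt ℝ m (dd v u) z :=
  (h.fderiv_right hmn).clm_apply contDiffAt_const

lemma C2alpha_of {α : ℝ} (hα0 : 0 < α) (hα1 : α < 1) {O : Set (ℝ × ℝ)} {u : ℝ × ℝ → ℝ}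
    (h2 : ∀ z ∈ O, ContDiffAt ℝ 2 u z) (hL : ∀ z ∈ O, ∀ v w, LH α (dd w (dd v u)) z) :
    C2alphaOn α O u := by
  refine ⟨fun z hz => (h2 z hz).contDiffWithinAt, ?_, ?_, ?_⟩
  · exact LH.locHolderOn hα0 fun z hz => LH.of_C1 hα1 hα0 ((h2 z hz).of_le (by norm_num))
  · exact fun v => LH.locHolderOn hα0 fun z hz => LH.of_C1 hα1 hα0
      (contDiffAt_dd (n := 2) (m := 1) (h2 z hz) (by norm_num) v)
  · exact fun v w => LH.locHolderOn hα0 fun z hz => hL z hz v w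
end Part4

section Part5
open Real Set MeasureTheory
open Filter Topology
open scoped ContDiff

lemma smooth_mul {n : WithTop ℕ∞} {ψ η : ℝ × ℝ → ℝ} (hη : ContDiff ℝ n η)
    (hψ : ∀ z ∈ tsupport η, ContDiffAt ℝ n ψ z) : ContDiff ℝ n (fun z => ψ z * η z) := by
  rw [contDiff_iff_contDiffAt]
  intro z
  by_cases hz : z ∈ tsupport η
  · exact (hψ z hz).mul hη.contDiffAt
  · have : (fun z => ψ z * η z) =ᶠ[𝓝 z] fun _ => 0 := by
      filter_upwards [(isClosed_tsupport η).isOpen_compl.mem_nhds hz] with w hw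
      rw [image_eq_zero_of_notMem_tsupport hw, mul_zero]
    exact contDiffAt_const.congr_of_eventuallyEq this

lemma dd_refl {M : ℝ × ℝ → ℝ} (hM : ContDiff ℝ ∞ M) (v z : ℝ × ℝ) :
    dd v (fun w => M (z - w)) = fun w => - dd v M (z - w) := by
  funext w
  have h1 : HasFDerivAt (fun w : ℝ × ℝ => z - w) (- ContinuousLinearMap.id ℝ (ℝ × ℝ)) w :=
    (hasFDerivAt_id w).const_sub z
  have h2 := ((hM.differentiable (by simp) (z - w)).hasFDerivAt).comp w h1
  have h3 : HasFDerivAt (fun w => M (z - w)) _ w := h2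
  simp only [dd]
  rw [h3.fderiv]
  simp

lemma dd_mul_fun {v : ℝ × ℝ} {a b : ℝ × ℝ → ℝ} (ha : ContDiff ℝ ∞ a) (hb : ContDiff ℝ ∞ b) :
    dd v (fun z => a z * b z) = fun z => a z * dd v b z + b z * dd v a z := by
  funext z
  exact dd_mul (ha.differentiable (by simp) z) (hb.differentiable (by simp) z)

lemma leib {v : ℝ × ℝ} {η m b : ℝ × ℝ → ℝ} (hη : ContDiff ℝ ∞ η) (hm : ContDiff ℝ ∞ m)
    (hb : ContDiff ℝ ∞ b) (w : ℝ × ℝ) :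
    - dd v (dd v (fun w => η w * m w)) w + dd v (fun w => b w * m w) w =
      - (η w * dd v (dd v m) w) + (b w - 2 * dd v η w) * dd v m w
       + (dd v b w - dd v (dd v η) w) * m w := by
  rw [dd_mul_fun hη hm, dd_mul_fun hb hm]
  rw [dd_add, dd_mul_fun hη (dd_smooth hm), dd_mul_fun hm (dd_smooth hη)]
  · ring
  · exact (hη.mul (dd_smooth hm)).differentiable (by simp) w
  · exact (hm.mul (dd_smooth hη)).differentiable (by simp) w

structure WeakSol (e₁ e₂ : ℝ × ℝ) (O : Set (ℝ × ℝ)) (B₁ B₂ c F u : ℝ × ℝ → ℝ) : Prop where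
  lb : ∀ φ : ℝ × ℝ → ℝ, ContDiff ℝ ∞ φ → HasCompactSupport φ → tsupport φ ⊆ O →
    (∃ M, ∀ z, |φ z * u z| ≤ M) ∧ LocallyIntegrable (fun z => φ z * u z)
  wk : ∀ φ : ℝ × ℝ → ℝ, ContDiff ℝ ∞ φ → HasCompactSupport φ → tsupport φ ⊆ O →
    ∫ z, u z * (-(dd e₁ (dd e₁ φ) z + dd e₂ (dd e₂ φ) z) + dd e₁ (fun w => B₁ w * φ w) z
      + dd e₂ (fun w => B₂ w * φ w) z + c z * φ z) = ∫ z, F z * φ z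

/-- coefficient functions of the localised equation -/
def Pc (e : ℝ × ℝ) (B η : ℝ × ℝ → ℝ) : ℝ × ℝ → ℝ := fun w => B w * η w - 2 * dd e η w
def Qc (e : ℝ × ℝ) (B η : ℝ × ℝ → ℝ) : ℝ × ℝ → ℝ := fun w =>
  dd e (fun w => B w * η w) w - dd e (dd e η) w

section
variable {e₁ e₂ : ℝ × ℝ} {O : Set (ℝ × ℝ)} {B₁ B₂ c F u η : ℝ × ℝ → ℝ}

lemma tsupport_mul_le_right {a b : ℝ × ℝ → ℝ} : tsupport (fun z => a z * b z) ⊆ tsupport b :=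
  tsupport_mul_subset_right

lemma tsupport_dd_le {v : ℝ × ℝ} {a : ℝ × ℝ → ℝ} : tsupport (dd v a) ⊆ tsupport a :=
  tsupport_fderiv_apply_subset ℝ v

lemma tsupport_sub_le {a b : ℝ × ℝ → ℝ} {K : Set (ℝ × ℝ)} (ha : tsupport a ⊆ K) (hb : tsupport b ⊆ K) :
    tsupport (fun z => a z - b z) ⊆ K := (tsupport_sub a b).trans (union_subset ha hb)
lemma tsupport_add_le {a b : ℝ × ℝ → ℝ} {K : Set (ℝ × ℝ)} (ha : tsupport a ⊆ K) (hb : tsupport b ⊆ K) :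
    tsupport (fun z => a z + b z) ⊆ K := (tsupport_add a b).trans (union_subset ha hb)

lemma cs_of_le {a η : ℝ × ℝ → ℝ} (hη : HasCompactSupport η) (h : tsupport a ⊆ tsupport η) : HasCompactSupport a :=
  IsCompact.of_isClosed_subset hη (isClosed_tsupport _) h

lemma Pc_smooth {e : ℝ × ℝ} {B : ℝ × ℝ → ℝ} (hη : ContDiff ℝ ∞ η) (hO : tsupport η ⊆ O)
    (hB : ∀ z ∈ O, ContDiffAt ℝ ∞ B z) : ContDiff ℝ ∞ (Pc e B η) :=
  (smooth_mul hη fun z hz => hB z (hO hz)).sub (contDiff_const.mul (dd_smooth hη))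

lemma Qc_smooth {e : ℝ × ℝ} {B : ℝ × ℝ → ℝ} (hη : ContDiff ℝ ∞ η) (hO : tsupport η ⊆ O)
    (hB : ∀ z ∈ O, ContDiffAt ℝ ∞ B z) : ContDiff ℝ ∞ (Qc e B η) :=
  (dd_smooth (smooth_mul hη fun z hz => hB z (hO hz))).sub (dd_smooth (dd_smooth hη))

lemma Pc_supp {e : ℝ × ℝ} {B : ℝ × ℝ → ℝ} : tsupport (Pc e B η) ⊆ tsupport η :=
  tsupport_sub_le tsupport_mul_le_right (tsupport_mul_le_right.trans tsupport_dd_le)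

lemma Qc_supp {e : ℝ × ℝ} {B : ℝ × ℝ → ℝ} : tsupport (Qc e B η) ⊆ tsupport η :=
  tsupport_sub_le (tsupport_dd_le.trans tsupport_mul_le_right) (tsupport_dd_le.trans tsupport_dd_le)

/-- total zeroth order coefficient -/
def Qt (e₁ e₂ : ℝ × ℝ) (B₁ B₂ c η : ℝ × ℝ → ℝ) : ℝ × ℝ → ℝ := fun w =>
  Qc e₁ B₁ η w + Qc e₂ B₂ η w + c w * η w

lemma Qt_smooth (hη : ContDiff ℝ ∞ η) (hO : tsupport η ⊆ O)
    (hB₁ : ∀ z ∈ O, ContDiffAt ℝ ∞ B₁ z) (hB₂ : ∀ z ∈ O, ContDiffAt ℝ ∞ B₂ z)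
    (hc : ∀ z ∈ O, ContDiffAt ℝ ∞ c z) : ContDiff ℝ ∞ (Qt e₁ e₂ B₁ B₂ c η) :=
  ((Qc_smooth hη hO hB₁).add (Qc_smooth hη hO hB₂)).add (smooth_mul hη fun z hz => hc z (hO hz))

lemma Qt_supp : tsupport (Qt e₁ e₂ B₁ B₂ c η) ⊆ tsupport η :=
  tsupport_add_le (tsupport_add_le Qc_supp Qc_supp) tsupport_mul_le_right

/-- the right side data -/
def Gd (e₁ e₂ : ℝ × ℝ) (B₁ B₂ c F u η : ℝ × ℝ → ℝ) : ℝ × ℝ → ℝ := fun w =>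
  Qt e₁ e₂ B₁ B₂ c η w * u w - F w * η w

lemma cv_sub_right {φ a b : ℝ × ℝ → ℝ} (hφ : Continuous φ) (hc : HasCompactSupport φ)
    (ha : LocallyIntegrable a) (hb : LocallyIntegrable b) (z : ℝ × ℝ) :
    cv φ (fun w => a w - b w) z = cv φ a z - cv φ b z := by
  simp only [cv, mul_sub]
  exact integral_sub (cv_integrable hφ hc ha z) (cv_integrable hφ hc hb z)

lemma cv_add_left {φ ψ a : ℝ × ℝ → ℝ} (hφ : Continuous φ) (hc : HasCompactSupport φ)
    (hψ : Continuous ψ) (hcψ : HasCompactSupport ψ)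
    (ha : LocallyIntegrable a) (z : ℝ × ℝ) :
    cv (fun z => φ z + ψ z) a z = cv φ a z + cv ψ a z := by
  simp only [cv, add_mul]
  exact integral_add (cv_integrable hφ hc ha z) (cv_integrable hψ hcψ ha z)

/-- localised identity against a smooth compactly supported kernel. -/
lemma rep_kernel (hw : WeakSol e₁ e₂ O B₁ B₂ c F u)
    (hB₁ : ∀ z ∈ O, ContDiffAt ℝ ∞ B₁ z) (hB₂ : ∀ z ∈ O, ContDiffAt ℝ ∞ B₂ z)
    (hc : ∀ z ∈ O, ContDiffAt ℝ ∞ c z) (hF : LocallyIntegrable (fun w => F w * η w))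
    (hη : ContDiff ℝ ∞ η) (hηc : HasCompactSupport η) (hηO : tsupport η ⊆ O)
    {M : ℝ × ℝ → ℝ} (hM : ContDiff ℝ ∞ M) (hMc : HasCompactSupport M) (z : ℝ × ℝ) :
    cv (fun w => dd e₁ (dd e₁ M) w + dd e₂ (dd e₂ M) w) (fun w => η w * u w) z =
      cv M (Gd e₁ e₂ B₁ B₂ c F u η) z - cv (dd e₁ M) (fun w => Pc e₁ B₁ η w * u w) z
        - cv (dd e₂ M) (fun w => Pc e₂ B₂ η w * u w) z := by
  have hm : ContDiff ℝ ∞ (fun w => M (z - w)) := hM.comp (contDiff_const.sub contDiff_id)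
  have hs : tsupport (fun w => η w * M (z - w)) ⊆ tsupport η := tsupport_mul_subset_left
  have hwk := hw.wk (fun w => η w * M (z - w)) (hη.mul hm) (cs_of_le hηc hs) (hs.trans hηO)
  have hb₁ := smooth_mul hη fun z hz => hB₁ z (hηO hz)
  have hb₂ := smooth_mul hη fun z hz => hB₂ z (hηO hz)
  have l1 := hw.lb η hη hηc hηO
  have l2 := hw.lb (Pc e₁ B₁ η) (Pc_smooth hη hηO hB₁) (cs_of_le hηc Pc_supp) (Pc_supp.trans hηO)
  have l3 := hw.lb (Pc e₂ B₂ η) (Pc_smooth hη hηO hB₂) (cs_of_le hηc Pc_supp) (Pc_supp.trans hηO)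
  have l4 := hw.lb (Qt e₁ e₂ B₁ B₂ c η) (Qt_smooth hη hηO hB₁ hB₂ hc) (cs_of_le hηc Qt_supp) (Qt_supp.trans hηO)
  have hm1 := dd_refl hM e₁ z
  have hm2 := dd_refl hM e₂ z
  have e : ∀ w, u w * (-(dd e₁ (dd e₁ (fun w => η w * M (z - w))) w + dd e₂ (dd e₂ (fun w => η w * M (z - w))) w)
      + dd e₁ (fun w => B₁ w * (η w * M (z - w))) w
      + dd e₂ (fun w => B₂ w * (η w * M (z - w))) w + c w * (η w * M (z - w))) =
      M (z - w) * (Qt e₁ e₂ B₁ B₂ c η w * u w)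
        - dd e₁ M (z - w) * (Pc e₁ B₁ η w * u w) - dd e₂ M (z - w) * (Pc e₂ B₂ η w * u w)
        - (dd e₁ (dd e₁ M) (z - w) + dd e₂ (dd e₂ M) (z - w)) * (η w * u w) := by
    intro w
    have h1 := leib (v := e₁) hη hm hb₁ w
    have h2 := leib (v := e₂) hη hm hb₂ w
    have d1 : dd e₁ (dd e₁ (fun w => M (z - w))) w = dd e₁ (dd e₁ M) (z - w) := by
      rw [hm1, dd_neg, dd_refl (dd_smooth hM), neg_neg]
    have d2 : dd e₂ (dd e₂ (fun w => M (z - w))) w = dd e₂ (dd e₂ M) (z - w) := by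
      rw [hm2, dd_neg, dd_refl (dd_smooth hM), neg_neg]
    rw [d1, hm1] at h1
    rw [d2, hm2] at h2
    have r1 : (fun w => B₁ w * (η w * M (z - w))) = fun w => B₁ w * η w * M (z - w) := by
      funext w; ring
    have r2 : (fun w => B₂ w * (η w * M (z - w))) = fun w => B₂ w * η w * M (z - w) := by
      funext w; ring
    rw [r1, r2]
    unfold Qt Qc Pc
    linear_combination u w * h1 + u w * h2
  have i1 := cv_integrable hM.continuous hMc l4.2 z
  have i2 := cv_integrable (dd_smooth (v := e₁) hM).continuous (dd_cs hMc) l2.2 z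
  have i3 := cv_integrable (dd_smooth (v := e₂) hM).continuous (dd_cs hMc) l3.2 z
  have i4 := cv_integrable ((dd_smooth (v := e₁) (dd_smooth (v := e₁) hM)).add
    (dd_smooth (v := e₂) (dd_smooth (v := e₂) hM))).continuous
    ((dd_cs (dd_cs hMc)).add (dd_cs (dd_cs hMc))) l1.2 z
  have i12 : Integrable (fun w => M (z - w) * (Qt e₁ e₂ B₁ B₂ c η w * u w)
      - dd e₁ M (z - w) * (Pc e₁ B₁ η w * u w)) := i1.sub i2
  have i123 : Integrable (fun w => M (z - w) * (Qt e₁ e₂ B₁ B₂ c η w * u w)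
      - dd e₁ M (z - w) * (Pc e₁ B₁ η w * u w) - dd e₂ M (z - w) * (Pc e₂ B₂ η w * u w)) := i12.sub i3
  rw [integral_congr_ae (Eventually.of_forall e), integral_sub i123 i4,
    integral_sub i12 i3, integral_sub i1 i2] at hwk
  have hr : ∫ w, F w * (η w * M (z - w)) = cv M (fun w => F w * η w) z := by
    unfold cv; congr 1; funext w; ring
  rw [hr] at hwk
  unfold Gd
  rw [cv_sub_right hM.continuous hMc l4.2 hF]
  unfold cv at hwk ⊢
  linarith

/-- approximate identity -/
lemma hk2_tendsto {rho g : ℝ × ℝ → ℝ} (hr : ContDiff ℝ ∞ rho) (hrc : HasCompactSupport rho)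
    (h1 : ∫ w, rho w = 1) (hg : LocallyIntegrable g) :
    ∀ᵐ z, Tendsto (fun k => hk 2 rho g k z) atTop (𝓝 (g z)) := by
  obtain ⟨R₀, hR₀⟩ := hrc.isCompact.isBounded.exists_norm_le
  obtain ⟨S, hS⟩ := hr.continuous.bounded_above_of_compact_support hrc
  set R := max R₀ 1 with hRdef
  have hR1 : 0 < R := lt_max_of_lt_right one_pos
  have hR : ∀ z, rho z ≠ 0 → ‖z‖ ≤ R := fun z hz =>
    (hR₀ z (subset_tsupport _ hz)).trans (le_max_left _ _)
  have hS0 : 0 ≤ S := (norm_nonneg _).trans (hS 0)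
  filter_upwards [IsUnifLocDoublingMeasure.ae_tendsto_average_norm_sub (μ := (volume : Measure (ℝ × ℝ))) hg 1] with z hz
  have hδ : Tendsto (fun k : ℕ => R * (1/2:ℝ)^k) atTop (𝓝[>] 0) := by
    rw [tendsto_nhdsWithin_iff]
    constructor
    · simpa using (tendsto_pow_atTop_nhds_zero_of_lt_one (r := (1/2:ℝ)) (by norm_num) (by norm_num)).const_mul R
    · exact Eventually.of_forall fun k => by simp only [mem_Ioi]; positivity
  have hz' := hz (fun _ => z) (fun k => R * (1/2:ℝ)^k) hδ
    (Eventually.of_forall fun k => Metric.mem_closedBall_self (by positivity))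
  rw [tendsto_iff_dist_tendsto_zero]
  have hz2 := hz'.const_mul (S * (4 * R^2))
  rw [mul_zero] at hz2
  refine squeeze_zero (fun _ => dist_nonneg) (fun k => ?_) hz2
  have hi0 := ((sc_smooth hr k).continuous.integrable_of_hasCompactSupport (sc_cs hrc k) (μ := volume)).comp_sub_left z
  set δ := R * (1/2:ℝ)^k with hδd
  have hδp : 0 < δ := by positivity
  have hvol : volume.real (Metric.closedBall z δ) = (2 * δ)^2 := by
    obtain ⟨a, b⟩ := z
    rw [← closedBall_prod_same, measureReal_def, Measure.volume_eq_prod, Measure.prod_prod, Real.volume_closedBall,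
      Real.volume_closedBall, ENNReal.toReal_mul, ENNReal.toReal_ofReal (by positivity)]
    ring
  have e1 : hk 2 rho g k z - g z = (2^k)^2 * ∫ w, sc k rho (z - w) * (g w - g z) := by
    simp only [mul_sub]
    rw [integral_sub (cv_integrable (sc_smooth hr k).continuous (sc_cs hrc k) hg z)
      (hi0.mul_const _), integral_mul_const, sc_integral, h1]
    unfold hk cv
    have : ((2:ℝ)^k)^2 * (1/4)^k = 1 := by
      rw [← pow_mul, mul_comm k 2, pow_mul, ← mul_pow]; norm_num
    linear_combination g z * this
  have hgi : IntegrableOn (fun w => ‖g w - g z‖) (Metric.closedBall z δ) :=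
    ((hg.integrableOn_isCompact (isCompact_closedBall z δ)).sub
      (integrableOn_const (by exact (isCompact_closedBall z δ).measure_lt_top.ne))).norm
  rw [Real.dist_eq, e1, abs_mul, abs_of_pos (by positivity : (0:ℝ) < (2^k)^2)]
  have e2 : |∫ w, sc k rho (z - w) * (g w - g z)| ≤ ∫ w in Metric.closedBall z δ, S * ‖g w - g z‖ := by
    rw [← integral_indicator Metric.isClosed_closedBall.measurableSet]
    rw [← Real.norm_eq_abs]
    refine norm_integral_le_of_norm_le ((show IntegrableOn (fun w => S * ‖g w - g z‖) (Metric.closedBall z δ) volume from hgi.const_mul S).integrable_indicator Metric.isClosed_closedBall.measurableSet) (Eventually.of_forall fun w => ?_)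
    rw [norm_mul]
    by_cases hne : sc k rho (z - w) = 0
    · rw [hne, norm_zero, zero_mul]
      exact indicator_nonneg (fun _ _ => by positivity) _
    · have : w ∈ Metric.closedBall z δ := by
        have := hR _ hne
        rw [norm_smul, Real.norm_eq_abs, abs_of_pos (by positivity)] at this
        rw [Metric.mem_closedBall, dist_comm, dist_eq_norm, hδd, one_div, inv_pow, ← div_eq_mul_inv, le_div_iff₀ (by positivity)]
        linarith
      rw [indicator_of_mem this]
      gcongr
      exact hS _
  rw [setAverage_eq, hvol, smul_eq_mul]
  rw [integral_const_mul] at e2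
  set I := ∫ w in Metric.closedBall z δ, ‖g w - g z‖
  calc (2^k)^2 * |∫ w, sc k rho (z - w) * (g w - g z)| ≤ (2^k)^2 * (S * I) := by gcongr
    _ = S * (4 * R^2) * (((2*δ)^2)⁻¹ * I) := by
      rw [hδd, one_div, inv_pow]
      field_simp
      norm_num
end
end Part5

section Part6
open Real Set MeasureTheory
open Filter Topology
open scoped ContDiff

lemma cont_mul {ψ η : ℝ × ℝ → ℝ} (hη : Continuous η)
    (hψ : ∀ z ∈ tsupport η, ContinuousAt ψ z) : Continuous (fun z => ψ z * η z) := by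
  rw [continuous_iff_continuousAt]
  intro z
  by_cases hz : z ∈ tsupport η
  · exact (hψ z hz).mul hη.continuousAt
  · have : (fun _ => 0) =ᶠ[𝓝 z] (fun z => ψ z * η z) := by
      filter_upwards [(isClosed_tsupport η).isOpen_compl.mem_nhds hz] with w hw
      rw [image_eq_zero_of_notMem_tsupport hw, mul_zero]
    exact continuousAt_const.congr this

lemma int_supp {ψ η : ℝ × ℝ → ℝ} (hη : Continuous η) (hc : HasCompactSupport η)
    (hψ : ∀ z ∈ tsupport η, ContinuousAt ψ z) : Integrable (fun z => ψ z * η z) :=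
  (cont_mul hη hψ).integrable_of_hasCompactSupport hc.mul_left

/-- regularised representation -/
def RepF (lam rho : ℝ × ℝ → ℝ) (e₁ e₂ : ℝ × ℝ) (B₁ B₂ c F u η : ℝ × ℝ → ℝ) : ℝ × ℝ → ℝ := fun z =>
  hk 2 rho (fun w => η w * u w) 0 z + Np lam (Gd e₁ e₂ B₁ B₂ c F u η) z
    - dd e₁ (Np lam (fun w => Pc e₁ B₁ η w * u w)) z
    - dd e₂ (Np lam (fun w => Pc e₂ B₂ η w * u w)) z

section
variable {e₁ e₂ : ℝ × ℝ} {O : Set (ℝ × ℝ)} {B₁ B₂ c F u η lam rho : ℝ × ℝ → ℝ}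

lemma Gd_bdd (hw : WeakSol e₁ e₂ O B₁ B₂ c F u)
    (hB₁ : ∀ z ∈ O, ContDiffAt ℝ ∞ B₁ z) (hB₂ : ∀ z ∈ O, ContDiffAt ℝ ∞ B₂ z)
    (hc : ∀ z ∈ O, ContDiffAt ℝ ∞ c z) (hF : ∀ z ∈ O, ContinuousAt F z)
    (hη : ContDiff ℝ ∞ η) (hηc : HasCompactSupport η) (hηO : tsupport η ⊆ O) :
    (∃ M, ∀ z, |Gd e₁ e₂ B₁ B₂ c F u η z| ≤ M) ∧ LocallyIntegrable (Gd e₁ e₂ B₁ B₂ c F u η) := by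
  obtain ⟨⟨M, hM⟩, l4⟩ := hw.lb (Qt e₁ e₂ B₁ B₂ c η) (Qt_smooth hη hηO hB₁ hB₂ hc) (cs_of_le hηc Qt_supp) (Qt_supp.trans hηO)
  have hFc := cont_mul hη.continuous fun z hz => hF z (hηO hz)
  obtain ⟨M', hM'⟩ := hFc.bounded_above_of_compact_support hηc.mul_left
  refine ⟨⟨M + M', fun z => ?_⟩, l4.sub hFc.locallyIntegrable⟩
  unfold Gd
  exact (abs_sub _ _).trans (add_le_add (hM z) (hM' z))

lemma hk_hasSum {j : ℕ} (hj : j < 2) {ψ g : ℝ × ℝ → ℝ} {M : ℝ} (hψ : ContDiff ℝ ∞ ψ) (hc : HasCompactSupport ψ)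
    (hgM : ∀ z, |g z| ≤ M) (z : ℝ × ℝ) :
    Tendsto (fun K => ∑ k ∈ Finset.range K, hk j ψ g k z) atTop (𝓝 (∑' k, hk j ψ g k z)) := by
  apply HasSum.tendsto_sum_nat
  apply Summable.hasSum
  have hq : (2:ℝ)^j / 4 < 1 := by interval_cases j <;> norm_num
  exact Summable.of_norm_bounded ((summable_geometric_of_lt_one (by positivity) hq).mul_left _)
    (fun k => hk_bound hψ hc hgM j k z)

lemma rep_ae (hw : WeakSol e₁ e₂ O B₁ B₂ c F u)
    (hl : ContDiff ℝ ∞ lam) (hlc : HasCompactSupport lam) (hr : ContDiff ℝ ∞ rho)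
    (hrc : HasCompactSupport rho) (hr1 : ∫ z, rho z = 1)
    (hlr : ∀ z, dd e₁ (dd e₁ lam) z + dd e₂ (dd e₂ lam) z = 4 * rho ((2:ℝ)•z) - rho z)
    (hB₁ : ∀ z ∈ O, ContDiffAt ℝ ∞ B₁ z) (hB₂ : ∀ z ∈ O, ContDiffAt ℝ ∞ B₂ z)
    (hc : ∀ z ∈ O, ContDiffAt ℝ ∞ c z) (hF : ∀ z ∈ O, ContinuousAt F z)
    (hη : ContDiff ℝ ∞ η) (hηc : HasCompactSupport η) (hηO : tsupport η ⊆ O) :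
    ∀ᵐ z, η z * u z = RepF lam rho e₁ e₂ B₁ B₂ c F u η z := by
  have l1 := hw.lb η hη hηc hηO
  obtain ⟨⟨M1, hM1⟩, l2⟩ := hw.lb (Pc e₁ B₁ η) (Pc_smooth hη hηO hB₁) (cs_of_le hηc Pc_supp) (Pc_supp.trans hηO)
  obtain ⟨⟨M2, hM2⟩, l3⟩ := hw.lb (Pc e₂ B₂ η) (Pc_smooth hη hηO hB₂) (cs_of_le hηc Pc_supp) (Pc_supp.trans hηO)
  obtain ⟨⟨M0, hM0⟩, l0⟩ := Gd_bdd hw hB₁ hB₂ hc hF hη hηc hηO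
  have hFc := cont_mul hη.continuous fun z hz => hF z (hηO hz)
  filter_upwards [hk2_tendsto hr hrc hr1 l1.2] with z hz
  have step : ∀ k, hk 2 rho (fun w => η w * u w) (k+1) z - hk 2 rho (fun w => η w * u w) k z
      = hk 0 lam (Gd e₁ e₂ B₁ B₂ c F u η) k z - hk 1 (dd e₁ lam) (fun w => Pc e₁ B₁ η w * u w) k z
        - hk 1 (dd e₂ lam) (fun w => Pc e₂ B₂ η w * u w) k z := by
    intro k
    have hid := rep_kernel hw hB₁ hB₂ hc hFc.locallyIntegrable hη hηc hηO (sc_smooth hl k) (sc_cs hlc k) z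
    have hd2 : ∀ e w, dd e (dd e (sc k lam)) w = 2^k * (2^k * sc k (dd e (dd e lam)) w) := by
      intro e w
      rw [dd_sc hl, dd_const_mul _ ((sc_smooth (dd_smooth hl) k).differentiable (by simp) w), dd_sc (dd_smooth hl)]
    have hker : (fun w => dd e₁ (dd e₁ (sc k lam)) w + dd e₂ (dd e₂ (sc k lam)) w)
        = fun w => (2^(k+1))^2 * sc (k+1) rho w - (2^k)^2 * sc k rho w := by
      funext w
      rw [hd2, hd2]
      have := hlr ((2:ℝ)^k • w)
      rw [smul_smul, ← pow_succ'] at this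
      simp only [sc]
      have e4 : ((2:ℝ)^(k+1))^2 = 4 * (2^k)^2 := by ring
      rw [e4]
      linear_combination (2^k)^2 * this
    rw [hker, dd_sc hl, dd_sc hl, cv_sub, cv_const_mul, cv_const_mul, cv_const_mul, cv_const_mul] at hid
    · unfold hk
      simp only [pow_zero, one_mul, pow_one]
      exact hid
    · exact (contDiff_const.mul (sc_smooth hr (k+1))).continuous
    · exact (sc_cs hrc (k+1)).mul_left
    · exact (contDiff_const.mul (sc_smooth hr k)).continuous
    · exact (sc_cs hrc k).mul_left
    · exact l1.2
  have hsum : ∀ K, hk 2 rho (fun w => η w * u w) K z = hk 2 rho (fun w => η w * u w) 0 z +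
      (∑ k ∈ Finset.range K, hk 0 lam (Gd e₁ e₂ B₁ B₂ c F u η) k z
        - ∑ k ∈ Finset.range K, hk 1 (dd e₁ lam) (fun w => Pc e₁ B₁ η w * u w) k z
        - ∑ k ∈ Finset.range K, hk 1 (dd e₂ lam) (fun w => Pc e₂ B₂ η w * u w) k z) := by
    intro K
    rw [← Finset.sum_sub_distrib, ← Finset.sum_sub_distrib, ← Finset.sum_congr rfl fun k _ => step k,
      Finset.sum_range_sub (fun k => hk 2 rho (fun w => η w * u w) k z)]
    ring
  have t0 := hk_hasSum (j := 0) (by norm_num) hl hlc hM0 z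
  have t1 := hk_hasSum (j := 1) (by norm_num) (dd_smooth (v := e₁) hl) (dd_cs hlc) hM1 z
  have t2 := hk_hasSum (j := 1) (by norm_num) (dd_smooth (v := e₂) hl) (dd_cs hlc) hM2 z
  have t3 := ((t0.sub t1).sub t2).const_add (hk 2 rho (fun w => η w * u w) 0 z)
  have := tendsto_nhds_unique hz (t3.congr fun K => (hsum K).symm)
  simp only [this, RepF]
  rw [(Np_C1 hl hlc l2 hM1).2 e₁, (Np_C1 hl hlc l3 hM2).2 e₂]
  unfold Np
  ring

lemma eq_of_ae_near {f g : ℝ × ℝ → ℝ} {z : ℝ × ℝ} {U : Set (ℝ × ℝ)} (hU : U ∈ 𝓝 z)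
    (hf : ContinuousAt f z) (hg : ContinuousAt g z) (h : ∀ᵐ w, w ∈ U → f w = g w) : f z = g z := by
  have hfr : ∃ᶠ w in 𝓝 z, f w = g w := by
    intro hev
    have hV : {w | w ∈ U ∧ ¬ f w = g w} ∈ 𝓝 z := inter_mem hU hev
    have h0 : volume {w | w ∈ U ∧ ¬ f w = g w} = 0 := by
      rw [ae_iff] at h
      convert h using 3
      simp
    exact (Measure.measure_pos_of_mem_nhds volume hV).ne' h0
  by_contra hne
  have : ∀ᶠ w in 𝓝 z, f w - g w ≠ 0 := (hf.sub hg).eventually_ne (sub_ne_zero.2 hne)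
  obtain ⟨w, h1, h2⟩ := (hfr.and_eventually this).exists
  exact h2 (sub_eq_zero.2 h1)
end

/-- bump functions -/
lemma exists_bump {O : Set (ℝ × ℝ)} (hO : IsOpen O) {z : ℝ × ℝ} (hz : z ∈ O) :
    ∃ η : ℝ × ℝ → ℝ, ContDiff ℝ ∞ η ∧ HasCompactSupport η ∧ tsupport η ⊆ O ∧
      (∀ w, 0 ≤ η w) ∧ ∀ᶠ w in 𝓝 z, η w = 1 := by
  obtain ⟨ε, hε, hb⟩ := Metric.nhds_basis_closedBall.mem_iff.1 (hO.mem_nhds hz)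
  let f : ContDiffBump z := ⟨ε/2, ε, by positivity, by linarith⟩
  refine ⟨f, f.contDiff, f.hasCompactSupport, ?_, fun w => f.nonneg, f.eventuallyEq_one⟩
  rw [f.tsupport_eq]
  exact hb

def G1 (α : ℝ) (u : ℝ × ℝ → ℝ) : Prop := ContDiff ℝ 1 u ∧ ∀ v z, LH α (dd v u) z
def G2 (α : ℝ) (u : ℝ × ℝ → ℝ) : Prop := ContDiff ℝ 2 u ∧ ∀ v w z, LH α (dd w (dd v u)) z

section
variable {α : ℝ} {a b : ℝ × ℝ → ℝ}
lemma dd_add_fun {v : ℝ × ℝ} (ha : ContDiff ℝ 1 a) (hb : ContDiff ℝ 1 b) :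
    dd v (fun z => a z + b z) = fun z => dd v a z + dd v b z := by
  funext z; exact dd_add (ha.differentiable (by simp) z) (hb.differentiable (by simp) z)
lemma dd_sub_fun {v : ℝ × ℝ} (ha : ContDiff ℝ 1 a) (hb : ContDiff ℝ 1 b) :
    dd v (fun z => a z - b z) = fun z => dd v a z - dd v b z := by
  funext z; exact dd_sub (ha.differentiable (by simp) z) (hb.differentiable (by simp) z)
lemma contDiff_dd {n m : ℕ∞} (h : ContDiff ℝ n a) (hmn : (m:WithTop ℕ∞) + 1 ≤ n) (v : ℝ × ℝ) :
    ContDiff ℝ m (dd v a) := (h.fderiv_right hmn).clm_apply contDiff_const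
lemma G1.add (ha : G1 α a) (hb : G1 α b) : G1 α (fun z => a z + b z) :=
  ⟨ha.1.add hb.1, fun v z => by rw [dd_add_fun ha.1 hb.1]; exact (ha.2 v z).add (hb.2 v z)⟩
lemma G1.sub (ha : G1 α a) (hb : G1 α b) : G1 α (fun z => a z - b z) :=
  ⟨ha.1.sub hb.1, fun v z => by rw [dd_sub_fun ha.1 hb.1]; exact (ha.2 v z).sub (hb.2 v z)⟩
lemma G2.add (ha : G2 α a) (hb : G2 α b) : G2 α (fun z => a z + b z) :=
  ⟨ha.1.add hb.1, fun v w z => by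
    rw [dd_add_fun (ha.1.of_le (by norm_num)) (hb.1.of_le (by norm_num)),
      dd_add_fun (contDiff_dd (n := 2) (m := 1) ha.1 (by norm_num) v) (contDiff_dd (n := 2) (m := 1) hb.1 (by norm_num) v)]
    exact (ha.2 v w z).add (hb.2 v w z)⟩
lemma G2.sub (ha : G2 α a) (hb : G2 α b) : G2 α (fun z => a z - b z) :=
  ⟨ha.1.sub hb.1, fun v w z => by
    rw [dd_sub_fun (ha.1.of_le (by norm_num)) (hb.1.of_le (by norm_num)),
      dd_sub_fun (contDiff_dd (n := 2) (m := 1) ha.1 (by norm_num) v) (contDiff_dd (n := 2) (m := 1) hb.1 (by norm_num) v)]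
    exact (ha.2 v w z).sub (hb.2 v w z)⟩
lemma G2.of_smooth (hα0 : 0 < α) (hα1 : α < 1) (h : ContDiff ℝ ∞ a) : G2 α a :=
  ⟨h.of_le (WithTop.coe_le_coe.2 le_top), fun v w z => LH.of_C1 hα1 hα0 ((dd_smooth (dd_smooth h)).of_le (by simp)).contDiffAt⟩
lemma G2.G1 (hα0 : 0 < α) (hα1 : α < 1) (h : G2 α a) : G1 α a :=
  ⟨h.1.of_le (by norm_num), fun v z => LH.of_C1 hα1 hα0 (contDiff_dd (n := 2) (m := 1) h.1 (by norm_num) v).contDiffAt⟩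

/-- product of cutoff with locally Hölder function -/
lemma LH_cut {O : Set (ℝ × ℝ)} (hα0 : 0 < α) (hα1 : α < 1) {φ u : ℝ × ℝ → ℝ} (hφ : ContDiff ℝ 1 φ)
    (hs : tsupport φ ⊆ O) (hu : ∀ z ∈ O, LH α u z) (z : ℝ × ℝ) : LH α (fun w => φ w * u w) z := by
  by_cases hz : z ∈ tsupport φ
  · exact (LH.of_C1 hα1 hα0 hφ.contDiffAt).mul hα0 (hu z (hs hz))
  · have : (fun _ => (0:ℝ)) =ᶠ[𝓝 z] (fun w => φ w * u w) := by
      filter_upwards [(isClosed_tsupport φ).isOpen_compl.mem_nhds hz] with w hw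
      rw [image_eq_zero_of_notMem_tsupport hw, zero_mul]
    exact (LH.of_C1 hα1 hα0 contDiffAt_const).congr this

lemma G1_Np_dd {lam g : ℝ × ℝ → ℝ} (hα0 : 0 < α) (hα1 : α < 1) (hl : ContDiff ℝ ∞ lam) (hlc : HasCompactSupport lam)
    (hg : ∀ z, LH α g z) (hgc : HasCompactSupport g) :
    G2 α (Np lam g) ∧ ∀ v, G1 α (dd v (Np lam g)) := by
  have hcont : Continuous g := continuous_iff_continuousAt.2 fun z => (hg z).continuousAt hα0
  obtain ⟨M, hM⟩ := hcont.bounded_above_of_compact_support hgc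
  have := Np_C2 hl hlc hcont.locallyIntegrable hM hα0 hα1 (LH.global hα0 hgc hg)
  have h2 : G2 α (Np lam g) := ⟨this.1, fun v w z => LH.of_g (this.2 v w)⟩
  exact ⟨h2, fun v => ⟨contDiff_dd (n := 2) (m := 1) this.1 (by norm_num) v, fun w z => LH.of_g (this.2 v w)⟩⟩
end
end Part6

section Part7
open Real Set MeasureTheory
open Filter Topology
open scoped ContDiff

section
variable {α : ℝ} {e₁ e₂ : ℝ × ℝ} {X Y : (ℝ × ℝ) →L[ℝ] ℝ} {O : Set (ℝ × ℝ)} {B₁ B₂ c F u : ℝ × ℝ → ℝ}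

lemma bracket_zero {φ : ℝ × ℝ → ℝ} {z : ℝ × ℝ} (hz : z ∉ tsupport φ) :
    (-(dd e₁ (dd e₁ φ) z + dd e₂ (dd e₂ φ) z) + dd e₁ (fun w => B₁ w * φ w) z
      + dd e₂ (fun w => B₂ w * φ w) z + c z * φ z) = 0 := by
  have h1 : ∀ e, dd e (dd e φ) z = 0 := fun e =>
    image_eq_zero_of_notMem_tsupport fun h => hz (tsupport_dd_le (tsupport_dd_le h))
  have h2 : ∀ e (B : ℝ × ℝ → ℝ), dd e (fun w => B w * φ w) z = 0 := fun e B =>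
    image_eq_zero_of_notMem_tsupport fun h => hz (tsupport_mul_le_right (tsupport_dd_le h))
  rw [h1, h1, h2, h2, image_eq_zero_of_notMem_tsupport hz]
  simp

lemma WeakSol.congr {v : ℝ × ℝ → ℝ} (hw : WeakSol e₁ e₂ O B₁ B₂ c F u)
    (hae : ∀ᵐ z, z ∈ O → v z = u z) (hv : ∀ z ∈ O, ContinuousAt v z) :
    WeakSol e₁ e₂ O B₁ B₂ c F v := by
  refine ⟨fun φ hφ hc hs => ?_, fun φ hφ hc hs => ?_⟩
  · have h := cont_mul hφ.continuous (fun z hz => hv z (hs hz))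
    have h' : Continuous (fun z => φ z * v z) := by simpa only [mul_comm] using h
    obtain ⟨M, hM⟩ := h'.bounded_above_of_compact_support (hc.mul_right)
    exact ⟨⟨M, hM⟩, h'.locallyIntegrable⟩
  · rw [← hw.wk φ hφ hc hs]
    apply integral_congr_ae
    filter_upwards [hae] with z hz
    by_cases hzs : z ∈ tsupport φ
    · rw [hz (hs hzs)]
    · rw [bracket_zero hzs]; simp

lemma WeakSol.pointwise (hO : IsOpen O) (hw : WeakSol e₁ e₂ O B₁ B₂ c F u)
    (hB₁ : ∀ z ∈ O, ContDiffAt ℝ ∞ B₁ z) (hB₂ : ∀ z ∈ O, ContDiffAt ℝ ∞ B₂ z)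
    (hc : ∀ z ∈ O, ContDiffAt ℝ ∞ c z) (hF : ∀ z ∈ O, ContinuousAt F z)
    (hu : ∀ z ∈ O, ContDiffAt ℝ 2 u z) :
    ∀ z ∈ O, -(dd e₁ (dd e₁ u) z + dd e₂ (dd e₂ u) z) - B₁ z * dd e₁ u z - B₂ z * dd e₂ u z
      + c z * u z = F z := by
  have hu1 : ∀ e, ∀ z ∈ O, ContDiffAt ℝ 1 (dd e u) z := fun e z hz =>
    contDiffAt_dd (n := 2) (m := 1) (hu z hz) (by norm_num) e
  have hu2 : ∀ e, ∀ z ∈ O, ContinuousAt (dd e (dd e u)) z := fun e z hz =>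
    (contDiffAt_dd (n := 1) (m := 0) (hu1 e z hz) (by norm_num) e).continuousAt
  set E : ℝ × ℝ → ℝ := fun z => -(dd e₁ (dd e₁ u) z + dd e₂ (dd e₂ u) z) - B₁ z * dd e₁ u z - B₂ z * dd e₂ u z
      + c z * u z - F z with hE
  have hEc : ∀ z ∈ O, ContinuousAt E z := fun z hz =>
    (((((hu2 e₁ z hz).add (hu2 e₂ z hz)).neg.sub ((hB₁ z hz).continuousAt.mul (hu1 e₁ z hz).continuousAt)).sub
      ((hB₂ z hz).continuousAt.mul (hu1 e₂ z hz).continuousAt)).add ((hc z hz).continuousAt.mul (hu z hz).continuousAt)).sub (hF z hz)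
  have hae : ∀ᵐ z, z ∈ O → E z = 0 := by
    apply hO.ae_eq_zero_of_integral_contDiff_smul_eq_zero
    · exact (show ContinuousOn E O from fun z hz => (hEc z hz).continuousWithinAt).locallyIntegrableOn hO.measurableSet
    intro φ hφ hφc hs
    have hsO : ∀ z ∈ tsupport φ, z ∈ O := fun z hz => hs hz
    have hφ1 : ContDiff ℝ 1 φ := hφ.of_le (by simp)
    have hwk := hw.wk φ hφ hφc hs
    -- integration by parts
    have ibp2 : ∀ e, ∫ z, u z * dd e (dd e φ) z = ∫ z, dd e (dd e u) z * φ z := by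
      intro e
      rw [dd_ibp ((dd_smooth hφ).of_le (by simp)) (dd_cs hφc) (fun z hz => (hu z (hs (tsupport_dd_le hz))).of_le (by norm_num)),
        dd_ibp hφ1 hφc (fun z hz => hu1 e z (hs hz)), neg_neg]
    have ibp1 : ∀ e (B : ℝ × ℝ → ℝ), (∀ z ∈ O, ContDiffAt ℝ ∞ B z) →
        ∫ z, u z * dd e (fun w => B w * φ w) z = - ∫ z, dd e u z * (B z * φ z) := by
      intro e B hB
      exact dd_ibp ((smooth_mul hφ fun z hz => hB z (hs hz)).of_le (by simp)) hφc.mul_left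
        (fun z hz => (hu z (hs (tsupport_mul_le_right hz))).of_le (by norm_num))
    have uc : ∀ z ∈ tsupport φ, ContinuousAt u z := fun z hz => (hu z (hs hz)).continuousAt
    have j1 : ∀ e, Integrable (fun z => u z * dd e (dd e φ) z) := fun e =>
      int_supp (dd_smooth (dd_smooth hφ)).continuous (dd_cs (dd_cs hφc))
        (fun z hz => uc z (tsupport_dd_le (tsupport_dd_le hz)))
    have j2 : ∀ e (B : ℝ × ℝ → ℝ), (∀ z ∈ O, ContDiffAt ℝ ∞ B z) →
        Integrable (fun z => u z * dd e (fun w => B w * φ w) z) := fun e B hB =>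
      int_supp (dd_smooth (smooth_mul hφ fun z hz => hB z (hs hz))).continuous (dd_cs hφc.mul_left)
        (fun z hz => uc z (tsupport_mul_le_right (tsupport_dd_le hz)))
    have j3 : Integrable (fun z => u z * (c z * φ z)) :=
      int_supp (smooth_mul hφ fun z hz => hc z (hs hz)).continuous hφc.mul_left
        (fun z hz => uc z (tsupport_mul_le_right hz))
    have k1 : ∀ e, Integrable (fun z => dd e (dd e u) z * φ z) := fun e =>
      int_supp hφ.continuous hφc (fun z hz => hu2 e z (hs hz))
    have k2 : ∀ e (B : ℝ × ℝ → ℝ), (∀ z ∈ O, ContDiffAt ℝ ∞ B z) →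
        Integrable (fun z => dd e u z * (B z * φ z)) := fun e B hB =>
      int_supp (smooth_mul hφ fun z hz => hB z (hs hz)).continuous hφc.mul_left
        (fun z hz => (hu1 e z (hs (tsupport_mul_le_right hz))).continuousAt)
    have k3 : Integrable (fun z => F z * φ z) := int_supp hφ.continuous hφc (fun z hz => hF z (hs hz))
    have hL : ∫ z, u z * (-(dd e₁ (dd e₁ φ) z + dd e₂ (dd e₂ φ) z) + dd e₁ (fun w => B₁ w * φ w) z
      + dd e₂ (fun w => B₂ w * φ w) z + c z * φ z) = -(∫ z, u z * dd e₁ (dd e₁ φ) z) -(∫ z, u z * dd e₂ (dd e₂ φ) z)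
        + (∫ z, u z * dd e₁ (fun w => B₁ w * φ w) z) + (∫ z, u z * dd e₂ (fun w => B₂ w * φ w) z)
        + ∫ z, u z * (c z * φ z) := by
      rw [← integral_neg, ← integral_sub, ← integral_add, ← integral_add, ← integral_add]
      · congr 1; funext z; ring
      · exact ((((j1 e₁).neg.sub (j1 e₂)).add (j2 e₁ B₁ hB₁)).add (j2 e₂ B₂ hB₂))
      · exact j3
      · exact (((j1 e₁).neg.sub (j1 e₂)).add (j2 e₁ B₁ hB₁))
      · exact j2 e₂ B₂ hB₂
      · exact ((j1 e₁).neg.sub (j1 e₂))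
      · exact j2 e₁ B₁ hB₁
      · exact (j1 e₁).neg
      · exact j1 e₂
    have hR : ∫ z, φ z • E z = -(∫ z, dd e₁ (dd e₁ u) z * φ z) - (∫ z, dd e₂ (dd e₂ u) z * φ z)
        - (∫ z, dd e₁ u z * (B₁ z * φ z)) - (∫ z, dd e₂ u z * (B₂ z * φ z)) + (∫ z, u z * (c z * φ z))
        - ∫ z, F z * φ z := by
      rw [← integral_neg, ← integral_sub, ← integral_sub, ← integral_sub, ← integral_add, ← integral_sub]
      · congr 1; funext z; simp only [hE, smul_eq_mul]; ring
      · exact (((((k1 e₁).neg.sub (k1 e₂)).sub (k2 e₁ B₁ hB₁)).sub (k2 e₂ B₂ hB₂)).add j3)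
      · exact k3
      · exact (((k1 e₁).neg.sub (k1 e₂)).sub (k2 e₁ B₁ hB₁)).sub (k2 e₂ B₂ hB₂)
      · exact j3
      · exact (((k1 e₁).neg.sub (k1 e₂)).sub (k2 e₁ B₁ hB₁))
      · exact k2 e₂ B₂ hB₂
      · exact ((k1 e₁).neg.sub (k1 e₂))
      · exact k2 e₁ B₁ hB₁
      · exact (k1 e₁).neg
      · exact k1 e₂
    rw [hR]
    rw [hL, ibp2, ibp2, ibp1 _ _ hB₁, ibp1 _ _ hB₂] at hwk
    linarith
  intro z hz
  have := eq_of_ae_near (hO.mem_nhds hz) (hEc z hz) (continuousAt_const (y := (0:ℝ))) hae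
  simp only [hE] at this
  linarith

/-- Weyl-type regularity lemma. -/
theorem weyl (hfr : Frame e₁ e₂ X Y) (hO : IsOpen O) (hα0 : 0 < α) (hα1 : α < 1)
    (hw : WeakSol e₁ e₂ O B₁ B₂ c F u)
    (hB₁ : ∀ z ∈ O, ContDiffAt ℝ ∞ B₁ z) (hB₂ : ∀ z ∈ O, ContDiffAt ℝ ∞ B₂ z)
    (hc : ∀ z ∈ O, ContDiffAt ℝ ∞ c z) (hF : ∀ z ∈ O, LH α F z) :
    ∃ v : ℝ × ℝ → ℝ, (∀ᵐ z, z ∈ O → v z = u z) ∧ (∀ z ∈ O, ContDiffAt ℝ 2 v z) ∧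
      (∀ z ∈ O, ∀ a b, LH α (dd b (dd a v)) z) ∧
      ∀ z ∈ O, -(dd e₁ (dd e₁ v) z + dd e₂ (dd e₂ v) z) - B₁ z * dd e₁ v z - B₂ z * dd e₂ v z
      + c z * v z = F z := by
  obtain ⟨lam, rho, hl, hlc, hr, hrc, hr1, hlr⟩ := exists_kernel hfr
  have hFc : ∀ z ∈ O, ContinuousAt F z := fun z hz => (hF z hz).continuousAt hα0
  choose! η hη hηc hηO hηn hη1 using fun z (hz : z ∈ O) => exists_bump hO hz
  -- Step 1
  have s1 : ∀ z ∈ O, ∀ w, LH α (RepF lam rho e₁ e₂ B₁ B₂ c F u (η z)) w := by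
    intro z hz w
    obtain ⟨⟨M3, hM3⟩, l1⟩ := hw.lb (η z) (hη z hz) (hηc z hz) (hηO z hz)
    obtain ⟨⟨M1, hM1⟩, l2⟩ := hw.lb (Pc e₁ B₁ (η z)) (Pc_smooth (hη z hz) (hηO z hz) hB₁) (cs_of_le (hηc z hz) Pc_supp) (Pc_supp.trans (hηO z hz))
    obtain ⟨⟨M2, hM2⟩, l3⟩ := hw.lb (Pc e₂ B₂ (η z)) (Pc_smooth (hη z hz) (hηO z hz) hB₂) (cs_of_le (hηc z hz) Pc_supp) (Pc_supp.trans (hηO z hz))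
    obtain ⟨⟨M0, hM0⟩, l0⟩ := Gd_bdd hw hB₁ hB₂ hc hFc (hη z hz) (hηc z hz) (hηO z hz)
    refine LH.sub (LH.sub (LH.add ?_ ?_) ?_) ?_
    · exact LH.of_C1 hα1 hα0 ((hk_smooth hr hrc l1 2 0).of_le (by simp)).contDiffAt
    · exact LH.of_C1 hα1 hα0 (Np_C1 hl hlc l0 hM0).1.contDiffAt
    · exact LH.of_g (Np_holder hl hlc l2 hM1 hα0 hα1 _)
    · exact LH.of_g (Np_holder hl hlc l3 hM2 hα0 hα1 _)
  have a1 : ∀ z ∈ O, ∀ᵐ w, η z w * u w = RepF lam rho e₁ e₂ B₁ B₂ c F u (η z) w := fun z hz =>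
    rep_ae hw hl hlc hr hrc hr1 hlr hB₁ hB₂ hc hFc (hη z hz) (hηc z hz) (hηO z hz)
  set v : ℝ × ℝ → ℝ := fun z => RepF lam rho e₁ e₂ B₁ B₂ c F u (η z) z with hv
  have hvloc : ∀ z ∈ O, v =ᶠ[𝓝 z] RepF lam rho e₁ e₂ B₁ B₂ c F u (η z) := by
    intro z hz
    filter_upwards [(hη1 z hz).eventually_nhds, hO.mem_nhds hz] with w hw1 hwO
    refine eq_of_ae_near (f := RepF lam rho e₁ e₂ B₁ B₂ c F u (η w)) (g := RepF lam rho e₁ e₂ B₁ B₂ c F u (η z)) (U := {x | η z x = 1} ∩ {x | η w x = 1}) (inter_mem hw1 (hη1 w hwO)) ((s1 w hwO w).continuousAt hα0)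
      ((s1 z hz w).continuousAt hα0) ?_
    filter_upwards [a1 z hz, a1 w hwO] with x hx1 hx2 hxU
    have e1 : η z x = 1 := hxU.1
    have e2 : η w x = 1 := hxU.2
    rw [← hx1, ← hx2, e1, e2]
  have hvae : ∀ᵐ z, z ∈ O → v z = u z := by
    rw [ae_iff]
    apply measure_null_of_locally_null
    intro z hz
    simp only [Classical.not_imp, mem_ofPred_eq] at hz
    refine ⟨{w | v w = RepF lam rho e₁ e₂ B₁ B₂ c F u (η z) w} ∩ {w | η z w = 1} ∩ {w | ¬ (w ∈ O → v w = u w)}, ?_, ?_⟩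
    · exact inter_mem (mem_nhdsWithin_of_mem_nhds (inter_mem (hvloc z hz.1) (hη1 z hz.1))) self_mem_nhdsWithin
    · have := a1 z hz.1
      rw [ae_iff] at this
      refine measure_mono_null ?_ this
      rintro w ⟨⟨h1, h2⟩, h3⟩
      simp only [mem_ofPred_eq, Classical.not_imp] at h1 h2 h3 ⊢
      intro h4
      rw [h2, one_mul, ← h1] at h4
      exact h3.2 h4.symm
  have hvLH : ∀ z ∈ O, LH α v z := fun z hz => (s1 z hz z).congr (hvloc z hz).symm
  -- Step 2
  have hwv := hw.congr hvae fun z hz => (hvLH z hz).continuousAt hα0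
  have hveq : ∀ z ∈ O, v =ᶠ[𝓝 z] RepF lam rho e₁ e₂ B₁ B₂ c F v (η z) ∧
      ((∀ w, LH α (Gd e₁ e₂ B₁ B₂ c F v (η z)) w) ∧ HasCompactSupport (Gd e₁ e₂ B₁ B₂ c F v (η z))) ∧
      ContDiff ℝ ∞ (hk 2 rho (fun w => η z w * v w) 0) := by
    intro z hz
    obtain ⟨⟨M3, hM3⟩, l1⟩ := hwv.lb (η z) (hη z hz) (hηc z hz) (hηO z hz)
    obtain ⟨⟨M1, hM1⟩, l2⟩ := hwv.lb (Pc e₁ B₁ (η z)) (Pc_smooth (hη z hz) (hηO z hz) hB₁) (cs_of_le (hηc z hz) Pc_supp) (Pc_supp.trans (hηO z hz))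
    obtain ⟨⟨M2, hM2⟩, l3⟩ := hwv.lb (Pc e₂ B₂ (η z)) (Pc_smooth (hη z hz) (hηO z hz) hB₂) (cs_of_le (hηc z hz) Pc_supp) (Pc_supp.trans (hηO z hz))
    obtain ⟨⟨M0, hM0⟩, l0⟩ := Gd_bdd hwv hB₁ hB₂ hc hFc (hη z hz) (hηc z hz) (hηO z hz)
    have ss := hk_smooth hr hrc l1 2 0
    have hcont : Continuous (RepF lam rho e₁ e₂ B₁ B₂ c F v (η z)) := by
      refine ((ss.continuous.add (Np_C1 hl hlc l0 hM0).1.continuous).sub ?_).sub ?_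
      · exact (contDiff_dd (n := 1) (m := 0) (Np_C1 hl hlc l2 hM1).1 (by norm_num) _).continuous
      · exact (contDiff_dd (n := 1) (m := 0) (Np_C1 hl hlc l3 hM2).1 (by norm_num) _).continuous
    refine ⟨?_, ⟨?_, ?_⟩, ss⟩
    · filter_upwards [(hη1 z hz).eventually_nhds, hO.mem_nhds hz] with w hw1 hwO
      refine eq_of_ae_near (U := {x | η z x = 1}) hw1 ((hvLH w hwO).continuousAt hα0)
        hcont.continuousAt ?_
      filter_upwards [rep_ae hwv hl hlc hr hrc hr1 hlr hB₁ hB₂ hc hFc (hη z hz) (hηc z hz) (hηO z hz)] with x hx1 hxU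
      have e1 : η z x = 1 := hxU
      rw [← hx1, e1, one_mul]
    · intro w
      have h1 := LH_cut hα0 hα1 ((Qt_smooth (e₁ := e₁) (e₂ := e₂) (hη z hz) (hηO z hz) hB₁ hB₂ hc).of_le (by simp)) (Qt_supp.trans (hηO z hz)) hvLH w
      have h2 := LH_cut hα0 hα1 ((hη z hz).of_le (by simp)) (hηO z hz) hF w
      refine (h1.sub h2).congr (Eventually.of_forall fun x => ?_)
      simp only [Gd]; ring
    · refine cs_of_le (hηc z hz) (tsupport_sub_le ?_ tsupport_mul_le_right)
      exact (tsupport_mul_subset_left).trans Qt_supp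
  have hcutLH : ∀ z ∈ O, ∀ e (B : ℝ × ℝ → ℝ), (∀ z ∈ O, ContDiffAt ℝ ∞ B z) → (∀ w, LH α (fun w => Pc e B (η z) w * v w) w) ∧
      HasCompactSupport (fun w => Pc e B (η z) w * v w) := fun z hz e B hB =>
    ⟨fun w => LH_cut hα0 hα1 ((Pc_smooth (hη z hz) (hηO z hz) hB).of_le (by simp)) (Pc_supp.trans (hηO z hz)) hvLH w,
      cs_of_le (hηc z hz) ((tsupport_mul_subset_left).trans Pc_supp)⟩
  have hv1 : ∀ z ∈ O, ContDiffAt ℝ 1 v z ∧ ∀ a, LH α (dd a v) z := by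
    intro z hz
    obtain ⟨heq, ⟨hG, hGc⟩, hs⟩ := hveq z hz
    have c1 := hcutLH z hz e₁ B₁ hB₁
    have c2 := hcutLH z hz e₂ B₂ hB₂
    have : G1 α (RepF lam rho e₁ e₂ B₁ B₂ c F v (η z)) := by
      refine ((((G2.of_smooth hα0 hα1 hs).G1 hα0 hα1).add ((G1_Np_dd hα0 hα1 hl hlc hG hGc).1.G1 hα0 hα1)).sub ?_).sub ?_
      · exact (G1_Np_dd hα0 hα1 hl hlc c1.1 c1.2).2 _
      · exact (G1_Np_dd hα0 hα1 hl hlc c2.1 c2.2).2 _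
    exact ⟨this.1.contDiffAt.congr_of_eventuallyEq heq, fun a => (this.2 a z).congr (dd_eventuallyEq heq).symm⟩
  -- Step 3
  have hv2 : ∀ z ∈ O, ContDiffAt ℝ 2 v z ∧ ∀ a b, LH α (dd b (dd a v)) z := by
    intro z hz
    obtain ⟨heq, ⟨hG, hGc⟩, hs⟩ := hveq z hz
    have key : ∀ e (B : ℝ × ℝ → ℝ), (∀ z ∈ O, ContDiffAt ℝ ∞ B z) →
        G2 α (dd e (Np lam (fun w => Pc e B (η z) w * v w))) := by
      intro e B hB
      have hP : ContDiff ℝ ∞ (Pc e B (η z)) := Pc_smooth (hη z hz) (hηO z hz) hB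
      have hPs : tsupport (Pc e B (η z)) ⊆ O := Pc_supp.trans (hηO z hz)
      have hC1 : ContDiff ℝ 1 (fun w => Pc e B (η z) w * v w) := by
        have := smooth_mul (hP.of_le (by simp) : ContDiff ℝ 1 _) (fun z hz => (hv1 z (hPs hz)).1)
        simpa only [mul_comm] using this
      have hcs := (hcutLH z hz e B hB).2
      rw [Np_dd_comm hl hlc hC1 hcs]
      refine (G1_Np_dd hα0 hα1 hl hlc ?_ (dd_cs hcs)).1
      intro w
      have h1 := LH_cut hα0 hα1 (hP.of_le (by simp)) hPs (fun x hx => (hv1 x hx).2 e) w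
      have h2 := LH_cut hα0 hα1 ((dd_smooth (v := e) hP).of_le (by simp)) (tsupport_dd_le.trans hPs) hvLH w
      refine (h1.add h2).congr (Eventually.of_forall fun x => ?_)
      show Pc e B (η z) x * dd e v x + dd e (Pc e B (η z)) x * v x = dd e (fun w => Pc e B (η z) w * v w) x
      by_cases hx : x ∈ O
      · rw [dd_mul (hP.differentiable (by simp) x) ((hv1 x hx).1.differentiableAt (by simp))]
        ring
      · have hx1 : x ∉ tsupport (Pc e B (η z)) := fun h => hx (hPs h)
        have hx2 : x ∉ tsupport (dd e (Pc e B (η z))) := fun h => hx1 (tsupport_dd_le h)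
        have hx3 : x ∉ tsupport (dd e (fun w => Pc e B (η z) w * v w)) := fun h => hx1 (tsupport_mul_subset_left (tsupport_dd_le h))
        rw [image_eq_zero_of_notMem_tsupport hx1, image_eq_zero_of_notMem_tsupport hx2, image_eq_zero_of_notMem_tsupport hx3]
        ring
    have : G2 α (RepF lam rho e₁ e₂ B₁ B₂ c F v (η z)) :=
      (((G2.of_smooth hα0 hα1 hs).add (G1_Np_dd hα0 hα1 hl hlc hG hGc).1).sub (key e₁ B₁ hB₁)).sub (key e₂ B₂ hB₂)
    exact ⟨this.1.contDiffAt.congr_of_eventuallyEq heq, fun a b => (this.2 a b z).congr (dd_eventuallyEq (dd_eventuallyEq heq)).symm⟩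
  exact ⟨v, hvae, fun z hz => (hv2 z hz).1, fun z hz => (hv2 z hz).2,
    hwv.pointwise hO hB₁ hB₂ hc hFc fun z hz => (hv2 z hz).1⟩
end
end Part7

section Part8

open Real Set MeasureTheory


open Filter Topology
open scoped ContDiff

/-- Data of a two-dimensional operator in a frame. -/
structure HOp where
  e₁ : ℝ × ℝ
  e₂ : ℝ × ℝ
  a : ℝ × ℝ → ℝ
  b₁ : ℝ × ℝ → ℝ
  b₂ : ℝ × ℝ → ℝ
  r : ℝ

structure HOp.Good (P : HOp) : Prop where
  ha : ContDiff ℝ ∞ P.a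
  hb₁ : ContDiff ℝ ∞ P.b₁
  hb₂ : ContDiff ℝ ∞ P.b₂
  hr : 0 < P.r

def HOp.L (P : HOp) (u : ℝ × ℝ → ℝ) (z : ℝ × ℝ) : ℝ :=
  -P.a z * (dd P.e₁ (dd P.e₁ u) z + dd P.e₂ (dd P.e₂ u) z) - P.b₁ z * dd P.e₁ u z
    - P.b₂ z * dd P.e₂ u z + P.r * u z

/-- central first difference -/
def df1 (h : ℝ) (e : ℝ × ℝ) (u : ℝ × ℝ → ℝ) (z : ℝ × ℝ) : ℝ := (u (z + h • e) - u (z - h • e)) / (2 * h)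
/-- second difference -/
def df2 (h : ℝ) (e : ℝ × ℝ) (u : ℝ × ℝ → ℝ) (z : ℝ × ℝ) : ℝ :=
  (u (z + h • e) + u (z - h • e) - 2 * u z) / h ^ 2

def HOp.Lh (P : HOp) (h : ℝ) (u : ℝ × ℝ → ℝ) (z : ℝ × ℝ) : ℝ :=
  -P.a z * (df2 h P.e₁ u z + df2 h P.e₂ u z) - P.b₁ z * df1 h P.e₁ u z
    - P.b₂ z * df1 h P.e₂ u z + P.r * u z

/-- weighted neighbour sum -/
def HOp.Sh (P : HOp) (h : ℝ) (u : ℝ × ℝ → ℝ) (z : ℝ × ℝ) : ℝ :=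
  (P.a z / h ^ 2 + P.b₁ z / (2 * h)) * u (z + h • P.e₁) + (P.a z / h ^ 2 - P.b₁ z / (2 * h)) * u (z - h • P.e₁)
  + (P.a z / h ^ 2 + P.b₂ z / (2 * h)) * u (z + h • P.e₂) + (P.a z / h ^ 2 - P.b₂ z / (2 * h)) * u (z - h • P.e₂)

lemma HOp.Lh_eq (P : HOp) (h : ℝ) (u : ℝ × ℝ → ℝ) (z : ℝ × ℝ) :
    P.Lh h u z = (4 * P.a z / h ^ 2 + P.r) * u z - P.Sh h u z := by
  simp only [HOp.Lh, HOp.Sh, df1, df2]; ring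

/-- positivity of the weights -/
def HOp.pos (P : HOp) (h : ℝ) (z : ℝ × ℝ) : Prop := 0 < h ∧ 0 ≤ P.a z ∧ h * |P.b₁ z| ≤ 2 * P.a z ∧ h * |P.b₂ z| ≤ 2 * P.a z

lemma wt_nonneg {h a b : ℝ} (hh : 0 < h) (hb : h * |b| ≤ 2 * a) : 0 ≤ a / h ^ 2 + b / (2 * h) ∧ 0 ≤ a / h ^ 2 - b / (2 * h) := by
  have e1 : a / h ^ 2 + b / (2 * h) = (2 * a + h * b) / (2 * h ^ 2) := by field_simp
  have e2 : a / h ^ 2 - b / (2 * h) = (2 * a - h * b) / (2 * h ^ 2) := by field_simp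
  have h1 := le_abs_self b
  have h2 := neg_abs_le b
  rw [e1, e2]
  constructor
  · apply div_nonneg _ (by positivity); nlinarith
  · apply div_nonneg _ (by positivity); nlinarith

lemma HOp.Sh_mono {P : HOp} {h : ℝ} {z : ℝ × ℝ} (hp : P.pos h z) {u v : ℝ × ℝ → ℝ}
    (h1 : u (z + h • P.e₁) ≤ v (z + h • P.e₁)) (h2 : u (z - h • P.e₁) ≤ v (z - h • P.e₁))
    (h3 : u (z + h • P.e₂) ≤ v (z + h • P.e₂)) (h4 : u (z - h • P.e₂) ≤ v (z - h • P.e₂)) :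
    P.Sh h u z ≤ P.Sh h v z := by
  obtain ⟨hh, _, hb1, hb2⟩ := hp
  have w1 := wt_nonneg hh hb1
  have w2 := wt_nonneg hh hb2
  unfold HOp.Sh
  gcongr
  · exact w1.1
  · exact w1.2
  · exact w2.1
  · exact w2.2

lemma HOp.Sh_const {P : HOp} {h : ℝ} {z : ℝ × ℝ} {u : ℝ × ℝ → ℝ} (c : ℝ) :
    P.Sh h (fun w => u w + c) z = P.Sh h u z + 4 * P.a z / h ^ 2 * c := by
  simp only [HOp.Sh]; ring

/-- discrete comparison -/
lemma HOp.comparison {P : HOp} (hr : 0 < P.r) {h : ℝ} {D : Set (ℝ × ℝ)} (hp : ∀ z ∈ D, P.pos h z)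
    {A : ℝ} (hA : ∀ z ∈ D, P.a z ≤ A) {u v : ℝ × ℝ → ℝ} {M : ℝ} (hM : ∀ z ∈ D, u z ≤ v z + M)
    (hL : ∀ z ∈ D, P.Lh h u z ≤ P.Lh h v z)
    (hN : ∀ z ∈ D, ∀ t ∈ ({h • P.e₁, -(h • P.e₁), h • P.e₂, -(h • P.e₂)} : Set (ℝ × ℝ)), z + t ∉ D → u (z + t) ≤ v (z + t)) :
    ∀ z ∈ D, u z ≤ v z := by
  intro z₀ hz₀
  have hh : 0 < h := (hp z₀ hz₀).1
  have hA0 : 0 ≤ A := (hp z₀ hz₀).2.1.trans (hA z₀ hz₀)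
  set θ := (4 * A / h ^ 2) / (4 * A / h ^ 2 + P.r) with hθ
  have hθ0 : 0 ≤ θ := by positivity
  have hθ1 : θ < 1 := by rw [hθ, div_lt_one (by positivity)]; linarith
  have key : ∀ k : ℕ, ∀ z ∈ D, u z ≤ v z + θ ^ k * |M| := by
    intro k
    induction k with
    | zero => intro z hz; have := hM z hz; have := le_abs_self M; simp; linarith
    | succ k ih =>
      intro z hz
      have hn : ∀ t ∈ ({h • P.e₁, -(h • P.e₁), h • P.e₂, -(h • P.e₂)} : Set (ℝ × ℝ)), u (z + t) ≤ v (z + t) + θ ^ k * |M| := by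
        intro t ht
        by_cases hD : z + t ∈ D
        · exact ih _ hD
        · have := hN z hz t ht hD
          have : 0 ≤ θ ^ k * |M| := by positivity
          linarith
      have hS : P.Sh h u z ≤ P.Sh h (fun w => v w + θ ^ k * |M|) z := by
        refine HOp.Sh_mono (hp z hz) ?_ ?_ ?_ ?_
        · exact hn _ (by simp)
        · have := hn (-(h • P.e₁)) (by simp); rwa [← sub_eq_add_neg] at this
        · exact hn _ (by simp)
        · have := hn (-(h • P.e₂)) (by simp); rwa [← sub_eq_add_neg] at this
      rw [HOp.Sh_const] at hS
      have hLz := hL z hz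
      rw [HOp.Lh_eq, HOp.Lh_eq] at hLz
      have ha := (hp z hz).2.1
      have hq0 : 0 ≤ 4 * P.a z / h ^ 2 := by positivity
      have hqA : 4 * P.a z / h ^ 2 ≤ 4 * A / h ^ 2 := by
        have := hA z hz
        gcongr
      set Q := 4 * P.a z / h ^ 2
      set QA := 4 * A / h ^ 2
      set m := θ ^ k * |M| with hm
      have hm0 : 0 ≤ m := by positivity
      have h3 : (Q + P.r) * (u z - v z) ≤ Q * m := by linarith
      have h4 : Q ≤ θ * (Q + P.r) := by
        rw [hθ, div_mul_eq_mul_div, le_div_iff₀ (by positivity)]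
        nlinarith
      have h5 : Q * m ≤ (Q + P.r) * (θ * m) := by nlinarith
      have h6 : u z - v z ≤ θ * m := le_of_mul_le_mul_left (h3.trans h5) (by positivity)
      rw [pow_succ', mul_assoc]
      linarith
  have ht : Tendsto (fun k : ℕ => v z₀ + θ ^ k * |M|) atTop (𝓝 (v z₀ + 0 * |M|)) :=
    ((tendsto_pow_atTop_nhds_zero_of_lt_one hθ0 hθ1).mul_const _).const_add _
  have := ge_of_tendsto' ht fun k => key k z₀ hz₀
  simpa using this

/-- one-dimensional consistency -/
lemma diff_est {g g' g'' : ℝ → ℝ} {h ε : ℝ} (hh : 0 < h) 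
    (h1 : ∀ t ∈ Icc (-h) h, HasDerivAt g (g' t) t) (h2 : ∀ t ∈ Icc (-h) h, HasDerivAt g' (g'' t) t)
    (h3 : ∀ t ∈ Icc (-h) h, |g'' t - g'' 0| ≤ ε) :
    |(g h + g (-h) - 2 * g 0) / h ^ 2 - g'' 0| ≤ 2 * ε := by
  have hε : 0 ≤ ε := (abs_nonneg _).trans (h3 0 ⟨by linarith, by linarith⟩)
  have s1 : ∀ t ∈ Icc 0 h, |g' t - g' (-t) - 2 * g'' 0 * t| ≤ 2 * ε * h := by
    intro t ht
    have := (convex_Icc (-h) h).norm_image_sub_le_of_norm_hasDerivWithin_le (f := fun s => g' s - g'' 0 * s)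
      (f' := fun s => g'' s - g'' 0) (C := ε) (x := -t) (y := t) (fun s hs => by
        have := ((h2 s hs).fun_sub ((hasDerivAt_id s).const_mul (g'' 0))).hasDerivWithinAt (s := Icc (-h) h)
        simpa using this) (fun s hs => h3 s hs) ⟨by linarith [ht.2], by linarith [ht.1]⟩ ⟨by linarith [ht.1], by linarith [ht.2]⟩
    simp only [Real.norm_eq_abs] at this
    have e : t - -t = 2 * t := by ring
    rw [e, abs_of_nonneg (by linarith [ht.1] : (0:ℝ) ≤ 2 * t)] at this
    calc _ = |g' t - g'' 0 * t - (g' (-t) - g'' 0 * -t)| := by congr 1; ring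
      _ ≤ _ := this
      _ ≤ _ := by nlinarith [ht.2]
  have := (convex_Icc 0 h).norm_image_sub_le_of_norm_hasDerivWithin_le (f := fun s => g s + g (-s) - g'' 0 * s ^ 2)
      (f' := fun s => g' s - g' (-s) - 2 * g'' 0 * s) (C := 2 * ε * h) (x := 0) (y := h) (fun s hs => by
        have a1 := h1 s ⟨by linarith [hs.1], hs.2⟩
        have a2 := (h1 (-s) ⟨by linarith [hs.2], by linarith [hs.1]⟩).comp s (hasDerivAt_neg s)
        have a3 := ((hasDerivAt_pow 2 s).const_mul (g'' 0))
        have := ((a1.add a2).sub a3).hasDerivWithinAt (s := Icc 0 h)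
        refine this.congr_deriv ?_
        simp; ring) (fun s hs => s1 s hs) ⟨le_rfl, hh.le⟩ ⟨hh.le, le_rfl⟩
  simp only [Real.norm_eq_abs] at this
  rw [sub_zero, abs_of_pos hh] at this
  have e : (g h + g (-h) - 2 * g 0) / h ^ 2 - g'' 0 = (g h + g (-h) - g'' 0 * h ^ 2 - (g 0 + g (-0) - g'' 0 * 0 ^ 2)) / h ^ 2 := by
    field_simp
    simp; ring
  rw [e, abs_div, abs_of_pos (by positivity : 0 < h ^ 2), div_le_iff₀ (by positivity)]
  calc _ ≤ _ := this
    _ = _ := by ring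

lemma diff_est1 {g g' : ℝ → ℝ} {h ε : ℝ} (hh : 0 < h) 
    (h1 : ∀ t ∈ Icc (-h) h, HasDerivAt g (g' t) t) 
    (h3 : ∀ t ∈ Icc (-h) h, |g' t - g' 0| ≤ ε) :
    |(g h - g (-h)) / (2 * h) - g' 0| ≤ ε := by
  have := (convex_Icc (-h) h).norm_image_sub_le_of_norm_hasDerivWithin_le (f := fun s => g s - g' 0 * s)
      (f' := fun s => g' s - g' 0) (C := ε) (x := -h) (y := h) (fun s hs => by
        have := ((h1 s hs).fun_sub ((hasDerivAt_id s).const_mul (g' 0))).hasDerivWithinAt (s := Icc (-h) h)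
        simpa using this) (fun s hs => h3 s hs) ⟨le_rfl, by linarith⟩ ⟨by linarith, le_rfl⟩
  simp only [Real.norm_eq_abs] at this
  have e' : h - -h = 2 * h := by ring
  rw [e', abs_of_pos (by positivity : 0 < 2 * h)] at this
  have e : (g h - g (-h)) / (2 * h) - g' 0 = (g h - g' 0 * h - (g (-h) - g' 0 * -h)) / (2 * h) := by
    field_simp; ring
  rw [e, abs_div, abs_of_pos (by positivity : 0 < 2 * h), div_le_iff₀ (by positivity)]
  exact this

lemma line_deriv {ψ : ℝ × ℝ → ℝ} {z e : ℝ × ℝ} {t : ℝ} (h : DifferentiableAt ℝ ψ (z + t • e)) :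
    HasDerivAt (fun s : ℝ => ψ (z + s • e)) (dd e ψ (z + t • e)) t := by
  have h1 : HasDerivAt (fun s : ℝ => z + s • e) e t := by
    simpa using ((hasDerivAt_id t).smul_const e).const_add z
  exact h.hasFDerivAt.comp_hasDerivAt t h1

lemma small_line {K U : Set (ℝ × ℝ)} (hK : IsCompact K) (hU : IsOpen U) (hKU : K ⊆ U) (e : ℝ × ℝ) {F : ℝ × ℝ → ℝ} (hF : ∀ z ∈ K, ContinuousAt F z)
    {ε : ℝ} (hε : 0 < ε) : ∀ᶠ h in 𝓝[>] (0:ℝ), ∀ z ∈ K, ∀ t ∈ Icc (-h) h, z + t • e ∈ U ∧ |F (z + t • e) - F z| ≤ ε := by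
  have h1 := hK.uniformContinuousAt_of_continuousAt F hF (Metric.dist_mem_uniformity hε)
  obtain ⟨δ1, hδ1, h1⟩ := Metric.mem_uniformity_dist.1 h1
  obtain ⟨δ2, hδ2, h2⟩ := hK.exists_thickening_subset_open hU hKU
  have hlt : ∀ᶠ h in 𝓝[>] (0:ℝ), h * ‖e‖ < min δ1 δ2 := by
    have : Tendsto (fun h : ℝ => h * ‖e‖) (𝓝[>] 0) (𝓝 (0 * ‖e‖)) := (tendsto_nhdsWithin_of_tendsto_nhds tendsto_id).mul_const _
    rw [zero_mul] at this
    exact this.eventually_lt_const (lt_min hδ1 hδ2)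
  filter_upwards [hlt] with h hh z hz t ht
  have hd : dist z (z + t • e) < min δ1 δ2 := by
    rw [dist_self_add_right, norm_smul]
    refine lt_of_le_of_lt ?_ hh
    gcongr
    exact abs_le.2 ht
  refine ⟨h2 (Metric.mem_thickening_iff.2 ⟨z, hz, ?_⟩), ?_⟩
  · rw [dist_comm]; exact hd.trans_le (min_le_right _ _)
  · have := h1 (hd.trans_le (min_le_left _ _)) hz
    simp only [mem_ofPred_eq] at this
    rw [dist_comm, Real.dist_eq] at this
    exact this.le

section
variable {K U : Set (ℝ × ℝ)} {ψ : ℝ × ℝ → ℝ}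

lemma cons2 (hK : IsCompact K) (hU : IsOpen U) (hKU : K ⊆ U) (hψ : ∀ z ∈ U, ContDiffAt ℝ 2 ψ z) (e : ℝ × ℝ)
    {ε : ℝ} (hε : 0 < ε) : ∀ᶠ h in 𝓝[>] (0:ℝ), ∀ z ∈ K, |df2 h e ψ z - dd e (dd e ψ) z| ≤ ε := by
  have hψ1 : ∀ z ∈ U, ContDiffAt ℝ 1 (dd e ψ) z := fun z hz => contDiffAt_dd (n := 2) (m := 1) (hψ z hz) (by norm_num) e
  have hψ2 : ∀ z ∈ U, ContinuousAt (dd e (dd e ψ)) z := fun z hz => (contDiffAt_dd (n := 1) (m := 0) (hψ1 z hz) (by norm_num) e).continuousAt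
  filter_upwards [small_line hK hU hKU e (fun z hz => hψ2 z (hKU hz)) (half_pos hε), self_mem_nhdsWithin] with h hh hpos z hz
  have := diff_est (g := fun s : ℝ => ψ (z + s • e)) (g' := fun s => dd e ψ (z + s • e)) (g'' := fun s => dd e (dd e ψ) (z + s • e)) (h := h) (ε := ε / 2) hpos
    (fun t ht => line_deriv ((hψ _ (hh z hz t ht).1).differentiableAt (by norm_num)))
    (fun t ht => line_deriv ((hψ1 _ (hh z hz t ht).1).differentiableAt (by norm_num)))
    (fun t ht => by simpa using (hh z hz t ht).2)
  simp only [zero_smul, add_zero, neg_smul, ← sub_eq_add_neg] at this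
  unfold df2
  linarith

lemma cons1 (hK : IsCompact K) (hU : IsOpen U) (hKU : K ⊆ U) (hψ : ∀ z ∈ U, ContDiffAt ℝ 2 ψ z) (e : ℝ × ℝ)
    {ε : ℝ} (hε : 0 < ε) : ∀ᶠ h in 𝓝[>] (0:ℝ), ∀ z ∈ K, |df1 h e ψ z - dd e ψ z| ≤ ε := by
  have hψ1 : ∀ z ∈ U, ContDiffAt ℝ 1 (dd e ψ) z := fun z hz => contDiffAt_dd (n := 2) (m := 1) (hψ z hz) (by norm_num) e
  filter_upwards [small_line hK hU hKU e (fun z hz => (hψ1 z (hKU hz)).continuousAt) hε, self_mem_nhdsWithin] with h hh hpos z hz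
  have := diff_est1 (g := fun s : ℝ => ψ (z + s • e)) (g' := fun s => dd e ψ (z + s • e)) (h := h) (ε := ε) hpos
    (fun t ht => line_deriv ((hψ _ (hh z hz t ht).1).differentiableAt (by norm_num)))
    (fun t ht => by simpa using (hh z hz t ht).2)
  simp only [zero_smul, add_zero, neg_smul, ← sub_eq_add_neg] at this
  unfold df1
  exact this

lemma bdd_on (hK : IsCompact K) {F : ℝ × ℝ → ℝ} (hF : ContinuousOn F K) : ∃ M, 0 < M ∧ ∀ z ∈ K, |F z| ≤ M := by
  obtain ⟨M, hM⟩ := hK.exists_bound_of_continuousOn hF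
  exact ⟨max M 1, by positivity, fun z hz => (hM z hz).trans (le_max_left _ _)⟩

lemma HOp.consL {P : HOp} (hP : P.Good) (hK : IsCompact K) (hU : IsOpen U) (hKU : K ⊆ U) (hψ : ∀ z ∈ U, ContDiffAt ℝ 2 ψ z)
    {ε : ℝ} (hε : 0 < ε) : ∀ᶠ h in 𝓝[>] (0:ℝ), ∀ z ∈ K, |P.Lh h ψ z - P.L ψ z| ≤ ε := by
  obtain ⟨A, hA0, hA⟩ := bdd_on hK hP.ha.continuous.continuousOn
  obtain ⟨B, hB0, hB⟩ := bdd_on hK hP.hb₁.continuous.continuousOn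
  obtain ⟨B', hB'0, hB'⟩ := bdd_on hK hP.hb₂.continuous.continuousOn
  set M := A + A + B + B' with hM
  have hM0 : 0 < M := by positivity
  have hd : 0 < ε / M := by positivity
  filter_upwards [cons2 hK hU hKU hψ P.e₁ hd, cons2 hK hU hKU hψ P.e₂ hd, cons1 hK hU hKU hψ P.e₁ hd, cons1 hK hU hKU hψ P.e₂ hd]
    with h h1 h2 h3 h4 z hz
  have e : P.Lh h ψ z - P.L ψ z = -(P.a z * (df2 h P.e₁ ψ z - dd P.e₁ (dd P.e₁ ψ) z)) - P.a z * (df2 h P.e₂ ψ z - dd P.e₂ (dd P.e₂ ψ) z)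
     - P.b₁ z * (df1 h P.e₁ ψ z - dd P.e₁ ψ z) - P.b₂ z * (df1 h P.e₂ ψ z - dd P.e₂ ψ z) := by
    simp only [HOp.Lh, HOp.L]; ring
  have k : ∀ {x y X Y : ℝ}, |x| ≤ X → |y| ≤ Y → |x * y| ≤ X * Y := by
    intro x y X Y hx hy
    rw [abs_mul]; exact mul_le_mul hx hy (abs_nonneg _) ((abs_nonneg _).trans hx)
  have k1 := abs_le.1 (k (hA z hz) (h1 z hz))
  have k2 := abs_le.1 (k (hA z hz) (h2 z hz))
  have k3 := abs_le.1 (k (hB z hz) (h3 z hz))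
  have k4 := abs_le.1 (k (hB' z hz) (h4 z hz))
  have e2 : A * (ε / M) + A * (ε / M) + B * (ε / M) + B' * (ε / M) = ε := by
    rw [← add_mul, ← add_mul, ← add_mul, ← hM]; field_simp
  rw [e, abs_le]
  constructor <;> linarith [k1.1, k1.2, k2.1, k2.2, k3.1, k3.2, k4.1, k4.2]

lemma HOp.pos_ev {P : HOp} (hP : P.Good) (hK : IsCompact K) (ha : ∀ z ∈ K, 0 < P.a z) :
    ∀ᶠ h in 𝓝[>] (0:ℝ), ∀ z ∈ K, P.pos h z := by
  rcases K.eq_empty_or_nonempty with rfl | hne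
  · simp
  obtain ⟨z₁, hz₁, hmin⟩ := hK.exists_isMinOn hne hP.ha.continuous.continuousOn
  obtain ⟨B, hB0, hB⟩ := bdd_on hK hP.hb₁.continuous.continuousOn
  obtain ⟨B', hB'0, hB'⟩ := bdd_on hK hP.hb₂.continuous.continuousOn
  have a0 := ha z₁ hz₁
  have hlt : ∀ᶠ h in 𝓝[>] (0:ℝ), h < 2 * P.a z₁ / (B + B') := 
    eventually_nhdsWithin_of_eventually_nhds (eventually_lt_nhds (by positivity))
  filter_upwards [hlt, self_mem_nhdsWithin] with h hh hpos z hz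
  have hpos : 0 < h := hpos
  have hm : P.a z₁ ≤ P.a z := hmin hz
  rw [lt_div_iff₀ (by positivity)] at hh
  have := hB z hz
  have := hB' z hz
  refine ⟨hpos, (ha z hz).le, ?_, ?_⟩ <;> nlinarith

end

end Part8

section Part9

open Real Set MeasureTheory


open Filter Topology
open scoped ContDiff

lemma HOp.Sh_meas {P : HOp} (hP : P.Good) (h : ℝ) {u : ℝ × ℝ → ℝ} (hu : Measurable u) : Measurable (P.Sh h u) := by
  have h1 := hP.ha.continuous.measurable
  have h2 := hP.hb₁.continuous.measurable
  have h3 := hP.hb₂.continuous.measurable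
  have t : ∀ e : ℝ × ℝ, Measurable (fun z => u (z + h • e)) := fun e => hu.comp (measurable_id.add_const _)
  have t' : ∀ e : ℝ × ℝ, Measurable (fun z => u (z - h • e)) := fun e => hu.comp (measurable_id.sub_const _)
  unfold HOp.Sh
  have t1 := t P.e₁
  have t2 := t P.e₂
  have t3 := t' P.e₁
  have t4 := t' P.e₂
  exact (((((h1.div_const _).add (h2.div_const _)).mul t1).add (((h1.div_const _).sub (h2.div_const _)).mul t3)).add
    (((h1.div_const _).add (h3.div_const _)).mul t2)).add (((h1.div_const _).sub (h3.div_const _)).mul t4)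

open Classical in
/-- the fixed point map -/
def HOp.T (P : HOp) (h : ℝ) (K : Set (ℝ × ℝ)) (f G u : ℝ × ℝ → ℝ) : ℝ × ℝ → ℝ :=
  K.piecewise (fun z => (P.Sh h u z + f z) / (4 * P.a z / h ^ 2 + P.r)) G

lemma HOp.exists_discrete {P : HOp} (hP : P.Good) {K : Set (ℝ × ℝ)} (hKm : MeasurableSet K) {h : ℝ}
    (hp : ∀ z ∈ K, P.pos h z) {f G V : ℝ × ℝ → ℝ} (hV : Measurable V) (hG : Measurable G)
    (hf : Measurable (K.indicator f)) (hGV : ∀ z, |G z| ≤ V z) (hfV : ∀ z ∈ K, |f z| ≤ P.Lh h V z) :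
    ∃ u : ℝ × ℝ → ℝ, Measurable u ∧ (∀ z ∈ K, P.Lh h u z = f z) ∧ (∀ z, z ∉ K → u z = G z) ∧ ∀ z, |u z| ≤ V z := by
  classical
  have hden : ∀ z ∈ K, 0 < 4 * P.a z / h ^ 2 + P.r := by
    intro z hz
    have := (hp z hz).2.1
    have := hP.hr
    positivity
  have Tin : ∀ u z, z ∈ K → P.T h K f G u z = (P.Sh h u z + f z) / (4 * P.a z / h ^ 2 + P.r) := fun u z hz => by
    simp [HOp.T, hz]
  have Tout : ∀ u z, z ∉ K → P.T h K f G u z = G z := fun u z hz => by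
    simp [HOp.T, hz]
  have Tmono : ∀ u v : ℝ × ℝ → ℝ, (∀ z, u z ≤ v z) → ∀ z, P.T h K f G u z ≤ P.T h K f G v z := by
    intro u v huv z
    by_cases hz : z ∈ K
    · rw [Tin _ _ hz, Tin _ _ hz]
      have := hden z hz
      have := HOp.Sh_mono (hp z hz) (huv (z + h • P.e₁)) (huv (z - h • P.e₁)) (huv (z + h • P.e₂)) (huv (z - h • P.e₂))
      gcongr
    · rw [Tout _ _ hz, Tout _ _ hz]
  have Tm : ∀ u, Measurable u → Measurable (P.T h K f G u) := by
    intro u hu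
    have e : P.T h K f G u = K.piecewise (fun z => (P.Sh h u z + K.indicator f z) / (4 * P.a z / h ^ 2 + P.r)) G := by
      funext z
      by_cases hz : z ∈ K <;> simp [HOp.T, hz]
    rw [e]
    refine Measurable.piecewise hKm ?_ hG
    exact ((HOp.Sh_meas hP h hu).add hf).div (((measurable_const.mul hP.ha.continuous.measurable).div_const _).add_const _)
  set U : ℕ → ℝ × ℝ → ℝ := fun k => (P.T h K f G)^[k] (fun z => -V z) with hU
  have Us : ∀ k, U (k+1) = P.T h K f G (U k) := fun k => Function.iterate_succ_apply' _ _ _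
  have ShN : ∀ z, P.Sh h (fun z => -V z) z = - P.Sh h V z := by
    intro z; simp only [HOp.Sh]; ring
  have hinc : ∀ k z, U k z ≤ U (k+1) z := by
    intro k
    induction k with
    | zero =>
      intro z
      rw [Us]
      show -V z ≤ P.T h K f G (fun z => -V z) z
      by_cases hz : z ∈ K
      · rw [Tin _ _ hz, le_div_iff₀ (hden z hz), ShN]
        have h1 := hfV z hz
        rw [HOp.Lh_eq] at h1
        linarith [(abs_le.1 h1).1]
      · rw [Tout _ _ hz]; exact (abs_le.1 (hGV z)).1
    | succ k ih => intro z; rw [Us, Us (k+1)]; exact Tmono _ _ ih z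
  have hle : ∀ k z, U k z ≤ V z := by
    intro k
    induction k with
    | zero => intro z; show -V z ≤ V z; linarith [(abs_nonneg _).trans (hGV z)]
    | succ k ih =>
      intro z
      rw [Us]
      refine (Tmono _ _ ih z).trans ?_
      by_cases hz : z ∈ K
      · rw [Tin _ _ hz, div_le_iff₀ (hden z hz)]
        have h1 := hfV z hz
        rw [HOp.Lh_eq] at h1
        linarith [(abs_le.1 h1).2]
      · rw [Tout _ _ hz]; exact (abs_le.1 (hGV z)).2
  have hm : ∀ k, Measurable (U k) := by
    intro k
    induction k with
    | zero => exact hV.neg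
    | succ k ih => rw [Us]; exact Tm _ ih
  have hmon : ∀ z, Monotone fun k => U k z := fun z => monotone_nat_of_le_succ fun k => hinc k z
  have hlim : ∀ z, Tendsto (fun k => U k z) atTop (𝓝 (⨆ k, U k z)) := fun z =>
    tendsto_atTop_ciSup (hmon z) ⟨V z, by rintro _ ⟨k, rfl⟩; exact hle k z⟩
  set u : ℝ × ℝ → ℝ := fun z => ⨆ k, U k z with hu
  refine ⟨u, measurable_of_tendsto_metrizable hm (tendsto_pi_nhds.2 hlim), ?_, ?_, ?_⟩
  · intro z hz
    have l1 : Tendsto (fun k => P.T h K f G (U k) z) atTop (𝓝 ((P.Sh h u z + f z) / (4 * P.a z / h ^ 2 + P.r))) := by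
      simp only [Tin _ _ hz]
      refine Tendsto.div_const (Tendsto.add_const _ ?_) _
      unfold HOp.Sh
      exact (((hlim _).const_mul _).add ((hlim _).const_mul _)).add ((hlim _).const_mul _) |>.add ((hlim _).const_mul _)
    have l2 : Tendsto (fun k => P.T h K f G (U k) z) atTop (𝓝 (u z)) := by
      simp only [← Us]
      exact (tendsto_add_atTop_iff_nat 1).2 (hlim z)
    have := tendsto_nhds_unique l2 l1
    rw [eq_div_iff (hden z hz).ne'] at this
    rw [HOp.Lh_eq]
    linarith
  · intro z hz
    refine tendsto_nhds_unique ((tendsto_add_atTop_iff_nat 1).2 (hlim z)) ?_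
    simp only [Us, Tout _ _ hz]
    exact tendsto_const_nhds
  · intro z
    rw [abs_le]
    exact ⟨ge_of_tendsto (hlim z) (Eventually.of_forall fun k => hmon z (Nat.zero_le k)), le_of_tendsto' (hlim z) fun k => hle k z⟩

/-- weak compactness -/
lemma weak_limit {ι : Type} {l : Filter ι} [l.NeBot] {v : ι → ℝ × ℝ → ℝ} {H : ℝ × ℝ → ℝ} (hH : Continuous H) (hH0 : ∀ z, 0 < H z)
    (hv : ∀ i, Measurable (v i)) (hvH : ∀ i z, |v i z| ≤ H z) :
    ∃ l' : Filter ι, l'.NeBot ∧ l' ≤ l ∧ ∃ w : ℝ × ℝ → ℝ, Measurable w ∧ (∀ z, |w z| ≤ H z) ∧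
      ∀ φ : ℝ × ℝ → ℝ, Continuous φ → HasCompactSupport φ → Tendsto (fun i => ∫ z, v i z * φ z) l' (𝓝 (∫ z, w z * φ z)) := by
  classical
  set k : ℝ × ℝ → ℝ := fun z => (1 + ‖z‖) ^ (-4 : ℝ) with hk
  have hk0 : ∀ z, 0 < k z := fun z => by simp only [hk]; positivity
  have hkc : Continuous k := by
    refine Continuous.rpow_const (by fun_prop) fun z => Or.inl ?_
    positivity
  have hk2 : MemLp k 2 (volume : Measure (ℝ × ℝ)) := by
    rw [memLp_two_iff_integrable_sq hkc.aestronglyMeasurable]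
    have := integrable_one_add_norm (μ := (volume : Measure (ℝ × ℝ))) (r := 8) (by
      simp only [Module.finrank_prod, Module.finrank_self]; norm_num)
    refine this.congr (Eventually.of_forall fun z => ?_)
    simp only [hk]
    rw [← Real.rpow_natCast, ← Real.rpow_mul (by positivity)]
    norm_num
  set x : ι → ℝ × ℝ → ℝ := fun i z => v i z / H z * k z with hx
  have hxk : ∀ i z, |x i z| ≤ k z := by
    intro i z
    simp only [hx, abs_mul, abs_div, abs_of_pos (hH0 z), abs_of_pos (hk0 z)]
    have : |v i z| / H z ≤ 1 := by rw [div_le_one (hH0 z)]; exact hvH i z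
    nlinarith [hk0 z]
  have hxm : ∀ i, Measurable (x i) := fun i => ((hv i).div hH.measurable).mul hkc.measurable
  have hx2 : ∀ i, MemLp (x i) 2 (volume : Measure (ℝ × ℝ)) := fun i =>
    hk2.mono (hxm i).aestronglyMeasurable (Eventually.of_forall fun z => by
      simp only [Real.norm_eq_abs, abs_of_pos (hk0 z)]; exact hxk i z)
  let E := Lp ℝ 2 (volume : Measure (ℝ × ℝ))
  let X : ι → E := fun i => (hx2 i).toLp
  let κ : E := hk2.toLp
  have hXn : ∀ i, ‖X i‖ ≤ ‖κ‖ := by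
    intro i
    refine Lp.norm_le_norm_of_ae_le ?_
    filter_upwards [(hx2 i).coeFn_toLp, hk2.coeFn_toLp] with z h1 h2
    rw [h1, h2, Real.norm_eq_abs, Real.norm_eq_abs, abs_of_pos (hk0 z)]
    exact hxk i z
  let Φ : ι → WeakDual ℝ E := fun i => StrongDual.toWeakDual (InnerProductSpace.toDual ℝ E (X i))
  have hcpt := WeakDual.isCompact_closedBall (𝕜 := ℝ) (E := E) 0 ‖κ‖
  have hmem : ∀ i, Φ i ∈ WeakDual.toStrongDual ⁻¹' Metric.closedBall (0 : StrongDual ℝ E) ‖κ‖ := by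
    intro i
    simp only [mem_preimage, Metric.mem_closedBall, dist_zero_right]
    show ‖InnerProductSpace.toDual ℝ E (X i)‖ ≤ _
    rw [LinearIsometryEquiv.norm_map]; exact hXn i
  obtain ⟨U, hU⟩ := Ultrafilter.exists_le l
  obtain ⟨y, hy, hUy⟩ := isCompact_iff_ultrafilter_le_nhds.1 hcpt (U.map Φ) (by
    simp only [le_principal_iff, Ultrafilter.mem_coe, Ultrafilter.mem_map]
    exact Filter.univ_mem' hmem)
  let Yw : E := (InnerProductSpace.toDual ℝ E).symm (WeakDual.toStrongDual y)
  have conv : ∀ g : E, Tendsto (fun i => inner ℝ (X i) g) U (𝓝 (inner ℝ Yw g)) := by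
    intro g
    have h1 : Tendsto Φ U (𝓝 y) := hUy
    have h2 := ((WeakDual.eval_continuous g).tendsto y).comp h1
    have e : inner ℝ Yw g = y g := by
      rw [← InnerProductSpace.toDual_apply_apply]
      simp only [Yw, LinearIsometryEquiv.apply_symm_apply]; rfl
    rw [e]
    refine h2.congr fun i => ?_
    show InnerProductSpace.toDual ℝ E (X i) g = _
    rw [InnerProductSpace.toDual_apply_apply]
  have conv2 : ∀ g : ℝ × ℝ → ℝ, MemLp g 2 (volume : Measure (ℝ × ℝ)) → Tendsto (fun i => ∫ z, x i z * g z) U (𝓝 (∫ z, Yw z * g z)) := by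
    intro g hg
    have e1 : ∀ Z : E, inner ℝ Z hg.toLp = ∫ z, Z z * g z := by
      intro Z
      rw [MeasureTheory.L2.inner_def]
      refine integral_congr_ae ?_
      filter_upwards [hg.coeFn_toLp] with z hz
      simp only [hz, RCLike.inner_apply, conj_trivial]; ring
    have := conv hg.toLp
    rw [e1] at this
    refine this.congr fun i => ?_
    rw [e1]
    refine integral_congr_ae ?_
    filter_upwards [(hx2 i).coeFn_toLp] with z hz
    simp only [X, hz]
  -- bound
  have hYk : ∀ᵐ z, |Yw z| ≤ k z := by
    have hY2 : MemLp (fun z => Yw z) 2 (volume : Measure (ℝ × ℝ)) := Lp.memLp Yw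
    have gen : ∀ s : ℝ, |s| = 1 → ∀ᵐ z, 0 ≤ k z - s * Yw z := by
      intro s hs
      have hk' : MemLp (fun z => k z - s * Yw z) 2 (volume : Measure (ℝ × ℝ)) := hk2.sub (hY2.const_mul s)
      refine ae_nonneg_of_forall_setIntegral_nonneg_of_sigmaFinite (fun S hS hSf => ?_) (fun S hS hSf => ?_)
      · have : IsFiniteMeasure (volume.restrict S) := ⟨by simpa using hSf⟩
        exact (hk'.restrict S).integrable (by norm_num)
      · have : IsFiniteMeasure (volume.restrict S) := ⟨by simpa using hSf⟩
        have i1 : Integrable k (volume.restrict S) := (hk2.restrict S).integrable (by norm_num)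
        have i2 : Integrable (fun z => Yw z) (volume.restrict S) := (hY2.restrict S).integrable (by norm_num)
        rw [integral_sub i1 (i2.const_mul s), integral_const_mul]
        have hind : MemLp (S.indicator fun _ => (1:ℝ)) 2 (volume : Measure (ℝ × ℝ)) := memLp_indicator_const 2 hS 1 (Or.inr hSf.ne)
        have c := (conv2 _ hind).const_mul s
        have e : ∀ F : ℝ × ℝ → ℝ, ∫ z, F z * S.indicator (fun _ => (1:ℝ)) z = ∫ z in S, F z := by
          intro F
          rw [← integral_indicator hS]
          congr 1; funext z
          by_cases hz : z ∈ S <;> simp [hz]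
        simp only [e] at c
        refine sub_nonneg.2 (le_of_tendsto' c fun i => ?_)
        rw [← integral_const_mul]
        refine integral_mono (((hx2 i).restrict S).integrable (by norm_num) |>.const_mul s) i1 fun z => ?_
        have := hxk i z
        calc s * x i z ≤ |s * x i z| := le_abs_self _
          _ = |x i z| := by rw [abs_mul, hs, one_mul]
          _ ≤ _ := this
    filter_upwards [gen 1 (by simp), gen (-1) (by simp)] with z h1 h2
    rw [abs_le]; constructor <;> linarith
  have hYm : AEStronglyMeasurable (fun z => Yw z) (volume : Measure (ℝ × ℝ)) := Lp.aestronglyMeasurable Yw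
  set w0 : ℝ × ℝ → ℝ := fun z => hYm.mk _ z * H z / k z with hw0
  have hw0m : Measurable w0 := ((hYm.stronglyMeasurable_mk.measurable).mul hH.measurable).div hkc.measurable
  refine ⟨U, inferInstance, hU, fun z => max (-H z) (min (w0 z) (H z)), ?_, ?_, ?_⟩
  · exact hH.measurable.neg.max (hw0m.min hH.measurable)
  · intro z
    have := hH0 z
    rw [abs_le]
    exact ⟨le_max_left _ _, max_le (by linarith) (min_le_right _ _)⟩
  · intro φ hφ hφc
    have hg : MemLp (fun z => φ z * (H z / k z)) 2 (volume : Measure (ℝ × ℝ)) :=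
      (hφ.mul (hH.div hkc fun z => (hk0 z).ne')).memLp_of_hasCompactSupport hφc.mul_right
    have c := conv2 _ hg
    have e1 : ∀ i, ∫ z, x i z * (φ z * (H z / k z)) = ∫ z, v i z * φ z := by
      intro i; congr 1; funext z
      have := (hH0 z).ne'
      have := (hk0 z).ne'
      simp only [hx]; field_simp
    simp only [e1] at c
    have e2 : ∫ z, Yw z * (φ z * (H z / k z)) = ∫ z, max (-H z) (min (w0 z) (H z)) * φ z := by
      refine integral_congr_ae ?_
      filter_upwards [hYk, hYm.ae_eq_mk] with z h1 h2
      have k0 := hk0 z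
      have h3 : |w0 z| ≤ H z := by
        simp only [hw0]
        rw [← h2, abs_div, abs_mul, abs_of_pos (hH0 z), abs_of_pos k0, div_le_iff₀ k0]
        nlinarith [hH0 z]
      rw [abs_le] at h3
      rw [min_eq_left h3.2, max_eq_right h3.1]
      simp only [hw0]
      rw [← h2]; field_simp
    rwa [e2] at c

end Part9

section Part10

open Real Set MeasureTheory


open Filter Topology
open scoped ContDiff

lemma two_le_infty : (2 : WithTop ℕ∞) ≤ ∞ := WithTop.coe_le_coe.2 (le_top : (2 : ℕ∞) ≤ ⊤)

lemma exhaustion {O : Set (ℝ × ℝ)} (hO : IsOpen O) : ∃ K : ℕ → Set (ℝ × ℝ), (∀ n, IsCompact (K n)) ∧ (∀ n, K n ⊆ O) ∧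
    ∀ C : Set (ℝ × ℝ), IsCompact C → C ⊆ O → ∀ᶠ n in atTop, C ⊆ K n := by
  have : LocallyCompactSpace O := hO.locallyCompactSpace
  let E := CompactExhaustion.choice O
  refine ⟨fun n => Subtype.val '' (E n), fun n => (E.isCompact n).image continuous_subtype_val, fun n => ?_, fun C hC hCO => ?_⟩
  · rintro _ ⟨x, _, rfl⟩; exact x.2
  · have hC' : IsCompact (Subtype.val ⁻¹' C : Set O) := by
      rw [Subtype.isCompact_iff, Subtype.image_preimage_coe, inter_eq_right.2 hCO]; exact hC
    obtain ⟨n, hn⟩ := E.exists_superset_of_isCompact hC'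
    filter_upwards [eventually_ge_atTop n] with m hm z hz
    exact ⟨⟨z, hCO hz⟩, E.subset hm (hn hz), rfl⟩

section
variable {u H ψ : ℝ × ℝ → ℝ}

lemma int_u (hu : Measurable u) (hH : Continuous H) (huH : ∀ z, |u z| ≤ H z) (hψ : Continuous ψ) (hc : HasCompactSupport ψ) :
    Integrable (fun z => u z * ψ z) := by
  have h1 : Integrable (fun z => H z * ψ z) := (hH.mul hψ).integrable_of_hasCompactSupport hc.mul_left
  refine h1.mono (hu.aestronglyMeasurable.mul hψ.aestronglyMeasurable) (Eventually.of_forall fun z => ?_)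
  rw [norm_mul, norm_mul, Real.norm_eq_abs, Real.norm_eq_abs]
  exact mul_le_mul_of_nonneg_right ((huH z).trans (le_abs_self _)) (abs_nonneg _)

lemma shift_u (t : ℝ × ℝ) : ∫ z, u (z + t) * ψ z = ∫ z, u z * ψ (z - t) := by
  rw [← integral_add_right_eq_self (fun z => u z * ψ (z - t)) t]
  simp

lemma cs_shift (hc : HasCompactSupport ψ) (t : ℝ × ℝ) : HasCompactSupport (fun z => ψ (z + t)) :=
  hc.comp_homeomorph (Homeomorph.addRight t)

lemma adj_aux (hu : Measurable u) (hH : Continuous H) (huH : ∀ z, |u z| ≤ H z) (hψ : Continuous ψ) (hc : HasCompactSupport ψ) (h : ℝ) (e : ℝ × ℝ) :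
    Integrable (fun z => df2 h e u z * ψ z) ∧ Integrable (fun z => df1 h e u z * ψ z) ∧
    Integrable (fun z => u z * df2 h e ψ z) ∧ Integrable (fun z => u z * df1 h e ψ z) ∧
    (∫ z, df2 h e u z * ψ z = ∫ z, u z * df2 h e ψ z) ∧ (∫ z, df1 h e u z * ψ z = - ∫ z, u z * df1 h e ψ z) := by
  have i0 := int_u hu hH huH hψ hc
  have sh : ∀ t : ℝ × ℝ, Integrable (fun z => u (z + t) * ψ z) := fun t => 
    int_u (u := fun z => u (z + t)) (H := fun z => H (z + t)) (hu.comp (measurable_id.add_const _)) (hH.comp (continuous_id.add continuous_const)) (fun z => huH _) hψ hc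
  have sh' : ∀ t : ℝ × ℝ, Integrable (fun z => u z * ψ (z + t)) := fun t => 
    int_u hu hH huH (hψ.comp (continuous_id.add continuous_const)) (cs_shift hc t)
  have p1 := sh (h • e)
  have p2 := sh (-(h • e))
  have p3 := sh' (h • e)
  have p4 := sh' (-(h • e))
  have s1 := shift_u (u := u) (ψ := ψ) (h • e)
  have s2 := shift_u (u := u) (ψ := ψ) (-(h • e))
  simp only [← sub_eq_add_neg, sub_neg_eq_add] at p2 p4 s2
  have e1 : (fun z => df2 h e u z * ψ z) = fun z => (u (z + h • e) * ψ z + u (z - h • e) * ψ z - 2 * (u z * ψ z)) / h ^ 2 := by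
    funext z; simp only [df2]; ring
  have e2 : (fun z => df1 h e u z * ψ z) = fun z => (u (z + h • e) * ψ z - u (z - h • e) * ψ z) / (2 * h) := by
    funext z; simp only [df1]; ring
  have e3 : (fun z => u z * df2 h e ψ z) = fun z => (u z * ψ (z + h • e) + u z * ψ (z - h • e) - 2 * (u z * ψ z)) / h ^ 2 := by
    funext z; simp only [df2]; ring
  have e4 : (fun z => u z * df1 h e ψ z) = fun z => (u z * ψ (z + h • e) - u z * ψ (z - h • e)) / (2 * h) := by
    funext z; simp only [df1]; ring
  have q1 : Integrable (fun z => u (z + h • e) * ψ z + u (z - h • e) * ψ z) := p1.add p2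
  have q3 : Integrable (fun z => u z * ψ (z + h • e) + u z * ψ (z - h • e)) := p3.add p4
  rw [e1, e2, e3, e4]
  refine ⟨(q1.sub (i0.const_mul 2)).div_const _, (p1.sub p2).div_const _, (q3.sub (i0.const_mul 2)).div_const _, (p3.sub p4).div_const _, ?_, ?_⟩
  · rw [integral_div, integral_div, integral_sub q1 (i0.const_mul 2), integral_sub q3 (i0.const_mul 2), integral_add p1 p2, integral_add p3 p4, s1, s2]
    ring
  · rw [integral_div, integral_div, integral_sub p1 p2, integral_sub p3 p4, s1, s2]
    ring

/-- discrete adjoint -/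
def HOp.Ls (P : HOp) (h : ℝ) (φ : ℝ × ℝ → ℝ) (z : ℝ × ℝ) : ℝ :=
  -(df2 h P.e₁ (fun w => P.a w * φ w) z + df2 h P.e₂ (fun w => P.a w * φ w) z) + df1 h P.e₁ (fun w => P.b₁ w * φ w) z
    + df1 h P.e₂ (fun w => P.b₂ w * φ w) z + P.r * φ z

/-- adjoint -/
def HOp.Lst (P : HOp) (φ : ℝ × ℝ → ℝ) (z : ℝ × ℝ) : ℝ :=
  -(dd P.e₁ (dd P.e₁ (fun w => P.a w * φ w)) z + dd P.e₂ (dd P.e₂ (fun w => P.a w * φ w)) z) + dd P.e₁ (fun w => P.b₁ w * φ w) z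
    + dd P.e₂ (fun w => P.b₂ w * φ w) z + P.r * φ z

lemma HOp.adj {P : HOp} (hP : P.Good) (hu : Measurable u) (hH : Continuous H) (huH : ∀ z, |u z| ≤ H z) {φ : ℝ × ℝ → ℝ} (hφ : Continuous φ)
    (hc : HasCompactSupport φ) (h : ℝ) : ∫ z, P.Lh h u z * φ z = ∫ z, u z * P.Ls h φ z := by
  have ca : Continuous (fun w => P.a w * φ w) := hP.ha.continuous.mul hφ
  have cb : Continuous (fun w => P.b₁ w * φ w) := hP.hb₁.continuous.mul hφ
  have cb' : Continuous (fun w => P.b₂ w * φ w) := hP.hb₂.continuous.mul hφ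
  obtain ⟨a1, -, a3, -, a5, -⟩ := adj_aux hu hH huH ca hc.mul_left h P.e₁
  obtain ⟨b1, -, b3, -, b5, -⟩ := adj_aux hu hH huH ca hc.mul_left h P.e₂
  obtain ⟨-, c2, -, c4, -, c6⟩ := adj_aux hu hH huH cb hc.mul_left h P.e₁
  obtain ⟨-, d2, -, d4, -, d6⟩ := adj_aux hu hH huH cb' hc.mul_left h P.e₂
  have i0 := int_u hu hH huH hφ hc
  have e1 : (fun z => P.Lh h u z * φ z) = fun z => P.r * (u z * φ z) - df2 h P.e₁ u z * (P.a z * φ z) - df2 h P.e₂ u z * (P.a z * φ z)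
     - df1 h P.e₁ u z * (P.b₁ z * φ z) - df1 h P.e₂ u z * (P.b₂ z * φ z) := by
    funext z; simp only [HOp.Lh]; ring
  have e2 : (fun z => u z * P.Ls h φ z) = fun z => P.r * (u z * φ z) - u z * df2 h P.e₁ (fun w => P.a w * φ w) z - u z * df2 h P.e₂ (fun w => P.a w * φ w) z
     + u z * df1 h P.e₁ (fun w => P.b₁ w * φ w) z + u z * df1 h P.e₂ (fun w => P.b₂ w * φ w) z := by
    funext z; simp only [HOp.Ls]; ring
  rw [e1, e2]
  have k1 := (i0.const_mul P.r).sub a1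
  have k2 := k1.sub b1
  have k3 := k2.sub c2
  have l1 := (i0.const_mul P.r).sub a3
  have l2 := l1.sub b3
  have l3 := l2.add c4
  rw [integral_sub (by exact k3) (by exact d2), integral_sub (by exact k2) (by exact c2), integral_sub (by exact k1) (by exact b1), integral_sub (by exact i0.const_mul _) (by exact a1),
    integral_add (by exact l3) (by exact d4), integral_add (by exact l2) (by exact c4), integral_sub (by exact l1) (by exact b3), integral_sub (by exact i0.const_mul _) (by exact a3),
    a5, b5, c6, d6]
  ring

lemma HOp.Ls_zero {P : HOp} {φ : ℝ × ℝ → ℝ} {h : ℝ} {z : ℝ × ℝ} 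
    (hz : ∀ t : ℝ × ℝ, ‖t‖ ≤ |h| * (‖P.e₁‖ + ‖P.e₂‖) → φ (z + t) = 0) : P.Ls h φ z = 0 := by
  have n1 : ‖h • P.e₁‖ ≤ |h| * (‖P.e₁‖ + ‖P.e₂‖) := by
    rw [norm_smul, Real.norm_eq_abs]; gcongr; linarith [norm_nonneg P.e₂]
  have n2 : ‖h • P.e₂‖ ≤ |h| * (‖P.e₁‖ + ‖P.e₂‖) := by
    rw [norm_smul, Real.norm_eq_abs]; gcongr; linarith [norm_nonneg P.e₁]
  have z0 : φ z = 0 := by simpa using hz 0 (by simp; positivity)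
  have z1 := hz _ n1
  have z2 := hz _ n2
  have z3 := hz (-(h • P.e₁)) (by rwa [norm_neg])
  have z4 := hz (-(h • P.e₂)) (by rwa [norm_neg])
  rw [← sub_eq_add_neg] at z3 z4
  simp only [HOp.Ls, df1, df2, z0, z1, z2, z3, z4]; simp

lemma HOp.Lst_zero {P : HOp} {φ : ℝ × ℝ → ℝ} {z : ℝ × ℝ} (hz : z ∉ tsupport φ) : P.Lst φ z = 0 := by
  have t : ∀ a : ℝ × ℝ → ℝ, z ∉ tsupport (fun w => a w * φ w) := fun a h => hz (tsupport_mul_le_right h)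
  unfold HOp.Lst
  rw [image_eq_zero_of_notMem_tsupport (fun h => t P.a (tsupport_dd_le (tsupport_dd_le h))),
    image_eq_zero_of_notMem_tsupport (fun h => t P.a (tsupport_dd_le (tsupport_dd_le h))),
    image_eq_zero_of_notMem_tsupport (fun h => t P.b₁ (tsupport_dd_le h)),
    image_eq_zero_of_notMem_tsupport (fun h => t P.b₂ (tsupport_dd_le h)), image_eq_zero_of_notMem_tsupport hz]
  simp

lemma HOp.Lst_cont {P : HOp} (hP : P.Good) {φ : ℝ × ℝ → ℝ} (hφ : ContDiff ℝ ∞ φ) : Continuous (P.Lst φ) := by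
  have a0 := hP.ha.mul hφ
  have b0 := hP.hb₁.mul hφ
  have c0 := hP.hb₂.mul hφ
  have s1 := (dd_smooth (v := P.e₁) (dd_smooth (v := P.e₁) a0)).continuous
  have s2 := (dd_smooth (v := P.e₂) (dd_smooth (v := P.e₂) a0)).continuous
  have s3 := (dd_smooth (v := P.e₁) b0).continuous
  have s4 := (dd_smooth (v := P.e₂) c0).continuous
  exact (((s1.add s2).neg.add s3).add s4).add (continuous_const.mul hφ.continuous)

lemma HOp.Ls_conv {P : HOp} (hP : P.Good) {φ : ℝ × ℝ → ℝ} (hφ : ContDiff ℝ ∞ φ) {K : Set (ℝ × ℝ)} (hK : IsCompact K) {ε : ℝ} (hε : 0 < ε) :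
    ∀ᶠ h in 𝓝[>] (0:ℝ), ∀ z ∈ K, |P.Ls h φ z - P.Lst φ z| ≤ ε := by
  have a0 : ∀ z ∈ univ, ContDiffAt ℝ 2 (fun w => P.a w * φ w) z := fun z _ => ((hP.ha.mul hφ).contDiffAt (x := z)).of_le two_le_infty
  have b0 : ∀ z ∈ univ, ContDiffAt ℝ 2 (fun w => P.b₁ w * φ w) z := fun z _ => ((hP.hb₁.mul hφ).contDiffAt (x := z)).of_le two_le_infty
  have c0 : ∀ z ∈ univ, ContDiffAt ℝ 2 (fun w => P.b₂ w * φ w) z := fun z _ => ((hP.hb₂.mul hφ).contDiffAt (x := z)).of_le two_le_infty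
  have hd : 0 < ε / 4 := by positivity
  filter_upwards [cons2 hK isOpen_univ (subset_univ _) a0 P.e₁ hd, cons2 hK isOpen_univ (subset_univ _) a0 P.e₂ hd,
    cons1 hK isOpen_univ (subset_univ _) b0 P.e₁ hd, cons1 hK isOpen_univ (subset_univ _) c0 P.e₂ hd] with h h1 h2 h3 h4 z hz
  have k1 := abs_le.1 (h1 z hz)
  have k2 := abs_le.1 (h2 z hz)
  have k3 := abs_le.1 (h3 z hz)
  have k4 := abs_le.1 (h4 z hz)
  unfold HOp.Ls HOp.Lst
  rw [abs_le]
  constructor <;> linarith [k1.1, k1.2, k2.1, k2.2, k3.1, k3.2, k4.1, k4.2]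

/-- uniform smallness of the adjoint error -/
lemma HOp.adj_err {P : HOp} (hP : P.Good) (hH : Continuous H) {φ : ℝ × ℝ → ℝ} (hφ : ContDiff ℝ ∞ φ) (hc : HasCompactSupport φ)
    {ε : ℝ} (hε : 0 < ε) : ∀ᶠ h in 𝓝[>] (0:ℝ), ∀ u : ℝ × ℝ → ℝ, Measurable u → (∀ z, |u z| ≤ H z) →
      |(∫ z, P.Lh h u z * φ z) - ∫ z, u z * P.Lst φ z| ≤ ε := by
  set N := ‖P.e₁‖ + ‖P.e₂‖ with hN
  set K := Metric.cthickening N (tsupport φ) with hK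
  have hKc : IsCompact K := IsCompact.cthickening hc
  have hHi : IntegrableOn H K := hH.continuousOn.integrableOn_compact hKc
  set J := ∫ z, K.indicator (fun z => |H z|) z with hJ
  have hHi' : Integrable (K.indicator (fun z => |H z|)) := (integrable_indicator_iff hKc.measurableSet).2 hHi.abs
  have hJ0 : 0 ≤ J := integral_nonneg fun z => indicator_nonneg (fun _ _ => abs_nonneg _) z
  have hlt : ∀ᶠ h in 𝓝[>] (0:ℝ), h < 1 := eventually_nhdsWithin_of_eventually_nhds (eventually_lt_nhds one_pos)
  filter_upwards [HOp.Ls_conv hP hφ hKc (show 0 < ε / (J + 1) by positivity), hlt, self_mem_nhdsWithin] with h h1 h2 h3 u hu huH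
  have h3 : 0 < h := h3
  have hLs : Continuous (P.Ls h φ) := by
    have c1 := hφ.continuous
    have c2 := hP.ha.continuous
    have c3 := hP.hb₁.continuous
    have c4 := hP.hb₂.continuous
    unfold HOp.Ls df1 df2
    fun_prop
  have hout : ∀ z, z ∉ K → P.Ls h φ z = 0 ∧ P.Lst φ z = 0 := by
    intro z hz
    constructor
    · refine HOp.Ls_zero fun t ht => image_eq_zero_of_notMem_tsupport fun hzt => hz ?_
      refine Metric.mem_cthickening_of_dist_le z _ _ _ hzt ?_
      rw [dist_self_add_right]
      refine ht.trans ?_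
      rw [abs_of_pos h3, ← hN]
      have : 0 ≤ N := by positivity
      nlinarith
    · exact HOp.Lst_zero fun h => hz (Metric.self_subset_cthickening _ h)
  have hcs : ∀ F : ℝ × ℝ → ℝ, (∀ z, z ∉ K → F z = 0) → HasCompactSupport F := fun F hF => HasCompactSupport.intro hKc hF
  rw [HOp.adj hP hu hH huH hφ.continuous hc]
  have i1 := int_u hu hH huH hLs (hcs _ fun z hz => (hout z hz).1)
  have i2 := int_u hu hH huH (HOp.Lst_cont hP hφ) (hcs _ fun z hz => (hout z hz).2)
  rw [← integral_sub i1 i2]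
  have := norm_integral_le_of_norm_le (f := fun z => u z * P.Ls h φ z - u z * P.Lst φ z) (hHi'.mul_const (ε / (J + 1))) (Eventually.of_forall fun z => by
    by_cases hz : z ∈ K
    · rw [indicator_of_mem hz, ← mul_sub, norm_mul]
      exact mul_le_mul ((huH z).trans (le_abs_self _)) (h1 z hz) (norm_nonneg _) (abs_nonneg _)
    · rw [indicator_of_notMem hz, (hout z hz).1, (hout z hz).2]; simp)
  rw [integral_mul_const, Real.norm_eq_abs] at this
  refine this.trans ?_
  rw [← hJ, mul_div_assoc', div_le_iff₀ (by positivity)]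
  nlinarith
end

end Part10

section Part11

open Real Set MeasureTheory


open Filter Topology
open scoped ContDiff

section
variable {P : HOp} {O : Set (ℝ × ℝ)} {f G W : ℝ × ℝ → ℝ}

lemma HOp.weakSol (hP : P.Good) (ha : ∀ z ∈ O, 0 < P.a z) {w : ℝ × ℝ → ℝ} (hW : Continuous W)
    (hm : Measurable w) (hb : ∀ z, |w z| ≤ W z)
    (hwk : ∀ φ : ℝ × ℝ → ℝ, ContDiff ℝ ∞ φ → HasCompactSupport φ → tsupport φ ⊆ O → ∫ z, w z * P.Lst φ z = ∫ z, f z * φ z) :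
    WeakSol P.e₁ P.e₂ O (fun z => P.b₁ z / P.a z) (fun z => P.b₂ z / P.a z) (fun z => P.r / P.a z) (fun z => f z / P.a z) w := by
  constructor
  · intro φ hφ hc hO
    constructor
    · obtain ⟨M, hM⟩ := (hW.mul hφ.continuous).bounded_above_of_compact_support (hc.mul_left)
      refine ⟨M, fun z => le_trans ?_ (hM z)⟩
      rw [mul_comm, abs_mul, Pi.mul_apply, norm_mul]
      exact mul_le_mul_of_nonneg_right ((hb z).trans (le_abs_self _)) (abs_nonneg _)
    · have := (int_u hm hW hb hφ.continuous hc).locallyIntegrable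
      simpa only [mul_comm] using this
  · intro Φ hΦ hc hO
    set φ : ℝ × ℝ → ℝ := fun z => (P.a z)⁻¹ * Φ z with hφ
    have hφs : ContDiff ℝ ∞ φ := smooth_mul hΦ fun z hz => (hP.ha.contDiffAt).inv (ha z (hO hz)).ne'
    have hsup : tsupport φ ⊆ tsupport Φ := tsupport_mul_le_right
    have := hwk φ hφs (cs_of_le hc hsup) (hsup.trans hO)
    have e1 : (fun w => P.a w * φ w) = Φ := by
      funext z
      by_cases hz : z ∈ O
      · simp only [hφ]; rw [← mul_assoc, mul_inv_cancel₀ (ha z hz).ne', one_mul]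
      · have : Φ z = 0 := image_eq_zero_of_notMem_tsupport fun h => hz (hO h)
        simp only [hφ, this, mul_zero]
    have e2 : (fun w => P.b₁ w * φ w) = fun w => P.b₁ w / P.a w * Φ w := by
      funext z; simp only [hφ]; ring
    have e3 : (fun w => P.b₂ w * φ w) = fun w => P.b₂ w / P.a w * Φ w := by
      funext z; simp only [hφ]; ring
    unfold HOp.Lst at this
    rw [e1, e2, e3] at this
    have e4 : ∀ z, P.r * φ z = P.r / P.a z * Φ z := fun z => by simp only [hφ]; ring
    have e5 : ∀ z, f z * φ z = f z / P.a z * Φ z := fun z => by simp only [hφ]; ring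
    simp only [e4, e5] at this
    exact this

/-- family of discrete solutions -/
lemma HOp.family (hP : P.Good) (ha : ∀ z ∈ O, 0 < P.a z) (hO : IsOpen O) {K : ℕ → Set (ℝ × ℝ)} (hK : ∀ n, IsCompact (K n)) (hKO : ∀ n, K n ⊆ O)
    (hf : ∀ z ∈ O, ContinuousAt f z) (hG : Continuous G) (hW : Continuous W) (hW2 : ∀ z ∈ O, ContDiffAt ℝ 2 W z)
    (hGW : ∀ z, |G z| ≤ W z) (hfW : ∀ z ∈ O, |f z| + 1 ≤ P.L W z) :
    ∃ u : ℕ × ℝ → ℝ × ℝ → ℝ, (∀ i, Measurable (u i)) ∧ (∀ i z, |u i z| ≤ W z) ∧ 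
      ∀ n, ∀ᶠ h in 𝓝[>] (0:ℝ), (∀ z ∈ K n, P.Lh h (u (n, h)) z = f z) ∧ ∀ z, z ∉ K n → u (n, h) z = G z := by
  classical
  have hW0 : ∀ z, 0 ≤ W z := fun z => (abs_nonneg _).trans (hGW z)
  have hex : ∀ n, ∀ᶠ h in 𝓝[>] (0:ℝ), ∃ u : ℝ × ℝ → ℝ, Measurable u ∧ (∀ z ∈ K n, P.Lh h u z = f z) ∧ (∀ z, z ∉ K n → u z = G z) ∧ ∀ z, |u z| ≤ W z := by
    intro n
    filter_upwards [HOp.pos_ev hP (hK n) (fun z hz => ha z (hKO n hz)), HOp.consL hP (hK n) hO (hKO n) hW2 one_pos] with h h1 h2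
    refine HOp.exists_discrete hP (hK n).measurableSet h1 hW.measurable hG.measurable ?_ hGW ?_
    · have hc : ContinuousOn f (K n) := fun z hz => (hf z (hKO n hz)).continuousWithinAt
      have := hc.measurable_piecewise (continuousOn_const (c := (0:ℝ)) (s := (K n)ᶜ)) (hK n).measurableSet
      exact (piecewise_eq_indicator (s := K n) (f := f)) ▸ this
    · intro z hz
      have k1 := abs_le.1 (h2 z hz)
      have := hfW z (hKO n hz)
      linarith [k1.1]
  refine ⟨fun i => if H : ∃ u : ℝ × ℝ → ℝ, Measurable u ∧ (∀ z ∈ K i.1, P.Lh i.2 u z = f z) ∧ (∀ z, z ∉ K i.1 → u z = G z) ∧ ∀ z, |u z| ≤ W z then H.choose else fun _ => 0, ?_, ?_, ?_⟩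
  · intro i
    dsimp only
    split_ifs with H
    · exact H.choose_spec.1
    · exact measurable_const
  · intro i z
    dsimp only
    split_ifs with H
    · exact H.choose_spec.2.2.2 z
    · simpa using hW0 z
  · intro n
    filter_upwards [hex n] with h H
    simp only [dif_pos H]
    exact ⟨H.choose_spec.2.1, H.choose_spec.2.2.1⟩

/-- local barrier at a boundary point -/
def HOp.Barrier (P : HOp) (O : Set (ℝ × ℝ)) (z₀ : ℝ × ℝ) : Prop :=
  ∃ R > 0, ∃ w : ℝ × ℝ → ℝ, (∀ z ∈ O ∩ Metric.ball z₀ R, ContDiffAt ℝ 2 w z) ∧ Tendsto w (𝓝[O] z₀) (𝓝 0) ∧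
    (∀ z ∈ O ∩ Metric.ball z₀ R, 0 ≤ w z) ∧ (∀ z ∈ O ∩ Metric.ball z₀ R, 1 ≤ P.L w z) ∧
    ∀ δ > 0, ∃ c > 0, ∀ z ∈ O ∩ Metric.ball z₀ R, δ ≤ dist z z₀ → c ≤ w z

lemma HOp.L_affine {w : ℝ × ℝ → ℝ} {z : ℝ × ℝ} (hw : ContDiffAt ℝ 2 w z) (c k : ℝ) :
    P.L (fun z => c + k * w z) z = P.r * c + k * P.L w z := by
  have h1 : ∀ᶠ z' in 𝓝 z, DifferentiableAt ℝ w z' := by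
    filter_upwards [hw.eventually (by simp)] with z' h using h.differentiableAt (by norm_num)
  have d1 : ∀ v, dd v (fun z => c + k * w z) =ᶠ[𝓝 z] fun z => k * dd v w z := by
    intro v
    filter_upwards [h1] with z' h
    show fderiv ℝ (fun z => c + k * w z) z' v = k * fderiv ℝ w z' v
    rw [fderiv_const_add (𝕜 := ℝ), fderiv_const_mul h]; rfl
  have d2 : ∀ v, dd v (dd v (fun z => c + k * w z)) z = k * dd v (dd v w) z := by
    intro v
    have := Filter.EventuallyEq.fderiv_eq (𝕜 := ℝ) (d1 v)
    have hd : DifferentiableAt ℝ (dd v w) z := (contDiffAt_dd (n := 2) (m := 1) hw (by norm_num) v).differentiableAt (by norm_num)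
    show fderiv ℝ (dd v fun z => c + k * w z) z v = k * fderiv ℝ (dd v w) z v
    rw [this, fderiv_const_mul hd]; rfl
  unfold HOp.L
  rw [d2, d2, (d1 P.e₁).eq_of_nhds, (d1 P.e₂).eq_of_nhds]
  ring

lemma HOp.barrier_upper (hP : P.Good) (ha : ∀ z ∈ O, 0 < P.a z) (hO : IsOpen O) {K : ℕ → Set (ℝ × ℝ)} (hK : ∀ n, IsCompact (K n)) (hKO : ∀ n, K n ⊆ O)
    (hG : Continuous G) (hW : Continuous W) (hfW : ∀ z ∈ O, |f z| ≤ W z) {u : ℕ × ℝ → ℝ × ℝ → ℝ} (huW : ∀ i z, |u i z| ≤ W z)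
    (hu : ∀ n, ∀ᶠ h in 𝓝[>] (0:ℝ), (∀ z ∈ K n, P.Lh h (u (n, h)) z = f z) ∧ ∀ z, z ∉ K n → u (n, h) z = G z)
    {z₀ : ℝ × ℝ} (hbar : P.Barrier O z₀) {ε : ℝ} (hε : 0 < ε) :
    ∃ R' > 0, ∃ V : ℝ × ℝ → ℝ, (∀ z ∈ O ∩ Metric.ball z₀ R', ContinuousAt V z) ∧ (∀ᶠ z in 𝓝[O] z₀, V z < G z₀ + 2 * ε) ∧
      ∀ n, ∀ᶠ h in 𝓝[>] (0:ℝ), ∀ z ∈ K n ∩ Metric.closedBall z₀ R', u (n, h) z ≤ V z := by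
  obtain ⟨R, hR, w, hw2, hw0, hwn, hwL, hwc⟩ := hbar
  obtain ⟨δ0, hδ0, hGd⟩ := Metric.continuous_iff.1 hG z₀ ε hε
  set δ := min δ0 (R / 2) with hδ
  have hδp : 0 < δ := lt_min hδ0 (by positivity)
  obtain ⟨c, hc, hcw⟩ := hwc δ hδp
  obtain ⟨M, hM0, hM⟩ := bdd_on (isCompact_closedBall z₀ R) hW.continuousOn
  set k := (M + |G z₀|) / c + (M + P.r * (|G z₀| + ε) + 1) with hk
  have hr := hP.hr
  have k1 : 0 ≤ (M + |G z₀|) / c := by positivity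
  have k2 : 0 ≤ (M + P.r * (|G z₀| + ε) + 1) := by positivity
  have hk0 : 0 ≤ k := by positivity
  set V : ℝ × ℝ → ℝ := fun z => (G z₀ + ε) + k * w z with hV
  have hV2 : ∀ z ∈ O ∩ Metric.ball z₀ R, ContDiffAt ℝ 2 V z := fun z hz => contDiffAt_const.add (contDiffAt_const.mul (hw2 z hz))
  refine ⟨R / 2, by positivity, V, fun z hz => (hV2 z ⟨hz.1, Metric.ball_subset_ball (by linarith) hz.2⟩).continuousAt, ?_, ?_⟩
  · have : Tendsto V (𝓝[O] z₀) (𝓝 (G z₀ + ε + k * 0)) := (hw0.const_mul k).const_add _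
    refine this.eventually_lt_const (by linarith)
  · intro n
    set D := K n ∩ Metric.closedBall z₀ (R / 2) with hD
    have hDc : IsCompact D := (hK n).inter_right Metric.isClosed_closedBall
    have hDU : D ⊆ O ∩ Metric.ball z₀ R := fun z hz => ⟨hKO n hz.1, Metric.closedBall_subset_ball (by linarith) hz.2⟩
    have hUo : IsOpen (O ∩ Metric.ball z₀ R) := hO.inter Metric.isOpen_ball
    obtain ⟨A, hA0, hA⟩ := bdd_on hDc hP.ha.continuous.continuousOn
    have Vb : ∀ z ∈ O ∩ Metric.ball z₀ R, δ ≤ dist z z₀ → M ≤ V z := by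
      intro z hz hd
      have h1 := hcw z hz hd
      have h2 : (M + |G z₀|) / c * c = M + |G z₀| := by field_simp
      have h3 : M + |G z₀| ≤ k * w z := by
        rw [← h2]
        have : (M + |G z₀|) / c ≤ k := by linarith
        exact mul_le_mul this h1 hc.le hk0
      have := neg_abs_le (G z₀)
      simp only [hV]; linarith
    filter_upwards [hu n, HOp.pos_ev hP hDc (fun z hz => ha z (hDU hz).1), HOp.consL hP hDc hUo hDU hV2 one_pos,
      small_line hDc hUo hDU P.e₁ (F := fun _ => 0) (fun z _ => continuousAt_const) one_pos,
      small_line hDc hUo hDU P.e₂ (F := fun _ => 0) (fun z _ => continuousAt_const) one_pos] with h h1 h2 h3 h4 h5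
    have hall : ∀ z ∈ O ∩ Metric.ball z₀ R, z ∉ D → u (n, h) z ≤ V z := by
      intro z hz hzD
      by_cases hd : δ ≤ dist z z₀
      · have := Vb z hz hd
        have h6 := hM z (Metric.ball_subset_closedBall hz.2)
        have h7 := huW (n, h) z
        linarith [le_abs_self (u (n,h) z), le_abs_self (W z)]
      · push Not at hd
        have hzK : z ∉ K n := fun hzK => hzD ⟨hzK, by
          rw [Metric.mem_closedBall]; exact (hd.trans_le (min_le_right _ _)).le⟩
        rw [h1.2 z hzK]
        have h6 := hGd z (hd.trans_le (min_le_left _ _))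
        rw [Real.dist_eq] at h6
        have := (abs_lt.1 h6).2
        have := mul_nonneg hk0 (hwn z hz)
        simp only [hV]; linarith
    refine HOp.comparison hr h2 (fun z hz => (le_abs_self _).trans (hA z hz)) (M := M + (|G z₀|)) ?_ ?_ ?_
    · intro z hz
      have h6 := hM z (Metric.ball_subset_closedBall (hDU hz).2)
      have h7 := huW (n, h) z
      have := mul_nonneg hk0 (hwn z (hDU hz))
      have := neg_abs_le (G z₀)
      simp only [hV]
      linarith [le_abs_self (u (n,h) z), le_abs_self (W z)]
    · intro z hz
      rw [h1.1 z hz.1]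
      have h6 := abs_le.1 (h3 z hz)
      have h7 : P.L V z = P.r * (G z₀ + ε) + k * P.L w z := HOp.L_affine (hw2 z (hDU hz)) _ _
      have h8 := hwL z (hDU hz)
      have h9 : k ≤ k * P.L w z := le_mul_of_one_le_right hk0 h8
      have h10 := hfW z (hDU hz).1
      have h11 := hM z (Metric.ball_subset_closedBall (hDU hz).2)
      have h12 : P.r * (-(|G z₀| + ε)) ≤ P.r * (G z₀ + ε) := by
        apply mul_le_mul_of_nonneg_left _ hr.le
        linarith [neg_abs_le (G z₀)]
      have h13 : (M + P.r * (|G z₀| + ε) + 1) ≤ k := by linarith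
      linarith [h6.1, le_abs_self (f z), le_abs_self (W z)]
    · intro z hz t ht hzt
      refine hall _ ?_ hzt
      have hh := (h2 z hz).1
      simp only [mem_insert_iff, mem_singleton_iff] at ht
      rcases ht with rfl | rfl | rfl | rfl
      · exact (h4 z hz h ⟨by linarith, le_rfl⟩).1
      · rw [← neg_smul]; exact (h4 z hz (-h) ⟨le_rfl, by linarith⟩).1
      · exact (h5 z hz h ⟨by linarith, le_rfl⟩).1
      · rw [← neg_smul]; exact (h5 z hz (-h) ⟨le_rfl, by linarith⟩).1

/-- upper bounds pass to the weak limit -/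
lemma pass_upper {ι : Type} {l : Filter ι} [l.NeBot] {u : ι → ℝ × ℝ → ℝ} {w v V : ℝ × ℝ → ℝ} (hW : Continuous W) (hum : ∀ i, Measurable (u i))
    (huW : ∀ i z, |u i z| ≤ W z)
    (hconv : ∀ φ : ℝ × ℝ → ℝ, Continuous φ → HasCompactSupport φ → Tendsto (fun i => ∫ z, u i z * φ z) l (𝓝 (∫ z, w z * φ z)))
    {N : Set (ℝ × ℝ)} (hN : IsOpen N) (hv : ∀ᵐ z, z ∈ N → v z = w z) (hvc : ∀ z ∈ N, ContinuousAt v z) (hVc : ∀ z ∈ N, ContinuousAt V z)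
    {z₁ : ℝ × ℝ} (hz₁ : z₁ ∈ N) (hle : ∀ᶠ i in l, ∀ z ∈ N, u i z ≤ V z) : v z₁ ≤ V z₁ := by
  by_contra hlt
  push Not at hlt
  have hev : ∀ᶠ z in 𝓝 z₁, V z < v z := (hVc z₁ hz₁).eventually_lt (hvc z₁ hz₁) hlt
  obtain ⟨N', hN'sub, hN'o, hz₁'⟩ := mem_nhds_iff.1 (inter_mem hev (hN.mem_nhds hz₁))
  obtain ⟨η, hη, hηc, hηN, hη0, hη1⟩ := exists_bump hN'o hz₁'
  have hηs : ∀ z ∈ tsupport η, z ∈ N := fun z hz => (hN'sub (hηN hz)).2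
  have iV : Integrable (fun z => V z * η z) := int_supp hη.continuous hηc fun z hz => hVc z (hηs z hz)
  have iv : Integrable (fun z => v z * η z) := int_supp hη.continuous hηc fun z hz => hvc z (hηs z hz)
  have c1 := hconv η hη.continuous hηc
  have l1 : ∫ z, w z * η z ≤ ∫ z, V z * η z := by
    refine le_of_tendsto c1 ?_
    filter_upwards [hle] with i hi
    refine integral_mono (int_u (hum i) hW (huW i) hη.continuous hηc) iV fun z => ?_
    by_cases hz : z ∈ tsupport η
    · exact mul_le_mul_of_nonneg_right (hi z (hηs z hz)) (hη0 z)
    · simp [image_eq_zero_of_notMem_tsupport hz]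
  have e1 : ∫ z, w z * η z = ∫ z, v z * η z := by
    refine integral_congr_ae ?_
    filter_upwards [hv] with z hz
    by_cases hzs : z ∈ tsupport η
    · rw [hz (hηs z hzs)]
    · simp [image_eq_zero_of_notMem_tsupport hzs]
  rw [e1] at l1
  have hcont : Continuous (fun z => (v z - V z) * η z) := cont_mul hη.continuous fun z hz => (hvc z (hηs z hz)).sub (hVc z (hηs z hz))
  have hnn : ∀ z, 0 ≤ (v z - V z) * η z := by
    intro z
    by_cases hz : z ∈ tsupport η
    · exact mul_nonneg (sub_nonneg.2 (hN'sub (hηN hz)).1.le) (hη0 z)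
    · simp [image_eq_zero_of_notMem_tsupport hz]
  have hpos : 0 < ∫ z, (v z - V z) * η z := by
    refine hcont.integral_pos_of_hasCompactSupport_nonneg_nonzero (x := z₁) hηc.mul_left hnn ?_
    rw [hη1.self_of_nhds, mul_one]
    exact (sub_pos.2 hlt).ne'
  have : ∫ z, (v z - V z) * η z = (∫ z, v z * η z) - ∫ z, V z * η z := by
    rw [← integral_sub iv iV]; congr 1; funext z; ring
  linarith

end

end Part11

section Part12

open Real Set MeasureTheory


open Filter Topology
open scoped ContDiff

section
variable {P : HOp} {O : Set (ℝ × ℝ)} {f G W : ℝ × ℝ → ℝ} {α : ℝ} {X Y : (ℝ × ℝ) →L[ℝ] ℝ}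

lemma HOp.Lh_neg (P : HOp) (h : ℝ) (u : ℝ × ℝ → ℝ) (z : ℝ × ℝ) : P.Lh h (fun z => - u z) z = - P.Lh h u z := by
  simp only [HOp.Lh, df1, df2]; ring

theorem HOp.exists_sol (hP : P.Good) (hfr : Frame P.e₁ P.e₂ X Y) (hO : IsOpen O) (ha : ∀ z ∈ O, 0 < P.a z) (hα0 : 0 < α) (hα1 : α < 1)
    (hf : ∀ z ∈ O, LH α f z) (hG : Continuous G) (hW : Continuous W) (hW0 : ∀ z, 0 < W z) (hW2 : ∀ z ∈ O, ContDiffAt ℝ 2 W z)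
    (hGW : ∀ z, |G z| ≤ W z) (hfW : ∀ z ∈ O, |f z| + 1 ≤ P.L W z) (hfb : ∀ z ∈ O, |f z| ≤ W z) :
    ∃ v : ℝ × ℝ → ℝ, (∀ z ∈ O, ContDiffAt ℝ 2 v z) ∧ (∀ z ∈ O, ∀ a b, LH α (dd b (dd a v)) z) ∧
      (∀ z ∈ O, P.L v z = f z) ∧ (∀ z ∈ O, |v z| ≤ W z) ∧
      ∀ z₀, P.Barrier O z₀ → Tendsto v (𝓝[O] z₀) (𝓝 (G z₀)) := by
  obtain ⟨K, hK, hKO, hKex⟩ := exhaustion hO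
  have hfc : ∀ z ∈ O, ContinuousAt f z := fun z hz => (hf z hz).continuousAt hα0
  obtain ⟨u, hum, huW, hu⟩ := HOp.family hP ha hO hK hKO hfc hG hW hW2 hGW hfW
  have hne : ((atTop : Filter ℕ).curry (𝓝[>] (0:ℝ))).NeBot := by
    constructor
    intro h
    have : ∀ᶠ x : ℕ × ℝ in (atTop : Filter ℕ).curry (𝓝[>] (0:ℝ)), False := by rw [h]; simp
    rw [eventually_curry_iff] at this
    simp at this
    obtain ⟨a, ha'⟩ := this
    exact (inferInstance : (𝓝[>] (0:ℝ)).NeBot).ne (ha' a le_rfl)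
  obtain ⟨l, hl, hle, w, hwm, hwW, hconv⟩ := weak_limit (l := (atTop : Filter ℕ).curry (𝓝[>] (0:ℝ))) hW hW0 hum huW
  have hwk : ∀ φ : ℝ × ℝ → ℝ, ContDiff ℝ ∞ φ → HasCompactSupport φ → tsupport φ ⊆ O → ∫ z, w z * P.Lst φ z = ∫ z, f z * φ z := by
    intro φ hφ hc hφO
    have hcL : HasCompactSupport (P.Lst φ) := HasCompactSupport.intro hc fun z hz => HOp.Lst_zero hz
    have t1 := hconv (P.Lst φ) (HOp.Lst_cont hP hφ) hcL
    have t2 : Tendsto (fun i => ∫ z, u i z * P.Lst φ z) l (𝓝 (∫ z, f z * φ z)) := by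
      refine Metric.tendsto_nhds.2 fun ε hε => hle ?_
      have : ∀ᶠ i : ℕ × ℝ in (atTop : Filter ℕ).curry (𝓝[>] (0:ℝ)), dist (∫ z, u i z * P.Lst φ z) (∫ z, f z * φ z) < ε := by
        rw [eventually_curry_iff]
        filter_upwards [hKex _ hc hφO] with n hn
        filter_upwards [hu n, HOp.adj_err hP hW hφ hc (half_pos hε)] with h h1 h2
        have h3 := h2 (u (n, h)) (hum _) (huW _)
        have h4 : ∫ z, P.Lh h (u (n, h)) z * φ z = ∫ z, f z * φ z := by
          congr 1; funext z
          by_cases hz : z ∈ tsupport φ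
          · rw [h1.1 z (hn hz)]
          · rw [image_eq_zero_of_notMem_tsupport hz]; simp
        rw [h4, abs_sub_comm] at h3
        rw [Real.dist_eq]; linarith
      exact this
    exact tendsto_nhds_unique t1 t2
  have hws := HOp.weakSol hP ha hW hwm hwW hwk
  have ia : ∀ z ∈ O, ContDiffAt ℝ ∞ (fun z => (P.a z)⁻¹) z := fun z hz => hP.ha.contDiffAt.inv (ha z hz).ne'
  obtain ⟨v, hvw, hv2, hvL, hveq⟩ := weyl hfr hO hα0 hα1 hws
    (fun z hz => by simp only [div_eq_mul_inv]; exact hP.hb₁.contDiffAt.mul (ia z hz))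
    (fun z hz => by simp only [div_eq_mul_inv]; exact hP.hb₂.contDiffAt.mul (ia z hz))
    (fun z hz => by simp only [div_eq_mul_inv]; exact contDiffAt_const.mul (ia z hz))
    (fun z hz => by
      simp only [div_eq_mul_inv]
      exact LH.mul hα0 (hf z hz) (LH.of_C1 hα1 hα0 ((ia z hz).of_le (by simp))))
  have hvc : ∀ z ∈ O, ContinuousAt v z := fun z hz => (hv2 z hz).continuousAt
  have hum' : ∀ i, Measurable (fun z => - u i z) := fun i => (hum i).neg
  have huW' : ∀ i z, |(- u i z)| ≤ W z := fun i z => by rw [abs_neg]; exact huW i z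
  have hconv' : ∀ φ : ℝ × ℝ → ℝ, Continuous φ → HasCompactSupport φ → Tendsto (fun i => ∫ z, (- u i z) * φ z) l (𝓝 (∫ z, (- w z) * φ z)) := by
    intro φ h1 h2
    have := (hconv φ h1 h2).neg
    simpa only [neg_mul, integral_neg] using this
  -- boundary
  have bd : ∀ (u' : ℕ × ℝ → ℝ × ℝ → ℝ) (w' v' f' G' : ℝ × ℝ → ℝ), (∀ i, Measurable (u' i)) → (∀ i z, |u' i z| ≤ W z) →
      (∀ φ : ℝ × ℝ → ℝ, Continuous φ → HasCompactSupport φ → Tendsto (fun i => ∫ z, u' i z * φ z) l (𝓝 (∫ z, w' z * φ z))) →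
      (∀ᵐ z, z ∈ O → v' z = w' z) → (∀ z ∈ O, ContinuousAt v' z) → Continuous G' → (∀ z ∈ O, |f' z| ≤ W z) →
      (∀ n, ∀ᶠ h in 𝓝[>] (0:ℝ), (∀ z ∈ K n, P.Lh h (u' (n, h)) z = f' z) ∧ ∀ z, z ∉ K n → u' (n, h) z = G' z) →
      ∀ z₀, P.Barrier O z₀ → ∀ ε > 0, ∀ᶠ z in 𝓝[O] z₀, v' z < G' z₀ + 2 * ε := by
    intro u' w' v' f' G' um uW hcv hae hc hG' hf' hu' z₀ hbar ε hε
    obtain ⟨R, hR, V, hVc, hVs, hVu⟩ := HOp.barrier_upper hP ha hO hK hKO hG' hW hf' uW hu' hbar hε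
    filter_upwards [hVs, self_mem_nhdsWithin, mem_nhdsWithin_of_mem_nhds (Metric.ball_mem_nhds z₀ hR)] with z h1 h2 h3
    refine lt_of_le_of_lt ?_ h1
    have ho : IsOpen (O ∩ Metric.ball z₀ R) := hO.inter Metric.isOpen_ball
    obtain ⟨C, hC, hzC, hCs⟩ := exists_compact_subset ho ⟨h2, h3⟩
    refine pass_upper hW um uW hcv (N := interior C) isOpen_interior ?_ (fun y hy => hc y (hCs (interior_subset hy)).1)
      (fun y hy => hVc y (hCs (interior_subset hy))) hzC (hle ?_)
    · filter_upwards [hae] with y hy hyC using hy (hCs (interior_subset hyC)).1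
    · have : ∀ᶠ i : ℕ × ℝ in (atTop : Filter ℕ).curry (𝓝[>] (0:ℝ)), ∀ z ∈ interior C, u' i z ≤ V z := by
        rw [eventually_curry_iff]
        filter_upwards [hKex _ hC (fun y hy => (hCs hy).1)] with n hn
        filter_upwards [hVu n] with h hh y hy
        exact hh y ⟨hn (interior_subset hy), Metric.ball_subset_closedBall (hCs (interior_subset hy)).2⟩
      exact this
  refine ⟨v, hv2, hvL, fun z hz => ?_, fun z hz => ?_, fun z₀ hbar => ?_⟩
  · have := hveq z hz
    have hz' := (ha z hz).ne'
    unfold HOp.L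
    field_simp at this
    linarith
  · rw [abs_le]
    constructor
    · have := pass_upper (v := fun z => - v z) (w := fun z => - w z) (V := W) hW hum' huW' hconv' hO (by filter_upwards [hvw] with y h1 h2; rw [h1 h2])
        (fun z hz => (hvc z hz).neg) (fun z _ => hW.continuousAt) hz (Eventually.of_forall fun i z _ => (le_abs_self _).trans (huW' i z))
      linarith
    · exact pass_upper (V := W) hW hum huW hconv hO hvw hvc (fun z _ => hW.continuousAt) hz
        (Eventually.of_forall fun i z _ => (le_abs_self _).trans (huW i z))
  · refine Metric.tendsto_nhds.2 fun ε hε => ?_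
    have b1 := bd u w v f G hum huW hconv hvw hvc hG hfb hu z₀ hbar (ε / 2) (by positivity)
    have b2 := bd (fun i z => - u i z) (fun z => - w z) (fun z => - v z) (fun z => - f z) (fun z => - G z) hum' huW' hconv'
      (by filter_upwards [hvw] with y h1 h2; rw [h1 h2]) (fun z hz => (hvc z hz).neg) hG.neg
      (fun z hz => by rw [abs_neg]; exact hfb z hz)
      (fun n => by
        filter_upwards [hu n] with h hh
        exact ⟨fun z hz => by rw [HOp.Lh_neg, hh.1 z hz], fun z hz => by rw [hh.2 z hz]⟩) z₀ hbar (ε / 2) (by positivity)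
    filter_upwards [b1, b2] with z h1 h2
    rw [Real.dist_eq, abs_lt]
    constructor <;> linarith

end

end Part12

section Part13

open Real Set MeasureTheory


open Filter Topology
open scoped ContDiff

/-- the Heston operator in the frame -/
def hop (σ ρ κ θ q r : ℝ) : HOp where
  e₁ := (1, ρ * σ)
  e₂ := (0, σ * Real.sqrt (1 - ρ ^ 2))
  a := fun z => z.2 / 2
  b₁ := fun z => r - q - z.2 / 2
  b₂ := fun z => (κ * (θ - z.2) - ρ * σ * (r - q - z.2 / 2)) / (σ * Real.sqrt (1 - ρ ^ 2))
  r := r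

section
variable {σ ρ κ θ q r : ℝ}

lemma s_ne (hσ : σ ≠ 0) (h1 : -1 < ρ) (h2 : ρ < 1) : σ * Real.sqrt (1 - ρ ^ 2) ≠ 0 := by
  have : 0 < 1 - ρ ^ 2 := by nlinarith
  exact mul_ne_zero hσ (Real.sqrt_pos.2 this).ne'

lemma s_sq (h1 : -1 < ρ) (h2 : ρ < 1) : (σ * Real.sqrt (1 - ρ ^ 2)) ^ 2 = σ ^ 2 * (1 - ρ ^ 2) := by
  have : 0 < 1 - ρ ^ 2 := by nlinarith
  rw [mul_pow, Real.sq_sqrt this.le]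

lemma hop_good (hr : 0 < r) : (hop σ ρ κ θ q r).Good where
  ha := by unfold hop; fun_prop
  hb₁ := by unfold hop; fun_prop
  hb₂ := by unfold hop; fun_prop
  hr := hr

def frX : (ℝ × ℝ) →L[ℝ] ℝ := ContinuousLinearMap.fst ℝ ℝ ℝ
def frY (σ ρ : ℝ) : (ℝ × ℝ) →L[ℝ] ℝ := (σ * Real.sqrt (1 - ρ ^ 2))⁻¹ • (ContinuousLinearMap.snd ℝ ℝ ℝ - (ρ * σ) • ContinuousLinearMap.fst ℝ ℝ ℝ)

lemma hop_frame (hσ : σ ≠ 0) (h1 : -1 < ρ) (h2 : ρ < 1) :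
    Frame (hop σ ρ κ θ q r).e₁ (hop σ ρ κ θ q r).e₂ frX (frY σ ρ) := by
  have hs := s_ne hσ h1 h2
  constructor <;> simp only [hop, frX, frY]
  · simp
  · simp
  · simp
  · simp only [_root_.smul_apply, _root_.sub_apply, ContinuousLinearMap.coe_snd', ContinuousLinearMap.coe_fst', smul_eq_mul, mul_zero, sub_zero]
    exact inv_mul_cancel₀ hs
  · intro z
    simp only [_root_.smul_apply, _root_.sub_apply, ContinuousLinearMap.coe_snd', ContinuousLinearMap.coe_fst', smul_eq_mul]
    ext
    · simp
    · simp only [Prod.snd_add, Prod.smul_snd, smul_eq_mul]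
      generalize σ * Real.sqrt (1 - ρ ^ 2) = s at *
      field_simp
      ring

lemma dd_dd_eq {u : ℝ × ℝ → ℝ} {z : ℝ × ℝ} (hu : ContDiffAt ℝ 2 u z) (v w : ℝ × ℝ) :
    dd w (dd v u) z = fderiv ℝ (fderiv ℝ u) z w v := by
  have hd : DifferentiableAt ℝ (fderiv ℝ u) z :=
    (hu.fderiv_right (m := 1) (by norm_num)).differentiableAt (by norm_num)
  have := fderiv_clm_apply (𝕜 := ℝ) (c := fderiv ℝ u) (u := fun _ => v) hd (differentiableAt_const v)
  show fderiv ℝ (fun z' => fderiv ℝ u z' v) z w = _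
  rw [this]
  simp

lemma heston_eq (hσ : σ ≠ 0) (h1 : -1 < ρ) (h2 : ρ < 1) {u : ℝ × ℝ → ℝ} {z : ℝ × ℝ} (hu : ContDiffAt ℝ 2 u z) :
    (hop σ ρ κ θ q r).L u z = hestonA σ ρ κ θ q r u z := by
  have hs := s_ne hσ h1 h2
  have hs2 := s_sq (σ := σ) h1 h2
  have sym : fderiv ℝ (fderiv ℝ u) z (1, 0) (0, 1) = fderiv ℝ (fderiv ℝ u) z (0, 1) (1, 0) :=
    (hu.isSymmSndFDerivAt (by simp)) (1, 0) (0, 1)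
  unfold HOp.L hestonA
  simp only [D1_eq_dd, D2_eq_dd, dd_dd_eq hu]
  simp only [dd, hop]
  generalize σ * Real.sqrt (1 - ρ ^ 2) = s at *
  have e1 : ((1, ρ * σ) : ℝ × ℝ) = (1, 0) + (ρ * σ) • (0, 1) := by ext <;> simp
  have e2 : ((0, s) : ℝ × ℝ) = s • (0, 1) := by ext <;> simp
  rw [e1, e2]
  simp only [map_add, map_smul, _root_.add_apply, _root_.smul_apply, smul_eq_mul]
  generalize fderiv ℝ (fderiv ℝ u) z (0, 1) (0, 1) = C at *
  generalize fderiv ℝ (fderiv ℝ u) z (1, 0) (0, 1) = B at *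
  generalize fderiv ℝ (fderiv ℝ u) z (0, 1) (1, 0) = B' at *
  subst sym
  field_simp
  linear_combination (- z.2 * C) * hs2

/-- evaluate the operator from explicit derivatives -/
lemma hA_of {w wx wy : ℝ × ℝ → ℝ} {z : ℝ × ℝ} {a b c d : ℝ}
    (h : ∀ᶠ z' in 𝓝 z, HasFDerivAt w (wx z' • ContinuousLinearMap.fst ℝ ℝ ℝ + wy z' • ContinuousLinearMap.snd ℝ ℝ ℝ) z')
    (hx : HasFDerivAt wx (a • ContinuousLinearMap.fst ℝ ℝ ℝ + b • ContinuousLinearMap.snd ℝ ℝ ℝ) z)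
    (hy : HasFDerivAt wy (c • ContinuousLinearMap.fst ℝ ℝ ℝ + d • ContinuousLinearMap.snd ℝ ℝ ℝ) z) :
    hestonA σ ρ κ θ q r w z = -(z.2 / 2) * (a + 2 * ρ * σ * b + σ ^ 2 * d) - (r - q - z.2 / 2) * wx z - κ * (θ - z.2) * wy z + r * w z := by
  have ex : dd (1, 0) w =ᶠ[𝓝 z] wx := by
    filter_upwards [h] with z' h'
    simp [dd, h'.fderiv]
  have ey : dd (0, 1) w =ᶠ[𝓝 z] wy := by
    filter_upwards [h] with z' h'
    simp [dd, h'.fderiv]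
  unfold hestonA
  simp only [D1_eq_dd, D2_eq_dd]
  rw [dd_congr ex, dd_congr ex, dd_congr ey, ex.eq_of_nhds, ey.eq_of_nhds]
  simp [dd, hx.fderiv, hy.fderiv]

lemma hA_add {p p1 g g1 : ℝ → ℝ} {p2 g2 : ℝ} {z : ℝ × ℝ}
    (hp : ∀ᶠ t in 𝓝 z.1, HasDerivAt p (p1 t) t) (hp1 : HasDerivAt p1 p2 z.1)
    (hg : ∀ᶠ t in 𝓝 z.2, HasDerivAt g (g1 t) t) (hg1 : HasDerivAt g1 g2 z.2) :
    hestonA σ ρ κ θ q r (fun z => p z.1 + g z.2) z =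
      -(z.2 / 2) * (p2 + σ ^ 2 * g2) - (r - q - z.2 / 2) * p1 z.1 - κ * (θ - z.2) * g1 z.2 + r * (p z.1 + g z.2) := by
  rw [hA_of (wx := fun z => p1 z.1) (wy := fun z => g1 z.2) (a := p2) (b := 0) (c := 0) (d := g2)]
  · ring
  · filter_upwards [continuousAt_fst.eventually hp, continuousAt_snd.eventually hg] with z' h1 h2
    exact (h1.comp_hasFDerivAt z' hasFDerivAt_fst).add (h2.comp_hasFDerivAt z' hasFDerivAt_snd)
  · rw [zero_smul, add_zero]; exact hp1.comp_hasFDerivAt z hasFDerivAt_fst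
  · rw [zero_smul, zero_add]; exact hg1.comp_hasFDerivAt z hasFDerivAt_snd

lemma hA_mul {p p1 g g1 : ℝ → ℝ} {p2 g2 : ℝ} {z : ℝ × ℝ}
    (hp : ∀ᶠ t in 𝓝 z.1, HasDerivAt p (p1 t) t) (hp1 : HasDerivAt p1 p2 z.1)
    (hg : ∀ᶠ t in 𝓝 z.2, HasDerivAt g (g1 t) t) (hg1 : HasDerivAt g1 g2 z.2) :
    hestonA σ ρ κ θ q r (fun z => p z.1 * g z.2) z =
      -(z.2 / 2) * (p2 * g z.2 + 2 * ρ * σ * (p1 z.1 * g1 z.2) + σ ^ 2 * (p z.1 * g2)) - (r - q - z.2 / 2) * (p1 z.1 * g z.2)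
        - κ * (θ - z.2) * (p z.1 * g1 z.2) + r * (p z.1 * g z.2) := by
  have m : ∀ {p g : ℝ → ℝ} {p' g' : ℝ} {z : ℝ × ℝ}, HasDerivAt p p' z.1 → HasDerivAt g g' z.2 →
      HasFDerivAt (fun z : ℝ × ℝ => p z.1 * g z.2) ((p' * g z.2) • ContinuousLinearMap.fst ℝ ℝ ℝ + (p z.1 * g') • ContinuousLinearMap.snd ℝ ℝ ℝ) z := by
    intro p g p' g' z h1 h2
    refine ((h1.comp_hasFDerivAt z hasFDerivAt_fst).mul (h2.comp_hasFDerivAt z hasFDerivAt_snd)).congr_fderiv ?_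
    ext <;> simp [mul_comm]
  rw [hA_of (wx := fun z => p1 z.1 * g z.2) (wy := fun z => p z.1 * g1 z.2)]
  · filter_upwards [continuousAt_fst.eventually hp, continuousAt_snd.eventually hg] with z' h1 h2
    exact m h1 h2
  · exact m hp1 hg.self_of_nhds
  · exact m hp.self_of_nhds hg1

end

end Part13

section Part14

open Real Set MeasureTheory


open Filter Topology
open scoped ContDiff

section
variable {σ ρ κ θ q r : ℝ}

def W0 (M₁ M₂ : ℝ) : ℝ × ℝ → ℝ := fun z => exp (M₂ * z.1) + (1 + exp (M₁ * z.2))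

lemma W0_smooth (M₁ M₂ : ℝ) : ContDiff ℝ ∞ (W0 M₁ M₂) := by
  unfold W0
  exact (Real.contDiff_exp.comp (by fun_prop)).add (contDiff_const.add (Real.contDiff_exp.comp (by fun_prop)))

lemma hasDerivAt_expc (M t : ℝ) : HasDerivAt (fun t => exp (M * t)) (M * exp (M * t)) t := by
  have := ((hasDerivAt_id t).const_mul M).exp
  simpa [mul_comm] using this

lemma W0_pos (hσ : σ ≠ 0) (hκ : 0 < κ) (hθ : 0 < θ) (hr : 0 < r) (hq : 0 ≤ q) {M₁ M₂ : ℝ} (h0 : 0 ≤ M₁)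
    (h1 : M₁ < min (r / (κ * θ)) (2 * κ / σ ^ 2)) (h2 : 0 ≤ M₂) (h3 : M₂ < 1) :
    ∃ δ > 0, ∀ z : ℝ × ℝ, 0 < z.2 → δ * W0 M₁ M₂ z ≤ hestonA σ ρ κ θ q r (W0 M₁ M₂) z := by
  have hσ2 : 0 < σ ^ 2 := by positivity
  have a1 : 0 < r - κ * θ * M₁ := by
    have := (lt_div_iff₀ (by positivity)).1 (h1.trans_le (min_le_left _ _))
    linarith
  have a2 : 0 < κ - σ ^ 2 * M₁ / 2 := by
    have := (lt_div_iff₀ hσ2).1 (h1.trans_le (min_le_right _ _))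
    linarith
  have a3 : 0 < r * (1 - M₂) := mul_pos hr (by linarith)
  refine ⟨min (r - κ * θ * M₁) (r * (1 - M₂)), lt_min a1 a3, fun z hz => ?_⟩
  have := hA_add (σ := σ) (ρ := ρ) (κ := κ) (θ := θ) (q := q) (r := r) (z := z) (p := fun t => exp (M₂ * t)) (p1 := fun t => M₂ * exp (M₂ * t)) (p2 := M₂ * (M₂ * exp (M₂ * z.1)))
    (g := fun t => 1 + exp (M₁ * t)) (g1 := fun t => M₁ * exp (M₁ * t)) (g2 := M₁ * (M₁ * exp (M₁ * z.2)))
    (Eventually.of_forall fun t => hasDerivAt_expc _ _) ((hasDerivAt_expc _ _).const_mul _)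
    (Eventually.of_forall fun t => (hasDerivAt_expc _ _).const_add _) ((hasDerivAt_expc _ _).const_mul _)
  unfold W0
  rw [this]
  set E1 := exp (M₁ * z.2)
  set E2 := exp (M₂ * z.1)
  have e1 : 0 < E1 := exp_pos _
  have e2 : 0 < E2 := exp_pos _
  set δ := min (r - κ * θ * M₁) (r * (1 - M₂))
  have d1 : δ ≤ r - κ * θ * M₁ := min_le_left _ _
  have d2 : δ ≤ r * (1 - M₂) := min_le_right _ _
  have d3 : δ ≤ r := d1.trans (by have : 0 ≤ κ * θ * M₁ := by positivity
                                  linarith)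
  have t1 : δ * E1 ≤ E1 * ((r - κ * θ * M₁) + z.2 * M₁ * (κ - σ ^ 2 * M₁ / 2)) := by
    have : 0 ≤ z.2 * M₁ * (κ - σ ^ 2 * M₁ / 2) := by positivity
    rw [mul_comm]
    exact mul_le_mul_of_nonneg_left (by linarith) e1.le
  have t2 : δ * E2 ≤ E2 * ((z.2 / 2) * M₂ * (1 - M₂) + r * (1 - M₂) + q * M₂) := by
    have s1 : 0 ≤ (z.2 / 2) * M₂ * (1 - M₂) := mul_nonneg (by positivity) (by linarith)
    have s2 : 0 ≤ q * M₂ := by positivity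
    rw [mul_comm]
    exact mul_le_mul_of_nonneg_left (by linarith) e2.le
  nlinarith

lemma barrier_zero (hσ : σ ≠ 0) (hρ1 : -1 < ρ) (hρ2 : ρ < 1) (hκ : 0 < κ) (hθ : 0 < θ) (hr : 0 < r) (hβ : 2 * κ * θ / σ ^ 2 < 1)
    {O : Set (ℝ × ℝ)} (hO : O ⊆ HH) {z₀ : ℝ × ℝ} (h0 : z₀.2 = 0) : (hop σ ρ κ θ q r).Barrier O z₀ := by
  have hσ2 : 0 < σ ^ 2 := by positivity
  set β := 2 * κ * θ / σ ^ 2 with hβd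
  have hβ0 : 0 < β := by positivity
  set p := (1 - β) / 2 with hp
  have hp0 : 0 < p := by rw [hp]; linarith
  have hp1 : p < 1 := by rw [hp]; linarith
  have hκθ : κ * θ = σ ^ 2 * (1 - 2 * p) / 2 := by
    rw [hp, hβd]; field_simp; ring
  set N := (4 + 2 * |r - q|) / (p ^ 2 * σ ^ 2 / 2) with hN
  have hN0 : 0 < N := by positivity
  have hN1 : N * (p ^ 2 * σ ^ 2 / 2) = 4 + 2 * |r - q| := by rw [hN]; field_simp
  set w : ℝ × ℝ → ℝ := fun z => (z.1 - z₀.1) ^ 2 + N * z.2 ^ p with hw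
  have hC2 : ∀ z : ℝ × ℝ, 0 < z.2 → ContDiffAt ℝ 2 w z := by
    intro z hz
    have : ContDiffAt ℝ 2 (fun z : ℝ × ℝ => z.2 ^ p) z := contDiffAt_snd.rpow_const_of_ne hz.ne'
    exact ((contDiffAt_fst.sub contDiffAt_const).pow 2).add (contDiffAt_const.mul this)
  refine ⟨1, one_pos, w, fun z hz => hC2 z (hO hz.1), ?_, fun z hz => ?_, fun z hz => ?_, fun δ hδ => ?_⟩
  · have : Continuous w := by
      rw [hw]
      have := (continuous_snd (X := ℝ) (Y := ℝ)).rpow_const (p := p) fun x => Or.inr hp0.le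
      fun_prop
    have t := (this.tendsto z₀).mono_left (nhdsWithin_le_nhds (s := O))
    have e : w z₀ = 0 := by simp [hw, h0, Real.zero_rpow hp0.ne']
    rwa [e] at t
  · have : 0 < z.2 := hO hz.1
    simp only [hw]; positivity
  · have hy : 0 < z.2 := hO hz.1
    rw [heston_eq hσ hρ1 hρ2 (hC2 z hy)]
    have := hA_add (σ := σ) (ρ := ρ) (κ := κ) (θ := θ) (q := q) (r := r) (z := z) (p := fun t => (t - z₀.1) ^ 2) (p1 := fun t => 2 * (t - z₀.1)) (p2 := 2)
      (g := fun t => N * t ^ p) (g1 := fun t => N * (p * t ^ (p - 1))) (g2 := N * (p * ((p - 1) * z.2 ^ (p - 1 - 1))))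
      (Eventually.of_forall fun t => (((hasDerivAt_id t).sub_const z₀.1).pow 2).congr_deriv (by simp))
      (by simpa using ((hasDerivAt_id z.1).sub_const z₀.1).const_mul 2)
      (by
        filter_upwards [lt_mem_nhds hy] with t ht
        exact (Real.hasDerivAt_rpow_const (Or.inl ht.ne')).const_mul N)
      (((Real.hasDerivAt_rpow_const (Or.inl hy.ne')).const_mul p).const_mul N)
    rw [hw, this]
    have hb := hz.2
    rw [Metric.mem_ball, Prod.dist_eq, max_lt_iff, Real.dist_eq, Real.dist_eq, h0, sub_zero, abs_of_pos hy] at hb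
    obtain ⟨hx, hy1⟩ := hb
    set x := z.1 - z₀.1
    have r1 : z.2 ^ (p - 1 - 1) = z.2 ^ (p - 1) / z.2 := Real.rpow_sub_one hy.ne' _
    have r2 : z.2 ^ p = z.2 ^ (p - 1) * z.2 := by rw [Real.rpow_sub_one hy.ne']; field_simp
    have r3 : 1 ≤ z.2 ^ (p - 1) := Real.one_le_rpow_of_pos_of_le_one_of_nonpos hy hy1.le (by linarith)
    simp only [r1, r2]
    generalize z.2 ^ (p - 1) = t at r3
    generalize z.2 = y at *
    have key : -(y / 2) * (2 + σ ^ 2 * (N * (p * ((p - 1) * (t / y))))) - (r - q - y / 2) * (2 * x) - κ * (θ - y) * (N * (p * t)) + r * (x ^ 2 + N * (t * y))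
      = N * (p ^ 2 * σ ^ 2 / 2) * t + (κ * p + r) * N * t * y + r * x ^ 2 - y - (r - q) * (2 * x) + y * x := by
      have : y * (t / y) = t := by field_simp
      linear_combination (-(1/2) * σ ^ 2 * N * p * (p - 1)) * this - N * p * t * hκθ
    rw [key, hN1]
    have k1 : (r - q) * x ≤ |r - q| := by
      calc (r - q) * x ≤ |(r - q) * x| := le_abs_self _
        _ = |r - q| * |x| := abs_mul _ _
        _ ≤ |r - q| * 1 := mul_le_mul_of_nonneg_left hx.le (abs_nonneg _)
        _ = _ := mul_one _
    have k2 : -1 ≤ y * x := by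
      have := abs_le.1 hx.le
      nlinarith
    have k3 : 0 ≤ (κ * p + r) * N * t * y := by positivity
    have k4 : 0 ≤ r * x ^ 2 := by positivity
    have k5 : (4 + 2 * |r - q|) ≤ (4 + 2 * |r - q|) * t := le_mul_of_one_le_right (by positivity) r3
    nlinarith
  · refine ⟨min (δ ^ 2) (N * δ ^ p), lt_min (by positivity) (by positivity), fun z hz hd => ?_⟩
    have hy : 0 < z.2 := hO hz.1
    rw [Prod.dist_eq, le_max_iff, Real.dist_eq, Real.dist_eq, h0, sub_zero, abs_of_pos hy] at hd
    simp only [hw]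
    rcases hd with hd | hd
    · refine (min_le_left _ _).trans ?_
      have : δ ^ 2 ≤ (z.1 - z₀.1) ^ 2 := by rw [← sq_abs (z.1 - z₀.1)]; gcongr
      have : 0 ≤ N * z.2 ^ p := by positivity
      linarith
    · refine (min_le_right _ _).trans ?_
      have : N * δ ^ p ≤ N * z.2 ^ p := by gcongr
      nlinarith [sq_nonneg (z.1 - z₀.1)]

lemma hasDerivAt_gauss (m c t : ℝ) : HasDerivAt (fun t => exp (-m * (t - c) ^ 2)) (-2 * m * (t - c) * exp (-m * (t - c) ^ 2)) t := by
  have := ((((hasDerivAt_id t).sub_const c).pow 2).const_mul (-m)).exp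
  refine this.congr_deriv ?_
  simp; ring

lemma hasDerivAt_gauss2 (m c t : ℝ) : HasDerivAt (fun t => -2 * m * (t - c) * exp (-m * (t - c) ^ 2))
    ((4 * m ^ 2 * (t - c) ^ 2 - 2 * m) * exp (-m * (t - c) ^ 2)) t := by
  have := (((hasDerivAt_id t).sub_const c).const_mul (-2 * m)).mul (hasDerivAt_gauss m c t)
  refine this.congr_deriv ?_
  simp; ring

lemma barrier_ext (hσ : σ ≠ 0) (hρ1 : -1 < ρ) (hρ2 : ρ < 1)
    {O : Set (ℝ × ℝ)} (hOo : IsOpen O) {z₀ : ℝ × ℝ} (h0 : z₀ ∈ Gamma1 O) (hext : extSphere O (Gamma1 O)) : (hop σ ρ κ θ q r).Barrier O z₀ := by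
  have hσ2 : 0 < σ ^ 2 := by positivity
  obtain ⟨c, R, hR, hc⟩ := hext z₀ h0
  have hy0 : 0 < z₀.2 := h0.2
  have hz0cl : z₀ ∈ closure O := frontier_subset_closure h0.1
  have hz0n : z₀ ∉ O := fun h => h0.1.2 (hOo.interior_eq.symm ▸ h)
  set d : ℝ × ℝ → ℝ := fun z => (z.1 - c.1) ^ 2 + (z.2 - c.2) ^ 2 with hd
  have hdc : Continuous d := by rw [hd]; fun_prop
  have hgt : ∀ z ∈ closure O, z ≠ z₀ → R ^ 2 < d z := by
    intro z hz hne
    by_contra hle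
    push Not at hle
    have : z ∈ ({z₀} : Set (ℝ × ℝ)) := by
      rw [← hc]
      exact ⟨Real.sqrt_le_iff.2 ⟨hR.le, hle⟩, hz⟩
    exact hne this
  have hd0 : d z₀ = R ^ 2 := by
    apply le_antisymm
    · have : z₀ ∈ ({z₀} : Set (ℝ × ℝ)) := rfl
      rw [← hc] at this
      exact (Real.sqrt_le_iff.1 this.1).2
    · have : closure O ⊆ {z | R ^ 2 ≤ d z} := by
        apply closure_minimal
        · intro z hz
          exact (hgt z (subset_closure hz) (fun h => hz0n (h ▸ hz))).le
        · exact isClosed_le continuous_const hdc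
      exact this hz0cl
  set F : ℝ × ℝ → ℝ := fun z => z.2 * ((z.1 - c.1) ^ 2 + 2 * ρ * σ * ((z.1 - c.1) * (z.2 - c.2)) + σ ^ 2 * (z.2 - c.2) ^ 2) with hF
  set H : ℝ × ℝ → ℝ := fun z => - z.2 * (1 + σ ^ 2) - 2 * (r - q - z.2 / 2) * (z.1 - c.1) - 2 * κ * (θ - z.2) * (z.2 - c.2) with hH
  have hF0 : 0 < F z₀ := by
    simp only [hF]
    refine mul_pos hy0 ?_
    have e : d z₀ = R ^ 2 := hd0
    simp only [hd] at e
    generalize z₀.1 - c.1 = a at *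
    generalize z₀.2 - c.2 = b at *
    have hq1 : 0 < 1 - ρ ^ 2 := by nlinarith
    have : a ^ 2 + 2 * ρ * σ * (a * b) + σ ^ 2 * b ^ 2 = (a + ρ * σ * b) ^ 2 + (1 - ρ ^ 2) * σ ^ 2 * b ^ 2 := by ring
    rw [this]
    by_cases hb : b = 0
    · subst hb
      have : 0 < a ^ 2 := by nlinarith [pow_pos hR 2]
      nlinarith
    · have : 0 < (1 - ρ ^ 2) * σ ^ 2 * b ^ 2 := by positivity
      positivity
  set m := (|H z₀| + 1) / F z₀ with hm
  have hm0 : 0 < m := by positivity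
  have hmF : m * F z₀ = |H z₀| + 1 := by rw [hm]; field_simp
  set E : ℝ × ℝ → ℝ := fun z => exp (-m * (z.1 - c.1) ^ 2) * exp (-m * (z.2 - c.2) ^ 2) with hE
  have hEd : ∀ z, E z = exp (-m * d z) := fun z => by
    simp only [hE, hd]; rw [← Real.exp_add]; ring_nf
  have hEs : ContDiff ℝ ∞ E := by
    rw [hE]
    exact (Real.contDiff_exp.comp (by fun_prop)).mul (Real.contDiff_exp.comp (by fun_prop))
  set A := exp (-m * R ^ 2) with hA
  have hA0 : 0 < A := exp_pos _
  set Ψ : ℝ × ℝ → ℝ := fun z => r * A + E z * (2 * m ^ 2 * F z + m * H z - r) with hΨ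
  have hL : ∀ z, hestonA σ ρ κ θ q r E z = r * A - Ψ z := by
    intro z
    have := hA_mul (σ := σ) (ρ := ρ) (κ := κ) (θ := θ) (q := q) (r := r) (z := z)
      (Eventually.of_forall fun t => hasDerivAt_gauss m c.1 t) (hasDerivAt_gauss2 m c.1 z.1)
      (Eventually.of_forall fun t => hasDerivAt_gauss m c.2 t) (hasDerivAt_gauss2 m c.2 z.2)
    rw [hE, this]
    simp only [hΨ, hE, hF, hH]
    ring
  have hΨ0 : 0 < Ψ z₀ := by
    have e : E z₀ = A := by rw [hEd, hd0]
    simp only [hΨ, e]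
    have : r * A + A * (2 * m ^ 2 * F z₀ + m * H z₀ - r) = A * m * (2 * (m * F z₀) + H z₀) := by ring
    rw [this, hmF]
    have := neg_abs_le (H z₀)
    have := abs_nonneg (H z₀)
    refine mul_pos (mul_pos hA0 hm0) (by linarith)
  have hΨc : Continuous Ψ := by
    have := hEs.continuous
    simp only [hΨ, hF, hH]
    fun_prop
  obtain ⟨R', hR', hball⟩ := Metric.mem_nhds_iff.1 (hΨc.continuousAt.eventually (lt_mem_nhds (half_lt_self hΨ0)))
  set k := Ψ z₀ / 2 with hk
  have hk0 : 0 < k := by positivity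
  set w : ℝ × ℝ → ℝ := fun z => A / k + (-1 / k) * E z with hw
  have hwc : Continuous w := by
    have := hEs.continuous
    rw [hw]; fun_prop
  have hws : ContDiff ℝ ∞ w := by
    rw [hw]; exact contDiff_const.add (contDiff_const.mul hEs)
  have hw' : ∀ z, w z = (A - E z) / k := fun z => by simp only [hw]; ring
  have hpos : ∀ z ∈ closure O, z ≠ z₀ → 0 < w z := by
    intro z hz hne
    rw [hw', hEd]
    refine div_pos (sub_pos.2 (exp_lt_exp.2 ?_)) hk0
    have := hgt z hz hne
    nlinarith
  refine ⟨R', hR', w, fun z _ => hws.contDiffAt.of_le two_le_infty, ?_, fun z hz => ?_, fun z hz => ?_, fun δ hδ => ?_⟩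
  · have t := (hwc.tendsto z₀).mono_left (nhdsWithin_le_nhds (s := O))
    have e : w z₀ = 0 := by rw [hw', hEd, hd0]; simp [hA]
    rwa [e] at t
  · exact (hpos z (subset_closure hz.1) (fun h => hz0n (h ▸ hz.1))).le
  · rw [hw, HOp.L_affine (hEs.contDiffAt.of_le two_le_infty), heston_eq hσ hρ1 hρ2 (hEs.contDiffAt.of_le two_le_infty), hL]
    have h1 : k < Ψ z := hball hz.2
    show 1 ≤ r * (A / k) + -1 / k * (r * A - Ψ z)
    have : r * (A / k) + -1 / k * (r * A - Ψ z) = Ψ z / k := by field_simp; ring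
    rw [this, le_div_iff₀ hk0]; linarith
  · have hKc : IsCompact ((closure O ∩ Metric.closedBall z₀ R') ∩ {z | δ ≤ dist z z₀}) := 
      ((isCompact_closedBall z₀ R').inter_left isClosed_closure).inter_right (isClosed_le continuous_const (continuous_id.dist continuous_const))
    obtain ⟨c', hc', hle⟩ := hKc.exists_forall_le' (a := (0:ℝ)) hwc.continuousOn (fun z hz => hpos z hz.1.1 (fun h => by
      have := hz.2; simp [h] at this; linarith))
    exact ⟨c', hc', fun z hz hdz => hle z ⟨⟨subset_closure hz.1, Metric.ball_subset_closedBall hz.2⟩, hdz⟩⟩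

end

end Part14

section Main
open Filter Topology
open scoped ContDiff

/-- Existence of solutions to the elliptic Heston boundary value problem with continuous
Dirichlet boundary data on the full boundary, when `0 < β < 1`. -/
theorem heston_elliptic_bvp_existence_beta_lt_one
    (σ ρ κ θ q r : ℝ) (hσ : σ ≠ 0) (hρ₁ : -1 < ρ) (hρ₂ : ρ < 1)
    (hκ : 0 < κ) (hθ : 0 < θ) (hr : 0 < r) (hq : 0 ≤ q)
    (hβ₀ : 0 < 2 * κ * θ / σ ^ 2) (hβ₁ : 2 * κ * θ / σ ^ 2 < 1)
    (O : Set (ℝ × ℝ)) (hO : IsOpen O) (hOconn : IsConnected O) (hOsub : O ⊆ HH)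
    (hΓ₀ : (Gamma0 O).Nonempty)
    (hsphere : extSphere O (Gamma1 O))
    (α : ℝ) (hα₀ : 0 < α) (hα₁ : α < 1)
    (f g : ℝ × ℝ → ℝ)
    (hf : locHolderOn α O f) (hfg : ellGrowth σ κ θ r O f)
    (hg : ContinuousOn g (frontier O))
    (hgg : ellGrowth σ κ θ r (frontier O) g) :
    ∃ u : ℝ × ℝ → ℝ, ContinuousOn u (closure O) ∧ C2alphaOn α O u ∧
      ellGrowth σ κ θ r O u ∧
      (∀ z ∈ O, hestonA σ ρ κ θ q r u z = f z) ∧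
      (∀ z ∈ frontier O, u z = g z) := by
  have hσ2 : 0 < σ ^ 2 := by positivity
  obtain ⟨Cf, Mf, Nf, hCf, hMf0, hMf1, hNf0, hNf1, hfb⟩ := hfg
  obtain ⟨Cg, Mg, Ng, hCg, hMg0, hMg1, hNg0, hNg1, hgb⟩ := hgg
  set M₁ := max Mf Mg with hM₁
  set M₂ := max Nf Ng with hM₂
  have m0 : 0 ≤ M₁ := hMf0.trans (le_max_left _ _)
  have m1 : M₁ < min (r / (κ * θ)) (2 * κ / σ ^ 2) := max_lt hMf1 hMg1
  have n0 : 0 ≤ M₂ := hNf0.trans (le_max_left _ _)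
  have n1 : M₂ < 1 := max_lt hNf1 hNg1
  obtain ⟨δ, hδ, hδW⟩ := W0_pos (ρ := ρ) hσ hκ hθ hr hq m0 m1 n0 n1
  have hexp : ∀ {a b : ℝ} (t : ℝ), 0 ≤ a → a ≤ b → exp (a * t) ≤ 1 + exp (b * t) := by
    intro a b t h1 h2
    rcases le_total t 0 with h | h
    · have : exp (a * t) ≤ 1 := exp_le_one_iff.2 (mul_nonpos_of_nonneg_of_nonpos h1 h)
      linarith [exp_pos (b * t)]
    · have : exp (a * t) ≤ exp (b * t) := exp_le_exp.2 (mul_le_mul_of_nonneg_right h2 h)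
      linarith
  have h3 : ∀ (a b : ℝ) (z : ℝ × ℝ), 0 ≤ a → a ≤ M₁ → 0 ≤ b → b ≤ M₂ → 1 + exp (a * z.2) + exp (b * z.1) ≤ 3 * W0 M₁ M₂ z := by
    intro a b z h1 h2 h3 h4
    have e1 := hexp z.2 h1 h2
    have e2 := hexp z.1 h3 h4
    unfold W0
    linarith [exp_pos (M₁ * z.2), exp_pos (M₂ * z.1)]
  have hW1 : ∀ z, 1 ≤ W0 M₁ M₂ z := fun z => by
    unfold W0
    linarith [exp_pos (M₁ * z.2), exp_pos (M₂ * z.1)]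
  have hW0 : ∀ z, 0 < W0 M₁ M₂ z := fun z => one_pos.trans_le (hW1 z)
  have hWs := W0_smooth M₁ M₂
  have hfb' : ∀ z ∈ O, |f z| ≤ 3 * Cf * W0 M₁ M₂ z := fun z hz => by
    have := mul_le_mul_of_nonneg_left (h3 Mf Nf z hMf0 (le_max_left _ _) hNf0 (le_max_left _ _)) hCf.le
    linarith [hfb z hz]
  have hgb' : ∀ z ∈ frontier O, |g z| ≤ 3 * Cg * W0 M₁ M₂ z := fun z hz => by
    have := mul_le_mul_of_nonneg_left (h3 Mg Ng z hMg0 (le_max_right _ _) hNg0 (le_max_right _ _)) hCg.le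
    linarith [hgb z hz]
  set C := 3 * Cg + 3 * Cf + (3 * Cf + 1) / δ with hC
  have c1 : 0 ≤ (3 * Cf + 1) / δ := by positivity
  have hC0 : 0 < C := by positivity
  -- extension of the boundary data
  obtain ⟨G, hGc, hGW, hGg⟩ : ∃ G : ℝ × ℝ → ℝ, Continuous G ∧ (∀ z, |G z| ≤ C * W0 M₁ M₂ z) ∧ ∀ z ∈ frontier O, G z = g z := by
    have hcr : Continuous (fun z : frontier O => g z / W0 M₁ M₂ z) :=
      (continuousOn_iff_continuous_domRestrict.1 hg).div (hWs.continuous.comp continuous_subtype_val) (fun z => (hW0 z).ne')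
    obtain ⟨Γ, hΓ1, hΓ2⟩ := ContinuousMap.exists_restrict_eq_forall_mem_of_closed (⟨_, hcr⟩ : C(frontier O, ℝ)) (t := Icc (-C) C)
      (fun z => by
        have hb := hgb' z z.2
        show g z / W0 M₁ M₂ z ∈ Icc (-C) C
        rw [mem_Icc, ← abs_le, abs_div, abs_of_pos (hW0 z), div_le_iff₀ (hW0 z)]
        refine hb.trans (mul_le_mul_of_nonneg_right ?_ (hW0 z).le)
        rw [hC]; linarith) ⟨0, by constructor <;> linarith⟩ isClosed_frontier
    refine ⟨fun z => Γ z * W0 M₁ M₂ z, Γ.continuous.mul hWs.continuous, fun z => ?_, fun z hz => ?_⟩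
    · rw [abs_mul, abs_of_pos (hW0 z)]
      exact mul_le_mul_of_nonneg_right (abs_le.2 (hΓ1 z)) (hW0 z).le
    · have := DFunLike.congr_fun hΓ2 ⟨z, hz⟩
      have e : Γ z = g z / W0 M₁ M₂ z := this
      show Γ z * W0 M₁ M₂ z = g z
      rw [e]; exact div_mul_cancel₀ _ (hW0 z).ne'
  have hLW : ∀ z ∈ O, (hop σ ρ κ θ q r).L (fun z => C * W0 M₁ M₂ z) z = C * hestonA σ ρ κ θ q r (W0 M₁ M₂) z := by
    intro z hz
    have := HOp.L_affine (P := hop σ ρ κ θ q r) (hWs.contDiffAt.of_le two_le_infty (x := z)) 0 C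
    simp only [zero_add, mul_zero] at this
    rw [this, heston_eq hσ hρ₁ hρ₂ (hWs.contDiffAt.of_le two_le_infty)]
  obtain ⟨v, hv2, hvL, hveq, hvW, hvb⟩ := HOp.exists_sol (P := hop σ ρ κ θ q r) (O := O) (f := f) (G := G) (W := fun z => C * W0 M₁ M₂ z)
    (hop_good hr) (hop_frame hσ hρ₁ hρ₂) hO (fun z hz => half_pos (hOsub hz)) hα₀ hα₁ (fun z hz => LH.of_loc hO hf hz) hGc
    (continuous_const.mul hWs.continuous) (fun z => mul_pos hC0 (hW0 z))
    (fun z _ => (contDiff_const.mul hWs).contDiffAt.of_le two_le_infty) hGW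
    (fun z hz => by
      rw [hLW z hz]
      have k1 := mul_le_mul_of_nonneg_left (hδW z (hOsub hz)) hC0.le
      have k2 : (3 * Cf + 1) ≤ C * δ := by
        rw [hC, add_mul, div_mul_cancel₀ _ hδ.ne']
        have : 0 ≤ (3 * Cg + 3 * Cf) * δ := by positivity
        linarith
      have k3 := mul_le_mul_of_nonneg_right k2 (hW0 z).le
      nlinarith [hfb' z hz, hW1 z])
    (fun z hz => (hfb' z hz).trans (mul_le_mul_of_nonneg_right (by rw [hC]; linarith) (hW0 z).le))
  have hbar : ∀ z ∈ frontier O, (hop σ ρ κ θ q r).Barrier O z := by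
    intro z hz
    have hcl : closure O ⊆ {z | 0 ≤ z.2} :=
      closure_minimal (fun z hz => le_of_lt (show (0:ℝ) < z.2 from hOsub hz)) (isClosed_le continuous_const continuous_snd)
    have hz2 : 0 ≤ z.2 := hcl (frontier_subset_closure hz)
    rcases hz2.lt_or_eq with h | h
    · exact barrier_ext hσ hρ₁ hρ₂ hO ⟨hz, h⟩ hsphere
    · exact barrier_zero hσ hρ₁ hρ₂ hκ hθ hr hβ₁ hOsub h.symm
  classical
  set u : ℝ × ℝ → ℝ := O.piecewise v G with hu
  have huv : ∀ z ∈ O, u =ᶠ[𝓝 z] v := fun z hz => by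
    filter_upwards [hO.mem_nhds hz] with y hy
    exact piecewise_eq_of_mem _ _ _ hy
  have hfrn : ∀ z ∈ frontier O, z ∉ O := fun z hz h => hz.2 (hO.interior_eq.symm ▸ h)
  have huG : ∀ z ∈ frontier O, u z = G z := fun z hz => piecewise_eq_of_notMem _ _ _ (hfrn z hz)
  have hu2 : ∀ z ∈ O, ContDiffAt ℝ 2 u z := fun z hz => (hv2 z hz).congr_of_eventuallyEq (huv z hz)
  refine ⟨u, ?_, C2alpha_of hα₀ hα₁ hu2 ?_, ⟨C, M₁, M₂, hC0, m0, m1, n0, n1, fun z hz => ?_⟩, fun z hz => ?_, fun z hz => ?_⟩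
  · intro z hz
    by_cases hzO : z ∈ O
    · exact (hu2 z hzO).continuousAt.continuousWithinAt
    · have hzf : z ∈ frontier O := ⟨hz, fun h => hzO (interior_subset h)⟩
      have hsub : closure O ⊆ O ∪ frontier O := fun y hy => by
        by_cases h : y ∈ O
        · exact Or.inl h
        · exact Or.inr ⟨hy, fun h' => h (interior_subset h')⟩
      refine ContinuousWithinAt.mono ?_ hsub
      show Tendsto u (𝓝[O ∪ frontier O] z) (𝓝 (u z))
      rw [nhdsWithin_union, huG z hzf]
      refine Tendsto.sup ?_ ?_
      · refine (hvb z (hbar z hzf)).congr' ?_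
        filter_upwards [self_mem_nhdsWithin] with y hy
        exact (piecewise_eq_of_mem _ _ _ hy).symm
      · refine ((hGc.tendsto z).mono_left nhdsWithin_le_nhds).congr' ?_
        filter_upwards [self_mem_nhdsWithin] with y hy
        exact (huG y hy).symm
  · intro z hz a b
    refine (hvL z hz a b).congr ?_
    exact dd_eventuallyEq (dd_eventuallyEq (huv z hz).symm)
  · rw [(huv z hz).eq_of_nhds]
    refine (hvW z hz).trans (le_of_eq ?_)
    unfold W0; ring
  · rw [← heston_eq hσ hρ₁ hρ₂ (hu2 z hz), ← hveq z hz]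
    unfold HOp.L
    rw [dd_congr (dd_eventuallyEq (huv z hz)), dd_congr (dd_eventuallyEq (huv z hz)), dd_congr (huv z hz), dd_congr (huv z hz), (huv z hz).eq_of_nhds]
  · rw [huG z hz, hGg z hz]

end Main

end
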